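/- For every integer p with 2 ≤ p ≤ p̄, the quantity (ln(e+t))^{−p} ∫ (|x|² + |y|² + |z|²)^p m_t(x,y,z) dx dy dz is bounded uniformly over t ≥ 0. -/

import Mathlib

noncomputable section

open Real MeasureTheory Filter

/-- The state space ℝⁿ × ℝⁿ × ℝᵐ. -/
abbrev St (n m : ℕ) := (Fin n → ℝ) × (Fin n → ℝ) × (Fin m → ℝ)

/-- `i`-th component of the gradient of a function on ℝᵏ. -/
def gradp {k : ℕ} (U : (Fin k → ℝ) → ℝ) (x : Fin k → ℝ) (i : Fin k) : ℝ :=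
  fderiv ℝ U x (Pi.single i 1)

/-- Partial derivative in the `i`-th x-coordinate. -/
def pX {n m : ℕ} (f : St n m → ℝ) (i : Fin n) (p : St n m) : ℝ :=
  fderiv ℝ f p (Pi.single i 1, 0, 0)

/-- Partial derivative in the `i`-th y-coordinate. -/
def pY {n m : ℕ} (f : St n m → ℝ) (i : Fin n) (p : St n m) : ℝ :=
  fderiv ℝ f p (0, Pi.single i 1, 0)

/-- Partial derivative in the `j`-th z-coordinate. -/
def pZ {n m : ℕ} (f : St n m → ℝ) (j : Fin m) (p : St n m) : ℝ :=
  fderiv ℝ f p (0, 0, Pi.single j 1)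

/-- Squared Euclidean norm of a vector. -/
def sqnorm {k : ℕ} (v : Fin k → ℝ) : ℝ := ∑ i, (v i) ^ 2

/-- Squared Euclidean norm of the full gradient. -/
def gradSq {n m : ℕ} (f : St n m → ℝ) (p : St n m) : ℝ :=
  (∑ i, (pX f i p) ^ 2) + (∑ i, (pY f i p) ^ 2) + (∑ j, (pZ f j p) ^ 2)

/-- The Hamiltonian W(x,y,z) = U(x) + |y|²/2 + |z|²/2. -/
def Wfun {n m : ℕ} (U : (Fin n → ℝ) → ℝ) (p : St n m) : ℝ :=
  U p.1 + sqnorm p.2.1 / 2 + sqnorm p.2.2 / 2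

/-- Normalizing constant Z_T. -/
def Zpart (n m : ℕ) (U : (Fin n → ℝ) → ℝ) (T : ℝ) : ℝ :=
  ∫ p : St n m, Real.exp (-(Wfun U p) / T)

/-- Density of the instantaneous equilibrium μ_T w.r.t. Lebesgue. -/
def muDen (n m : ℕ) (U : (Fin n → ℝ) → ℝ) (T : ℝ) (p : St n m) : ℝ :=
  Real.exp (-(Wfun U p) / T) / Zpart n m U T

/-- The Gibbs measure μ_T ∝ exp(−W/T). -/
def muT (n m : ℕ) (U : (Fin n → ℝ) → ℝ) (T : ℝ) : Measure (St n m) :=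
  volume.withDensity fun p => ENNReal.ofReal (muDen n m U T p)

/-- Generator of the generalised Langevin dynamics at temperature T. -/
def genL {n m : ℕ} (U : (Fin n → ℝ) → ℝ) (A : Matrix (Fin m) (Fin m) ℝ)
    (lam : Matrix (Fin m) (Fin n) ℝ) (T : ℝ) (f : St n m → ℝ) (p : St n m) : ℝ :=
  (∑ i, p.2.1 i * pX f i p)
    - (∑ i, gradp U p.1 i * pY f i p)
    + (∑ i, (lam.transpose.mulVec p.2.2) i * pY f i p)
    - (∑ j, (lam.mulVec p.2.1) j * pZ f j p)
    - T⁻¹ * (∑ j, (A.transpose.mulVec p.2.2) j * pZ f j p)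
    + (∑ i, ∑ j, A i j * pZ (fun q => pZ f j q) i p)

/-- Formal L²(μ_T)-adjoint of the generator. -/
def genLstar {n m : ℕ} (U : (Fin n → ℝ) → ℝ) (A : Matrix (Fin m) (Fin m) ℝ)
    (lam : Matrix (Fin m) (Fin n) ℝ) (T : ℝ) (h : St n m → ℝ) (p : St n m) : ℝ :=
  -(∑ i, p.2.1 i * pX h i p)
    + (∑ i, gradp U p.1 i * pY h i p)
    - (∑ i, (lam.transpose.mulVec p.2.2) i * pY h i p)
    + (∑ j, (lam.mulVec p.2.1) j * pZ h j p)
    - T⁻¹ * (∑ j, (A.mulVec p.2.2) j * pZ h j p)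
    + (∑ i, ∑ j, A i j * pZ (fun q => pZ h j q) i p)

/-- Formal Lebesgue adjoint L_T^⊤ (Fokker–Planck operator). -/
def genLadj {n m : ℕ} (U : (Fin n → ℝ) → ℝ) (A : Matrix (Fin m) (Fin m) ℝ)
    (lam : Matrix (Fin m) (Fin n) ℝ) (T : ℝ) (g : St n m → ℝ) (p : St n m) : ℝ :=
  -(∑ i, p.2.1 i * pX g i p)
    + (∑ i, (gradp U p.1 i - (lam.transpose.mulVec p.2.2) i) * pY g i p)
    + (∑ j, ((lam.mulVec p.2.1) j + T⁻¹ * (A.transpose.mulVec p.2.2) j) * pZ g j p)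
    + T⁻¹ * A.trace * g p
    + (∑ i, ∑ j, A i j * pZ (fun q => pZ g j q) i p)

/-- Operator norm of a matrix (Euclidean → Euclidean). -/
def opNorm {a b : ℕ} (M : Matrix (Fin a) (Fin b) ℝ) : ℝ :=
  sSup {c : ℝ | ∃ v : Fin b → ℝ, sqnorm v ≤ 1 ∧ c = Real.sqrt (sqnorm (M.mulVec v))}

/-- The Lyapunov function R(x,y,z,T). -/
def Rfun {n m : ℕ} (U : (Fin n → ℝ) → ℝ) (lamInv : Matrix (Fin n) (Fin m) ℝ)
    (δ T : ℝ) (p : St n m) : ℝ :=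
  Wfun U p + δ * T * ((∑ i, p.2.1 i * (lamInv.mulVec p.2.2) i) + (∑ i, p.1 i * p.2.1 i) / 2)

/-- Full gradient indexed by x-, y-, z-coordinates. -/
def fullGrad {n m : ℕ} (f : St n m → ℝ) (p : St n m) : (Fin n ⊕ (Fin n ⊕ Fin m)) → ℝ :=
  Sum.elim (fun i => pX f i p) (Sum.elim (fun i => pY f i p) (fun j => pZ f j p))

/-- Gateaux derivative dΦ(h).g of a map on functions. -/
def gateaux {n m : ℕ} (Φ : (St n m → ℝ) → St n m → ℝ) (h g : St n m → ℝ) (p : St n m) : ℝ :=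
  deriv (fun s : ℝ => Φ (fun q => h q + s * g q) p) 0

/-- Γ_{L_T*,Φ}(h) := ½ (L_T*(Φ(h)) − dΦ(h).(L_T* h)). -/
def GammaPhi {n m : ℕ} (U : (Fin n → ℝ) → ℝ) (A : Matrix (Fin m) (Fin m) ℝ)
    (lam : Matrix (Fin m) (Fin n) ℝ) (T : ℝ)
    (Φ : (St n m → ℝ) → St n m → ℝ) (h : St n m → ℝ) (p : St n m) : ℝ :=
  (genLstar U A lam T (Φ h) p - gateaux Φ h (genLstar U A lam T h) p) / 2

/-- Φ₁(h) = |2∇ₓh + 8S₀(∇_y h + λ⁻¹∇_z h)|²/h. -/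
def Phi1 {n m : ℕ} (lamInv : Matrix (Fin n) (Fin m) ℝ) (S0 : ℝ)
    (g : St n m → ℝ) (p : St n m) : ℝ :=
  (∑ i, (2 * pX g i p + 8 * S0 * (pY g i p + (lamInv.mulVec fun j => pZ g j p) i)) ^ 2) / g p

/-- Φ₂(h) = |∇_y h + S₁λ⁻¹∇_z h|²/h. -/
def Phi2 {n m : ℕ} (lamInv : Matrix (Fin n) (Fin m) ℝ) (S1 : ℝ)
    (g : St n m → ℝ) (p : St n m) : ℝ :=
  (∑ i, (pY g i p + S1 * (lamInv.mulVec fun j => pZ g j p) i) ^ 2) / g p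

/-- β(s) = 1 + β₀ + β₁ s + β₂ s². -/
def betaP (β0 β1 β2 s : ℝ) : ℝ := 1 + β0 + β1 * s + β2 * s ^ 2

/-- Ψ_T(h) = Φ₁(h) + Φ₂(h) + β·h ln h. -/
def PsiT {n m : ℕ} (lamInv : Matrix (Fin n) (Fin m) ℝ) (S0 S1 βc : ℝ)
    (g : St n m → ℝ) (p : St n m) : ℝ :=
  Phi1 lamInv S0 g p + Phi2 lamInv S1 g p + βc * (g p * Real.log (g p))

/-- λ̂² = max(|λ|², |λᵀ|², |λ⁻¹|², |λ⁻¹||λᵀ|). -/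
def lamhatSq {n m : ℕ} (lam : Matrix (Fin m) (Fin n) ℝ)
    (lamInv : Matrix (Fin n) (Fin m) ℝ) : ℝ :=
  max (max (opNorm lam ^ 2) (opNorm lam.transpose ^ 2))
    (max (opNorm lamInv ^ 2) (opNorm lamInv * opNorm lam.transpose))

section MomentBounds

set_option linter.unusedSectionVars false

open scoped Topology ContDiff

/-- The first point of `S` strictly to the right of `τ`. -/
def gapRight (S : Set ℝ) (τ : ℝ) : ℝ := sInf (S ∩ Set.Ioi τ)

/-- The last point of `S` weakly to the left of `τ`. -/
def gapLeft (S : Set ℝ) (τ : ℝ) : ℝ := sSup (S ∩ Set.Iic τ)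

open Classical in
/-- The derivative `f'` at points of `S` not isolated on the right, and the slope of `f` across a
gap of `S` inside that gap. -/
def gapSlope (S : Set ℝ) (f f' : ℝ → ℝ) (τ : ℝ) : ℝ :=
  if τ < gapRight S τ then
    (f (gapRight S τ) - f (gapLeft S τ)) / (gapRight S τ - gapLeft S τ)
  else f' τ

open Classical in
/-- `f` on `S`, interpolated linearly across the gaps of `S`. -/
def gapInterp (S : Set ℝ) (f : ℝ → ℝ) (τ : ℝ) : ℝ :=
  if τ ∈ S then f τ else
    f (gapLeft S τ) + (τ - gapLeft S τ) *
      ((f (gapRight S τ) - f (gapLeft S τ)) / (gapRight S τ - gapLeft S τ))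

section Gap

variable {S : Set ℝ} {a b : ℝ}

theorem nonempty_inter_Ioi (hb : Set.Ici b ⊆ S) (τ : ℝ) : (S ∩ Set.Ioi τ).Nonempty :=
  ⟨max b (τ + 1), hb (Set.mem_Ici.2 (le_max_left _ _)),
    lt_of_lt_of_le (lt_add_one τ) (le_max_right _ _)⟩

theorem nonempty_inter_Iic (ha : Set.Iic a ⊆ S) (τ : ℝ) : (S ∩ Set.Iic τ).Nonempty :=
  ⟨min a τ, ha (Set.mem_Iic.2 (min_le_left _ _)), Set.mem_Iic.2 (min_le_right _ _)⟩

theorem bddBelow_inter_Ioi (S : Set ℝ) (τ : ℝ) : BddBelow (S ∩ Set.Ioi τ) :=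
  ⟨τ, fun _ hx => le_of_lt hx.2⟩

theorem bddAbove_inter_Iic (S : Set ℝ) (τ : ℝ) : BddAbove (S ∩ Set.Iic τ) :=
  ⟨τ, fun _ hx => hx.2⟩

theorem le_gapRight (hb : Set.Ici b ⊆ S) (τ : ℝ) : τ ≤ gapRight S τ :=
  le_csInf (nonempty_inter_Ioi hb τ) fun _ hx => le_of_lt hx.2

theorem gapRight_le {τ c : ℝ} (hc : c ∈ S) (h : τ < c) : gapRight S τ ≤ c :=
  csInf_le (bddBelow_inter_Ioi S τ) ⟨hc, h⟩

theorem gapLeft_le (ha : Set.Iic a ⊆ S) (τ : ℝ) : gapLeft S τ ≤ τ :=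
  csSup_le (nonempty_inter_Iic ha τ) fun _ hx => hx.2

theorem le_gapLeft {τ c : ℝ} (hc : c ∈ S) (h : c ≤ τ) : c ≤ gapLeft S τ :=
  le_csSup (bddAbove_inter_Iic S τ) ⟨hc, h⟩

theorem gapLeft_mem (hS : IsClosed S) (ha : Set.Iic a ⊆ S) (τ : ℝ) : gapLeft S τ ∈ S :=
  ((hS.inter isClosed_Iic).csSup_mem (nonempty_inter_Iic ha τ) (bddAbove_inter_Iic S τ)).1

theorem gapRight_mem (hS : IsClosed S) (hb : Set.Ici b ⊆ S) (τ : ℝ) : gapRight S τ ∈ S :=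
  hS.closure_subset (closure_mono Set.inter_subset_left
    (csInf_mem_closure (nonempty_inter_Ioi hb τ) (bddBelow_inter_Ioi S τ)))

theorem lt_gapRight_of_notMem (hS : IsClosed S) (hb : Set.Ici b ⊆ S) {τ : ℝ} (h : τ ∉ S) :
    τ < gapRight S τ :=
  lt_of_le_of_ne (le_gapRight hb τ) fun e => h (e ▸ gapRight_mem hS hb τ)

theorem gapLeft_lt_of_notMem (hS : IsClosed S) (ha : Set.Iic a ⊆ S) {τ : ℝ} (h : τ ∉ S) :
    gapLeft S τ < τ :=
  lt_of_le_of_ne (gapLeft_le ha τ) fun e => h (e ▸ gapLeft_mem hS ha τ)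

theorem notMem_of_gap {τ σ : ℝ} (h1 : gapLeft S τ < σ) (h2 : σ < gapRight S τ) :
    σ ∉ S := fun h => by
  rcases le_or_gt σ τ with hle | hlt
  · exact absurd (le_gapLeft h hle) (not_le.2 h1)
  · exact absurd (gapRight_le h hlt) (not_le.2 h2)

theorem gap_eq_of_mem (hS : IsClosed S) (ha : Set.Iic a ⊆ S) (hb : Set.Ici b ⊆ S) {τ σ : ℝ}
    (h1 : gapLeft S τ < σ) (h2 : σ < gapRight S τ) :
    gapLeft S σ = gapLeft S τ ∧ gapRight S σ = gapRight S τ := by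
  constructor
  · refine le_antisymm ?_ (le_gapLeft (gapLeft_mem hS ha τ) h1.le)
    by_contra! h
    exact notMem_of_gap h ((gapLeft_le ha σ).trans_lt h2) (gapLeft_mem hS ha σ)
  · refine le_antisymm (gapRight_le (gapRight_mem hS hb τ) h2) ?_
    by_contra! h
    exact notMem_of_gap (h1.trans_le (le_gapRight hb σ)) h (gapRight_mem hS hb σ)

theorem monotone_gapRight (hb : Set.Ici b ⊆ S) : Monotone (gapRight S) := fun x y hxy =>
  csInf_le_csInf (bddBelow_inter_Ioi S x) (nonempty_inter_Ioi hb y)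
    fun _ hz => ⟨hz.1, hxy.trans_lt hz.2⟩

theorem monotone_gapLeft (ha : Set.Iic a ⊆ S) : Monotone (gapLeft S) := fun x y hxy =>
  csSup_le_csSup (bddAbove_inter_Iic S y) (nonempty_inter_Iic ha x)
    fun _ hz => ⟨hz.1, le_trans hz.2 hxy⟩

/-- Across a gap, including both of its end points, the interpolation is affine. -/
theorem gapInterp_eq_affine (hS : IsClosed S) (ha : Set.Iic a ⊆ S) (hb : Set.Ici b ⊆ S)
    (f : ℝ → ℝ) {τ σ : ℝ} (hlt : gapLeft S τ < gapRight S τ) (h1 : gapLeft S τ ≤ σ)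
    (h2 : σ ≤ gapRight S τ) :
    gapInterp S f σ = f (gapLeft S τ) + (σ - gapLeft S τ) *
      ((f (gapRight S τ) - f (gapLeft S τ)) / (gapRight S τ - gapLeft S τ)) := by
  have hne : gapRight S τ - gapLeft S τ ≠ 0 := (sub_pos.2 hlt).ne'
  rcases h1.eq_or_lt with e1 | l1
  · rw [gapInterp, if_pos (e1 ▸ gapLeft_mem hS ha τ), ← e1]; simp
  rcases h2.eq_or_lt with e2 | l2
  · rw [gapInterp, if_pos (e2 ▸ gapRight_mem hS hb τ), e2]; field_simp; ring
  · obtain ⟨e1, e2⟩ := gap_eq_of_mem hS ha hb l1 l2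
    rw [gapInterp, if_neg (notMem_of_gap l1 l2), e1, e2]

/-- The interpolation stays as close to an affine function as `f` does on `S`. -/
theorem abs_gapInterp_sub_le (hS : IsClosed S) (ha : Set.Iic a ⊆ S) (hb : Set.Ici b ⊆ S)
    (f : ℝ → ℝ) {σ y k τ A B ε : ℝ}
    (hA : ∀ c ∈ S, A ≤ c → c ≤ B → |f c - y - (c - τ) * k| ≤ ε * (c - A))
    (hl : A ≤ gapLeft S σ) (hr : σ ∉ S → gapRight S σ ≤ B) (hσ : σ ≤ B) :
    |gapInterp S f σ - y - (σ - τ) * k| ≤ ε * (σ - A) := by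
  by_cases hmem : σ ∈ S
  · rw [gapInterp, if_pos hmem]
    exact hA σ hmem (hl.trans (gapLeft_le ha σ)) hσ
  have h1 := gapLeft_lt_of_notMem hS ha hmem
  have h2 := lt_gapRight_of_notMem hS hb hmem
  have hL := hA _ (gapLeft_mem hS ha σ) hl (h1.le.trans hσ)
  have hR := hA _ (gapRight_mem hS hb σ) (hl.trans (h1.le.trans h2.le)) (hr hmem)
  rw [gapInterp, if_neg hmem]
  set l := gapLeft S σ
  set r := gapRight S σ
  have hpos : 0 < r - l := by linarith
  obtain ⟨θ, hθ⟩ : ∃ θ, θ = (σ - l) / (r - l) := ⟨_, rfl⟩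
  have hθ0 : 0 ≤ θ := hθ ▸ div_nonneg (by linarith) hpos.le
  have hθ1 : θ ≤ 1 := by rw [hθ, div_le_one hpos]; linarith
  have hσ' : σ = (1 - θ) * l + θ * r := by rw [hθ]; field_simp; ring
  have e : f l + (σ - l) * ((f r - f l) / (r - l)) = (1 - θ) * f l + θ * f r := by
    rw [hθ]; field_simp; ring
  have e1 : (1 - θ) * f l + θ * f r - y - (σ - τ) * k =
      (1 - θ) * (f l - y - (l - τ) * k) + θ * (f r - y - (r - τ) * k) := by
    linear_combination -k * hσ'
  have e2 : ε * (σ - A) = (1 - θ) * (ε * (l - A)) + θ * (ε * (r - A)) := by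
    linear_combination ε * hσ'
  rw [e, e1, e2]
  refine (abs_add_le _ _).trans (add_le_add ?_ ?_)
  · rw [abs_mul, abs_of_nonneg (sub_nonneg.2 hθ1)]
    exact mul_le_mul_of_nonneg_left hL (sub_nonneg.2 hθ1)
  · rw [abs_mul, abs_of_nonneg hθ0]
    exact mul_le_mul_of_nonneg_left hR hθ0

theorem hasDerivWithinAt_gapInterp (hS : IsClosed S) (ha : Set.Iic a ⊆ S) (hb : Set.Ici b ⊆ S)
    {f f' : ℝ → ℝ} {τ : ℝ} (hf : τ ∈ S → HasDerivWithinAt f (f' τ) (Set.Ioi τ) τ) :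
    HasDerivWithinAt (gapInterp S f) (gapSlope S f f' τ) (Set.Ioi τ) τ := by
  by_cases hlt : τ < gapRight S τ
  · rw [gapSlope, if_pos hlt]
    have hl := gapLeft_le ha τ
    set k := (f (gapRight S τ) - f (gapLeft S τ)) / (gapRight S τ - gapLeft S τ) with hk
    have haff : HasDerivWithinAt (fun σ => f (gapLeft S τ) + (σ - gapLeft S τ) * k) k
        (Set.Ioi τ) τ := by
      simpa using ((((hasDerivAt_id τ).sub_const (gapLeft S τ)).mul_const k).const_add
        (f (gapLeft S τ))).hasDerivWithinAt
    refine haff.congr_of_eventuallyEq ?_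
      (gapInterp_eq_affine hS ha hb f (hl.trans_lt hlt) hl hlt.le)
    filter_upwards [Ioo_mem_nhdsGT hlt] with σ hσ
    exact gapInterp_eq_affine hS ha hb f (hl.trans_lt hlt) (hl.trans hσ.1.le) hσ.2.le
  · have he : gapRight S τ = τ := le_antisymm (not_lt.1 hlt) (le_gapRight hb τ)
    have hmem : τ ∈ S := he ▸ gapRight_mem hS hb τ
    rw [gapSlope, if_neg hlt]
    have h := hf hmem
    rw [hasDerivWithinAt_iff_isLittleO, Asymptotics.isLittleO_iff] at h ⊢
    intro ε hε
    have h1 := h hε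
    obtain ⟨u, hu, hsub⟩ := mem_nhdsGT_iff_exists_Ioo_subset.1 h1
    obtain ⟨c, hc, hcu⟩ : ∃ c ∈ S ∩ Set.Ioi τ, c < u :=
      exists_lt_of_csInf_lt (nonempty_inter_Ioi hb τ) (by
        change gapRight S τ < u; rw [he]; exact hu)
    have hcτ : τ < c := hc.2
    filter_upwards [Ioo_mem_nhdsGT hcτ] with σ hσ
    have := abs_gapInterp_sub_le (τ := τ) (A := τ) (B := c) (y := f τ) (k := f' τ) hS ha hb f
      (ε := ε)
      (σ := σ) ?_ (le_gapLeft hmem hσ.1.le) (fun _ => gapRight_le hc.1 hσ.2) hσ.2.le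
    · have e : gapInterp S f τ = f τ := by rw [gapInterp, if_pos hmem]
      rw [e, smul_eq_mul, Real.norm_eq_abs, Real.norm_eq_abs, abs_of_pos (sub_pos.2 hσ.1)]
      exact this
    · intro d _ hd1 hd2
      rcases hd1.eq_or_lt with rfl | hd1
      · simp
      have := hsub ⟨hd1, hd2.trans_lt hcu⟩
      simp only [Set.mem_ofPred_eq, smul_eq_mul, Real.norm_eq_abs] at this
      rwa [abs_of_pos (sub_pos.2 hd1)] at this

theorem continuous_gapInterp (hS : IsClosed S) (ha : Set.Iic a ⊆ S) (hb : Set.Ici b ⊆ S)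
    {f : ℝ → ℝ} (hf : Continuous f) : Continuous (gapInterp S f) := by
  have key : ∀ (τ σ B A ε : ℝ), 0 ≤ ε → (∀ c, A ≤ c → c ≤ B → |f c - f τ| ≤ ε) →
      A ≤ gapLeft S σ → (σ ∉ S → gapRight S σ ≤ B) → σ ≤ B → |gapInterp S f σ - f τ| ≤ ε := by
    intro τ σ B A ε hε hA hl hr hσ
    by_cases hmem : σ ∈ S
    · rw [gapInterp, if_pos hmem]
      exact hA σ (hl.trans (gapLeft_le ha σ)) hσ
    have h1 := gapLeft_lt_of_notMem hS ha hmem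
    have h2 := lt_gapRight_of_notMem hS hb hmem
    have hL := hA _ hl (h1.le.trans hσ)
    have hR := hA _ (hl.trans (h1.le.trans h2.le)) (hr hmem)
    rw [gapInterp, if_neg hmem]
    set l := gapLeft S σ
    set r := gapRight S σ
    have hpos : 0 < r - l := by linarith
    obtain ⟨θ, hθ⟩ : ∃ θ, θ = (σ - l) / (r - l) := ⟨_, rfl⟩
    have hθ0 : 0 ≤ θ := hθ ▸ div_nonneg (by linarith) hpos.le
    have hθ1 : θ ≤ 1 := by rw [hθ, div_le_one hpos]; linarith
    have e : f l + (σ - l) * ((f r - f l) / (r - l)) = (1 - θ) * f l + θ * f r := by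
      rw [hθ]; field_simp; ring
    rw [e]
    rw [abs_le] at hL hR ⊢
    constructor <;> nlinarith
  have aff : ∀ τ, gapLeft S τ < gapRight S τ →
      ContinuousOn (gapInterp S f) (Set.Icc (gapLeft S τ) (gapRight S τ)) := by
    intro τ hlt
    refine ContinuousOn.congr (f := fun σ => f (gapLeft S τ) + (σ - gapLeft S τ) *
      ((f (gapRight S τ) - f (gapLeft S τ)) / (gapRight S τ - gapLeft S τ))) ?_ ?_
    · exact Continuous.continuousOn (by fun_prop)
    · intro σ hσ
      exact gapInterp_eq_affine hS ha hb f hlt hσ.1 hσ.2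
  rw [continuous_iff_continuousAt]
  intro τ
  rw [continuousAt_iff_continuous_left'_right']
  have e : τ ∈ S → gapInterp S f τ = f τ := fun h => by rw [gapInterp, if_pos h]
  constructor
  · by_cases hgap : ∃ c < τ, ∀ σ ∈ Set.Ioo c τ, σ ∉ S
    · obtain ⟨c, hc, hcS⟩ := hgap
      obtain ⟨σ, hσ⟩ := exists_between hc
      have hn := hcS σ hσ
      have h1 := gapLeft_lt_of_notMem hS ha hn
      have h2 := lt_gapRight_of_notMem hS hb hn
      have h3 : τ ≤ gapRight S σ := by
        by_contra! h
        exact hcS _ ⟨hσ.1.trans h2, h⟩ (gapRight_mem hS hb σ)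
      have := aff σ (h1.trans h2) τ ⟨(h1.trans hσ.2).le, h3⟩
      refine this.mono_of_mem_nhdsWithin ?_
      filter_upwards [Ioo_mem_nhdsLT (h1.trans hσ.2)] with x hx
      exact ⟨hx.1.le, hx.2.le.trans h3⟩
    · push Not at hgap
      have hmem : τ ∈ S := by
        rw [← hS.closure_eq, Metric.mem_closure_iff]
        intro ε hε
        obtain ⟨c, hc, hcS⟩ := hgap (τ - ε) (by linarith)
        refine ⟨c, hcS, ?_⟩
        rw [Real.dist_eq, abs_lt]; constructor <;> linarith [hc.1, hc.2]
      rw [ContinuousWithinAt, Metric.tendsto_nhds]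
      intro ε hε
      obtain ⟨δ, hδ, hd⟩ := Metric.continuousAt_iff.1 (hf.continuousAt (x := τ)) (ε / 2)
        (half_pos hε)
      obtain ⟨c, hc, hcS⟩ := hgap (τ - δ) (by linarith)
      filter_upwards [Ioo_mem_nhdsLT hc.2] with σ hσ
      rw [e hmem, Real.dist_eq]
      refine lt_of_le_of_lt (key τ σ τ c (ε / 2) (half_pos hε).le ?_ (le_gapLeft hcS hσ.1.le)
        (fun _ => gapRight_le hmem hσ.2) hσ.2.le) (half_lt_self hε)
      intro d hd1 hd2
      refine le_of_lt (hd ?_)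
      rw [Real.dist_eq, abs_lt]; constructor <;> linarith [hc.1]
  · by_cases hlt : τ < gapRight S τ
    · have hl := gapLeft_le ha τ
      refine (aff τ (hl.trans_lt hlt) τ ⟨hl, hlt.le⟩).mono_of_mem_nhdsWithin ?_
      filter_upwards [Ioo_mem_nhdsGT hlt] with x hx
      exact ⟨hl.trans hx.1.le, hx.2.le⟩
    · have he : gapRight S τ = τ := le_antisymm (not_lt.1 hlt) (le_gapRight hb τ)
      have hmem : τ ∈ S := he ▸ gapRight_mem hS hb τ
      rw [ContinuousWithinAt, Metric.tendsto_nhds]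
      intro ε hε
      obtain ⟨δ, hδ, hd⟩ := Metric.continuousAt_iff.1 (hf.continuousAt (x := τ)) (ε / 2)
        (half_pos hε)
      obtain ⟨c, hc, hcu⟩ : ∃ c ∈ S ∩ Set.Ioi τ, c < τ + δ :=
        exists_lt_of_csInf_lt (nonempty_inter_Ioi hb τ) (by
          change gapRight S τ < τ + δ; rw [he]; linarith)
      have hcτ : τ < c := hc.2
      filter_upwards [Ioo_mem_nhdsGT hcτ] with σ hσ
      rw [e hmem, Real.dist_eq]
      refine lt_of_le_of_lt (key τ σ c τ (ε / 2) (half_pos hε).le ?_ (le_gapLeft hmem hσ.1.le)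
        (fun _ => gapRight_le hc.1 hσ.2) hσ.2.le) (half_lt_self hε)
      intro d hd1 hd2
      refine le_of_lt (hd ?_)
      rw [Real.dist_eq, abs_lt]; constructor <;> linarith

/-- Fundamental theorem of calculus for a function with a right derivative on a closed set `S`,
the gaps of `S` being bridged by chords. -/
theorem integral_gapSlope (hS : IsClosed S) (hab : a ≤ b) (ha : Set.Iic a ⊆ S)
    (hb : Set.Ici b ⊆ S) {f f' : ℝ → ℝ} (hf : Continuous f)
    (hd : ∀ τ ∈ S, τ ∈ Set.Ioo a b → HasDerivWithinAt f (f' τ) (Set.Ioi τ) τ)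
    (hi : IntervalIntegrable (gapSlope S f f') volume a b) :
    ∫ τ in a..b, gapSlope S f f' τ = f b - f a := by
  have e1 : gapInterp S f b = f b := by rw [gapInterp, if_pos (hb Set.self_mem_Ici)]
  have e2 : gapInterp S f a = f a := by rw [gapInterp, if_pos (ha Set.self_mem_Iic)]
  rw [← e1, ← e2]
  exact intervalIntegral.integral_eq_sub_of_hasDeriv_right_of_le hab
    (continuous_gapInterp hS ha hb hf).continuousOn
    (fun τ hτ => hasDerivWithinAt_gapInterp hS ha hb fun h => hd τ h hτ) hi

end Gap

section Scheffe

variable {E : Type*} [MeasurableSpace E] {μ : Measure E}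

/-- Scheffé's lemma. -/
theorem tendsto_integral_abs_sub_of_density {X : Type*} {l : Filter X} [l.IsCountablyGenerated]
    {u : X → E → ℝ} {v : E → ℝ} {C : ℝ} (hu : ∀ t, Integrable (u t) μ) (hv : Integrable v μ)
    (hu0 : ∀ t p, 0 ≤ u t p) (hu1 : ∀ t, ∫ p, u t p ∂μ = C) (hv1 : ∫ p, v p ∂μ = C)
    (hlim : ∀ p, Tendsto (fun t => u t p) l (𝓝 (v p))) :
    Tendsto (fun t => ∫ p, |u t p - v p| ∂μ) l (𝓝 0) := by
  have key : Tendsto (fun t => ∫ p, max (v p - u t p) 0 ∂μ) l (𝓝 (∫ _, (0 : ℝ) ∂μ)) := by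
    refine tendsto_integral_filter_of_dominated_convergence (fun p => |v p|) ?_ ?_ hv.abs ?_
    · exact .of_forall fun t => ((hv.sub (hu t)).pos_part).aestronglyMeasurable
    · refine .of_forall fun t => .of_forall fun p => ?_
      rw [Real.norm_eq_abs, abs_of_nonneg (le_max_right _ _)]
      exact max_le (by linarith [hu0 t p, le_abs_self (v p)]) (abs_nonneg _)
    · refine .of_forall fun p => ?_
      have := ((hlim p).const_sub (v p)).max (tendsto_const_nhds (x := (0 : ℝ)))
      simpa using this
  have e : ∀ t, ∫ p, |u t p - v p| ∂μ = 2 * ∫ p, max (v p - u t p) 0 ∂μ := by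
    intro t
    have h : ∀ p, |u t p - v p| = (u t p - v p) + 2 * max (v p - u t p) 0 := by
      intro p
      rcases le_total (u t p) (v p) with h | h
      · rw [abs_of_nonpos (by linarith), max_eq_left (by linarith)]; ring
      · rw [abs_of_nonneg (by linarith), max_eq_right (by linarith)]; ring
    simp_rw [h]
    have hs1 : Integrable (fun p => u t p - v p) μ := (hu t).sub hv
    have hs2 : Integrable (fun p => v p - u t p) μ := hv.sub (hu t)
    rw [integral_add hs1 (hs2.pos_part.const_mul 2),
      integral_sub (hu t) hv, hu1, hv1, integral_const_mul]
    ring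
  simp_rw [e]
  simpa using key.const_mul 2

/-- Integrals of boundedly convergent functions against pointwise convergent densities converge. -/
theorem tendsto_integral_mul_of_density {X : Type*} {l : Filter X} [l.IsCountablyGenerated]
    {u : X → E → ℝ} {v : E → ℝ} {C M : ℝ} (hu : ∀ t, Integrable (u t) μ) (hv : Integrable v μ)
    (hu0 : ∀ t p, 0 ≤ u t p) (hu1 : ∀ t, ∫ p, u t p ∂μ = C) (hv1 : ∫ p, v p ∂μ = C)
    (hlim : ∀ p, Tendsto (fun t => u t p) l (𝓝 (v p)))
    {g : X → E → ℝ} {g₀ : E → ℝ} (hg : ∀ t, AEStronglyMeasurable (g t) μ)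
    (hgM : ∀ᶠ t in l, ∀ p, |g t p| ≤ M)
    (hglim : ∀ p, Tendsto (fun t => g t p) l (𝓝 (g₀ p))) :
    Tendsto (fun t => ∫ p, g t p * u t p ∂μ) l (𝓝 (∫ p, g₀ p * v p ∂μ)) := by
  have h1 : Tendsto (fun t => ∫ p, g t p * v p ∂μ) l (𝓝 (∫ p, g₀ p * v p ∂μ)) := by
    refine tendsto_integral_filter_of_dominated_convergence (fun p => M * |v p|) ?_ ?_
      (hv.abs.const_mul M) ?_
    · exact .of_forall fun t => (hg t).mul hv.aestronglyMeasurable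
    · filter_upwards [hgM] with t ht
      refine .of_forall fun p => ?_
      rw [Real.norm_eq_abs, abs_mul]
      exact mul_le_mul_of_nonneg_right (ht p) (abs_nonneg _)
    · exact .of_forall fun p => (hglim p).mul_const _
  have h2 : Tendsto (fun t => ∫ p, g t p * (u t p - v p) ∂μ) l (𝓝 0) := by
    have := (tendsto_integral_abs_sub_of_density hu hv hu0 hu1 hv1 hlim).const_mul M
    rw [mul_zero] at this
    refine squeeze_zero_norm' ?_ this
    filter_upwards [hgM] with t ht
    rw [← integral_const_mul]
    refine norm_integral_le_of_norm_le (((hu t).sub hv).abs.const_mul M) (.of_forall fun p => ?_)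
    rw [Real.norm_eq_abs, abs_mul]
    exact mul_le_mul_of_nonneg_right (ht p) (abs_nonneg _)
  have h3 := h1.add h2
  rw [add_zero] at h3
  refine h3.congr' ?_
  filter_upwards [hgM] with t ht
  have hb : ∀ f : E → ℝ, Integrable f μ → Integrable (fun p => g t p * f p) μ := fun f hf =>
    hf.bdd_mul (c := M) (hg t) (.of_forall fun p => ht p)
  have hs : Integrable (fun p => u t p - v p) μ := (hu t).sub hv
  rw [← integral_add (hb v hv) (hb _ hs)]
  congr 1; ext p; ring

end Scheffe

section DiffOp

variable {E : Type*} [NormedAddCommGroup E] [NormedSpace ℝ E]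

/-- Directional derivative in a fixed direction. -/
def dirDeriv (v : E) (f : E → ℝ) (p : E) : ℝ := fderiv ℝ f p v

/-- Linear differential operators with smooth coefficients, of order at most `k`. -/
inductive IsDiffOp : ℕ → ((E → ℝ) → E → ℝ) → Prop
  | id : IsDiffOp 0 fun f => f
  | mul {k : ℕ} {P : (E → ℝ) → E → ℝ} {g : E → ℝ} (hg : ContDiff ℝ ∞ g) (hP : IsDiffOp k P) :
      IsDiffOp k fun f p => g p * P f p
  | add {k : ℕ} {P Q : (E → ℝ) → E → ℝ} (hP : IsDiffOp k P) (hQ : IsDiffOp k Q) :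
      IsDiffOp k fun f p => P f p + Q f p
  | deriv {k : ℕ} {P : (E → ℝ) → E → ℝ} (v : E) (hP : IsDiffOp k P) :
      IsDiffOp (k + 1) fun f => dirDeriv v (P f)
  | succ {k : ℕ} {P : (E → ℝ) → E → ℝ} (hP : IsDiffOp k P) : IsDiffOp (k + 1) P

theorem contDiff_dirDeriv (v : E) {f : E → ℝ} (hf : ContDiff ℝ ∞ f) :
    ContDiff ℝ ∞ (dirDeriv v f) :=
  (hf.fderiv_right (m := ∞) le_rfl).clm_apply contDiff_const

theorem tsupport_dirDeriv_subset (v : E) (f : E → ℝ) : tsupport (dirDeriv v f) ⊆ tsupport f := by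
  refine subset_trans (closure_mono fun p hp => ?_) (tsupport_fderiv_subset ℝ (f := f))
  rw [Function.mem_support] at hp ⊢
  intro h
  exact hp (by rw [dirDeriv, h]; simp)

namespace IsDiffOp

variable {k : ℕ} {P : (E → ℝ) → E → ℝ}

theorem contDiff (hP : IsDiffOp k P) {f : E → ℝ} (hf : ContDiff ℝ ∞ f) :
    ContDiff ℝ ∞ (P f) := by
  induction hP with
  | id => exact hf
  | mul hg _ ih => exact hg.mul ih
  | add _ _ ih1 ih2 => exact ih1.add ih2
  | deriv v _ ih => exact contDiff_dirDeriv v ih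
  | succ _ ih => exact ih

theorem tsupport_subset (hP : IsDiffOp k P) (f : E → ℝ) : tsupport (P f) ⊆ tsupport f := by
  induction hP with
  | id => exact subset_rfl
  | mul hg _ ih => exact (tsupport_mul_subset_right).trans ih
  | add _ _ ih1 ih2 => exact (tsupport_add _ _).trans (Set.union_subset ih1 ih2)
  | deriv v _ ih => exact (tsupport_dirDeriv_subset v _).trans ih
  | succ _ ih => exact ih

theorem hasCompactSupport (hP : IsDiffOp k P) {f : E → ℝ} (hf : HasCompactSupport f) :
    HasCompactSupport (P f) :=
  hf.of_isClosed_subset (isClosed_tsupport _) (hP.tsupport_subset f)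

/-- Every differential operator has a formal adjoint. -/
theorem exists_adjoint [FiniteDimensional ℝ E] [MeasurableSpace E] [BorelSpace E] (μ : Measure E)
    [μ.IsAddHaarMeasure] (hP : IsDiffOp k P) : ∀ φ : E → ℝ, ContDiff ℝ ∞ φ → HasCompactSupport φ →
      ∃ ψ : E → ℝ, ContDiff ℝ ∞ ψ ∧ HasCompactSupport ψ ∧
        ∀ f, ContDiff ℝ ∞ f → ∫ p, φ p * P f p ∂μ = ∫ p, ψ p * f p ∂μ := by
  induction hP with
  | id => exact fun φ h1 h2 => ⟨φ, h1, h2, fun _ _ => rfl⟩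
  | @mul _ _ g hg _ ih =>
    intro φ h1 h2
    obtain ⟨ψ, hψ, hψ', h⟩ := ih (φ * g) (h1.mul hg) h2.mul_right
    refine ⟨ψ, hψ, hψ', fun f hf => ?_⟩
    rw [← h f hf]
    congr 1; ext p; simp [mul_assoc]
  | @add _ P Q hP hQ ih1 ih2 =>
    intro φ h1 h2
    obtain ⟨ψ, hψ, hψ', h⟩ := ih1 φ h1 h2
    obtain ⟨ζ, hζ, hζ', h'⟩ := ih2 φ h1 h2
    refine ⟨ψ + ζ, hψ.add hζ, hψ'.add hζ', fun f hf => ?_⟩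
    have i1 : ∀ a b : E → ℝ, ContDiff ℝ ∞ a → HasCompactSupport a → ContDiff ℝ ∞ b →
        Integrable (fun p => a p * b p) μ := fun a b ha ha' hb =>
      (ha.continuous.mul hb.continuous).integrable_of_hasCompactSupport ha'.mul_right
    simp only [mul_add, add_mul, Pi.add_apply]
    rw [integral_add (i1 _ _ h1 h2 (hP.contDiff hf)) (i1 _ _ h1 h2 (hQ.contDiff hf)),
      integral_add (i1 _ _ hψ hψ' hf) (i1 _ _ hζ hζ' hf), h f hf, h' f hf]
  | @deriv _ P v hP ih =>
    intro φ h1 h2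
    have h3 := contDiff_dirDeriv v h1
    have h4 : HasCompactSupport (dirDeriv v φ) :=
      h2.of_isClosed_subset (isClosed_tsupport _) (tsupport_dirDeriv_subset v φ)
    obtain ⟨ψ, hψ, hψ', h⟩ := ih (-dirDeriv v φ) h3.neg h4.neg
    refine ⟨ψ, hψ, hψ', fun f hf => ?_⟩
    rw [← h f hf]
    have hPf := hP.contDiff hf
    have := integral_mul_fderiv_eq_neg_fderiv_mul_of_integrable (μ := μ) (f := φ) (g := P f)
      (v := v) ?_ ?_ ?_ (fun x _ => h1.differentiable (by simp) x)
      (fun x _ => hPf.differentiable (by simp) x)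
    · refine this.trans ?_
      rw [← integral_neg]
      congr 1; ext p; simp [dirDeriv]
    · exact (h3.continuous.mul hPf.continuous).integrable_of_hasCompactSupport h4.mul_right
    · exact (h1.continuous.mul (contDiff_dirDeriv v hPf).continuous).integrable_of_hasCompactSupport
        h2.mul_right
    · exact (h1.continuous.mul hPf.continuous).integrable_of_hasCompactSupport h2.mul_right
  | succ _ ih => exact ih

end IsDiffOp

theorem exists_isDiffOp_iteratedFDeriv (j : ℕ) (m : Fin j → E) : ∃ P, IsDiffOp j P ∧
    ∀ f : E → ℝ, ContDiff ℝ ∞ f → ∀ p, iteratedFDeriv ℝ j f p m = P f p := by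
  induction j with
  | zero => exact ⟨_, .id, fun f _ p => by simp⟩
  | succ j ih =>
    obtain ⟨P, hP, h⟩ := ih (Fin.tail m)
    refine ⟨_, hP.deriv (m 0), fun f hf p => ?_⟩
    have e : P f = fun q => iteratedFDeriv ℝ j f q (Fin.tail m) := funext fun q => (h f hf q).symm
    rw [iteratedFDeriv_succ_apply_left, dirDeriv, e]
    have hd : DifferentiableAt ℝ (iteratedFDeriv ℝ j f) p :=
      (hf.differentiable_iteratedFDeriv (by exact_mod_cast ENat.natCast_lt_top j)) p
    rw [fderiv_continuousMultilinear_apply_const_apply hd]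

/-- A family of smooth functions with derivatives up to order `N` uniformly bounded on `K`. -/
def UnifCk {ι : Type*} (K : Set E) (N : ℕ) (F : ι → E → ℝ) : Prop :=
  (∀ i, ContDiff ℝ ∞ (F i)) ∧ ∃ C, ∀ i, ∀ p ∈ K, ∀ j ≤ N, ‖iteratedFDeriv ℝ j (F i) p‖ ≤ C

namespace UnifCk

variable {ι : Type*} {K : Set E} {N : ℕ} {F G : ι → E → ℝ}

theorem add (hF : UnifCk K N F) (hG : UnifCk K N G) : UnifCk K N fun i p => F i p + G i p := by
  obtain ⟨h1, C, hC⟩ := hF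
  obtain ⟨h2, D, hD⟩ := hG
  refine ⟨fun i => (h1 i).add (h2 i), C + D, fun i p hp j hj => ?_⟩
  have : iteratedFDeriv ℝ j (fun p => F i p + G i p) p =
      iteratedFDeriv ℝ j (F i) p + iteratedFDeriv ℝ j (G i) p :=
    iteratedFDeriv_add_apply ((h1 i).of_le (by exact_mod_cast le_top)).contDiffAt
      ((h2 i).of_le (by exact_mod_cast le_top)).contDiffAt
  rw [this]
  exact (norm_add_le _ _).trans (add_le_add (hC i p hp j hj) (hD i p hp j hj))

theorem mul (hF : UnifCk K N F) (hG : UnifCk K N G) : UnifCk K N fun i p => F i p * G i p := by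
  obtain ⟨h1, C, hC⟩ := hF
  obtain ⟨h2, D, hD⟩ := hG
  refine ⟨fun i => (h1 i).mul (h2 i), 2 ^ N * (|C| * |D|), fun i p hp j hj => ?_⟩
  refine (norm_iteratedFDeriv_mul_le (N := ∞) (h1 i) (h2 i) p
    (by exact_mod_cast le_top)).trans ?_
  calc ∑ a ∈ Finset.range (j + 1), (j.choose a : ℝ) * ‖iteratedFDeriv ℝ a (F i) p‖ *
          ‖iteratedFDeriv ℝ (j - a) (G i) p‖
      ≤ ∑ a ∈ Finset.range (j + 1), (j.choose a : ℝ) * (|C| * |D|) := by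
        refine Finset.sum_le_sum fun a ha => ?_
        rw [mul_assoc]
        have ha' := Finset.mem_range.1 ha
        gcongr
        · exact (hC i p hp a (by omega)).trans (le_abs_self _)
        · exact (hD i p hp (j - a) (by omega)).trans (le_abs_self _)
    _ = 2 ^ j * (|C| * |D|) := by
        rw [← Finset.sum_mul]
        congr 1
        exact_mod_cast Nat.sum_range_choose j
    _ ≤ 2 ^ N * (|C| * |D|) := by
        gcongr
        norm_num

theorem mono {M : ℕ} (hF : UnifCk K N F) (h : M ≤ N) : UnifCk K M F :=
  ⟨hF.1, hF.2.imp fun _ hC i p hp j hj => hC i p hp j (hj.trans h)⟩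

theorem reindex {κ : Type*} (hF : UnifCk K N F) (e : κ → ι) : UnifCk K N fun i => F (e i) :=
  ⟨fun i => hF.1 (e i), hF.2.imp fun _ hC i => hC (e i)⟩

theorem dirDeriv (hF : UnifCk K (N + 1) F) (v : E) : UnifCk K N fun i => dirDeriv v (F i) := by
  obtain ⟨h1, C, hC⟩ := hF
  refine ⟨fun i => contDiff_dirDeriv v (h1 i), ‖v‖ * C, fun i p hp j hj => ?_⟩
  have h := norm_iteratedFDeriv_clm_apply_const (𝕜 := ℝ) (f := fderiv ℝ (F i)) (c := v)
    (N := ∞) (n := j) (x := p) ((h1 i).fderiv_right (m := ∞) le_rfl).contDiffAt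
    (by exact_mod_cast le_top)
  refine h.trans ?_
  rw [norm_iteratedFDeriv_fderiv]
  exact mul_le_mul_of_nonneg_left (hC i p hp (j + 1) (by omega)) (norm_nonneg _)

theorem const {g : E → ℝ} (hK : IsCompact K) (hg : ContDiff ℝ ∞ g) :
    UnifCk K N fun _ : ι => g := by
  refine ⟨fun _ => hg, ?_⟩
  have h : ∀ j, ∃ C, ∀ p ∈ K, ‖iteratedFDeriv ℝ j g p‖ ≤ C := fun j =>
    hK.exists_bound_of_continuousOn
      (hg.continuous_iteratedFDeriv (by exact_mod_cast le_top)).continuousOn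
  choose C hC using h
  refine ⟨∑ j ∈ Finset.range (N + 1), |C j|, fun _ p hp j hj => ?_⟩
  exact ((hC j p hp).trans (le_abs_self _)).trans
    (Finset.single_le_sum (f := fun j => |C j|) (fun _ _ => abs_nonneg _)
      (Finset.mem_range.2 (by omega)))

theorem const_smul {r : ι → ℝ} {R : ℝ} (hF : UnifCk K N F) (hr : ∀ i, |r i| ≤ R) :
    UnifCk K N fun i p => r i * F i p := by
  obtain ⟨h1, C, hC⟩ := hF
  refine ⟨fun i => contDiff_const.mul (h1 i), R * |C|, fun i p hp j hj => ?_⟩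
  have : iteratedFDeriv ℝ j (fun p => r i * F i p) p = r i • iteratedFDeriv ℝ j (F i) p :=
    iteratedFDeriv_const_smul_apply (a := r i) (f := F i)
      ((h1 i).of_le (by exact_mod_cast le_top)).contDiffAt
  rw [this, norm_smul, Real.norm_eq_abs]
  exact mul_le_mul (hr i) ((hC i p hp j hj).trans (le_abs_self _)) (norm_nonneg _)
    ((abs_nonneg _).trans (hr i))

theorem sub (hF : UnifCk K N F) (hG : UnifCk K N G) : UnifCk K N fun i p => F i p - G i p := by
  have := hF.add (hG.const_smul (r := fun _ => -1) (R := 1) (by simp))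
  simpa [sub_eq_add_neg] using this

theorem diffOp {k : ℕ} {P : (E → ℝ) → E → ℝ} (hP : IsDiffOp k P) (hK : IsCompact K)
    (hF : UnifCk K (N + k) F) : UnifCk K N fun i => P (F i) := by
  induction hP generalizing N with
  | id => exact hF
  | mul hg _ ih => exact (UnifCk.const hK hg).mul (ih hF)
  | add _ _ ih1 ih2 => exact (ih1 hF).add (ih2 hF)
  | deriv v _ ih => exact (ih (N := N + 1) (hF.mono (by omega))).dirDeriv v
  | succ _ ih => exact ih (hF.mono (by omega))

theorem exists_bound (hF : UnifCk K N F) : ∃ C, 0 ≤ C ∧ ∀ i, ∀ p ∈ K, |F i p| ≤ C := by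
  obtain ⟨_, C, hC⟩ := hF
  refine ⟨|C|, abs_nonneg _, fun i p hp => ?_⟩
  have := hC i p hp 0 (Nat.zero_le _)
  rw [norm_iteratedFDeriv_zero] at this
  exact this.trans (le_abs_self _)

end UnifCk

end DiffOp

section Flow

variable {E : Type*} [NormedAddCommGroup E] [NormedSpace ℝ E]

/-- The operator `c₀(t) P₀ + c₁(t) P₁`. -/
def opPencil (c₀ c₁ : ℝ → ℝ) (P₀ P₁ : (E → ℝ) → E → ℝ) (t : ℝ) (f : E → ℝ) (p : E) : ℝ :=
  c₀ t * P₀ f p + c₁ t * P₁ f p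

/-- A family of smooth probability densities solving `∂ₜ u = (c₀(t) K₀ + c₁(t) K₁) u` pointwise,
where `K₀`, `K₁` are the formal adjoints of the second order operators `L₀`, `L₁`. -/
structure IsDensityFlow [MeasurableSpace E] (μ : Measure E) (u : ℝ → E → ℝ) (c₀ c₁ : ℝ → ℝ)
    (L₀ L₁ K₀ K₁ : (E → ℝ) → E → ℝ) : Prop where
  contDiff : ∀ t, ContDiff ℝ ∞ (u t)
  nonneg : ∀ t p, 0 ≤ u t p
  integral_eq : ∀ t, ∫ p, u t p ∂μ = 1
  cont₀ : Continuous c₀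
  cont₁ : Continuous c₁
  isL₀ : IsDiffOp 2 L₀
  isL₁ : IsDiffOp 2 L₁
  isK₀ : IsDiffOp 2 K₀
  isK₁ : IsDiffOp 2 K₁
  adj₀ : ∀ φ f : E → ℝ, ContDiff ℝ ∞ φ → HasCompactSupport φ → ContDiff ℝ ∞ f →
    ∫ p, φ p * K₀ f p ∂μ = ∫ p, L₀ φ p * f p ∂μ
  adj₁ : ∀ φ f : E → ℝ, ContDiff ℝ ∞ φ → HasCompactSupport φ → ContDiff ℝ ∞ f →
    ∫ p, φ p * K₁ f p ∂μ = ∫ p, L₁ φ p * f p ∂μ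
  hasDerivAt : ∀ t p, HasDerivAt (fun s => u s p) (opPencil c₀ c₁ K₀ K₁ t (u t) p) t

section Pencil

variable {c₀ c₁ : ℝ → ℝ} {P₀ P₁ : (E → ℝ) → E → ℝ} {k : ℕ}

theorem isDiffOp_opPencil (h₀ : IsDiffOp k P₀) (h₁ : IsDiffOp k P₁) (t : ℝ) :
    IsDiffOp k (opPencil c₀ c₁ P₀ P₁ t) :=
  (IsDiffOp.mul (g := fun _ => c₀ t) contDiff_const h₀).add
    (IsDiffOp.mul (g := fun _ => c₁ t) contDiff_const h₁)

theorem UnifCk.opPencil {ι : Type*} {K : Set E} {N : ℕ} {F : ι → E → ℝ} {τ : ι → ℝ} {R : ℝ}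
    (h₀ : IsDiffOp k P₀) (h₁ : IsDiffOp k P₁) (hK : IsCompact K) (hF : UnifCk K (N + k) F)
    (hr₀ : ∀ i, |c₀ (τ i)| ≤ R) (hr₁ : ∀ i, |c₁ (τ i)| ≤ R) :
    UnifCk K N fun i => opPencil c₀ c₁ P₀ P₁ (τ i) (F i) :=
  ((hF.diffOp h₀ hK).const_smul hr₀).add ((hF.diffOp h₁ hK).const_smul hr₁)

end Pencil

variable [FiniteDimensional ℝ E] [MeasurableSpace E] [BorelSpace E] {μ : Measure E}
  [μ.IsAddHaarMeasure]

theorem integrable_mul_of_hasCompactSupport {f g : E → ℝ} (hf : ContDiff ℝ ∞ f)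
    (hf' : HasCompactSupport f) (hg : ContDiff ℝ ∞ g) : Integrable (fun p => f p * g p) μ :=
  (hf.continuous.mul hg.continuous).integrable_of_hasCompactSupport hf'.mul_right

namespace IsDensityFlow

variable {u : ℝ → E → ℝ} {c₀ c₁ : ℝ → ℝ} {L₀ L₁ K₀ K₁ : (E → ℝ) → E → ℝ}

theorem adj (H : IsDensityFlow μ u c₀ c₁ L₀ L₁ K₀ K₁) (t : ℝ) {φ f : E → ℝ} (hφ : ContDiff ℝ ∞ φ)
    (hφ' : HasCompactSupport φ) (hf : ContDiff ℝ ∞ f) :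
    ∫ p, φ p * opPencil c₀ c₁ K₀ K₁ t f p ∂μ = ∫ p, opPencil c₀ c₁ L₀ L₁ t φ p * f p ∂μ := by
  have e1 : ∀ p, φ p * opPencil c₀ c₁ K₀ K₁ t f p =
      c₀ t * (φ p * K₀ f p) + c₁ t * (φ p * K₁ f p) := fun p => by rw [opPencil]; ring
  have e2 : ∀ p, opPencil c₀ c₁ L₀ L₁ t φ p * f p =
      c₀ t * (L₀ φ p * f p) + c₁ t * (L₁ φ p * f p) := fun p => by rw [opPencil]; ring
  simp_rw [e1, e2]
  have i1 := integrable_mul_of_hasCompactSupport (μ := μ) hφ hφ' (H.isK₀.contDiff hf)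
  have i2 := integrable_mul_of_hasCompactSupport (μ := μ) hφ hφ' (H.isK₁.contDiff hf)
  have i3 := integrable_mul_of_hasCompactSupport (μ := μ) (H.isL₀.contDiff hφ)
    (H.isL₀.hasCompactSupport hφ') hf
  have i4 := integrable_mul_of_hasCompactSupport (μ := μ) (H.isL₁.contDiff hφ)
    (H.isL₁.hasCompactSupport hφ') hf
  rw [integral_add (i1.const_mul _) (i2.const_mul _), integral_add (i3.const_mul _)
    (i4.const_mul _)]
  simp only [integral_const_mul]
  rw [H.adj₀ φ f hφ hφ' hf, H.adj₁ φ f hφ hφ' hf]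

theorem continuous_apply (H : IsDensityFlow μ u c₀ c₁ L₀ L₁ K₀ K₁) (p : E) :
    Continuous fun t => u t p :=
  continuous_iff_continuousAt.2 fun t => (H.hasDerivAt t p).continuousAt

theorem integrable (H : IsDensityFlow μ u c₀ c₁ L₀ L₁ K₀ K₁) (t : ℝ) : Integrable (u t) μ :=
  Integrable.of_integral_ne_zero (by rw [H.integral_eq]; exact one_ne_zero)

theorem abs_integral_le (H : IsDensityFlow μ u c₀ c₁ L₀ L₁ K₀ K₁) {g : E → ℝ} {C : ℝ}
    (hg : ∀ p, |g p| ≤ C) (t : ℝ) : |∫ p, g p * u t p ∂μ| ≤ C := by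
  have := norm_integral_le_of_norm_le (f := fun p => g p * u t p) ((H.integrable t).const_mul C)
    (.of_forall fun p => by
      rw [Real.norm_eq_abs, abs_mul, abs_of_nonneg (H.nonneg t p)]
      exact mul_le_mul_of_nonneg_right (hg p) (H.nonneg t p))
  rwa [integral_const_mul, H.integral_eq, mul_one] at this

theorem continuous_integral (H : IsDensityFlow μ u c₀ c₁ L₀ L₁ K₀ K₁) {φ : E → ℝ}
    (hφ : Continuous φ) (hφ' : HasCompactSupport φ) :
    Continuous fun t => ∫ p, φ p * u t p ∂μ := by
  obtain ⟨C, hC⟩ := hφ'.exists_bound_of_continuous hφ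
  refine continuous_iff_continuousAt.2 fun t => ?_
  exact tendsto_integral_mul_of_density H.integrable (H.integrable t) H.nonneg H.integral_eq
    (H.integral_eq t) (fun p => (H.continuous_apply p).continuousAt)
    (fun _ => hφ.aestronglyMeasurable) (.of_forall fun _ p => hC p) fun _ => tendsto_const_nhds

theorem continuous_integral_opPencil (H : IsDensityFlow μ u c₀ c₁ L₀ L₁ K₀ K₁) {φ : E → ℝ}
    (hφ : ContDiff ℝ ∞ φ) (hφ' : HasCompactSupport φ) :
    Continuous fun t => ∫ p, opPencil c₀ c₁ L₀ L₁ t φ p * u t p ∂μ := by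
  have h1 := H.continuous_integral (H.isL₀.contDiff hφ).continuous (H.isL₀.hasCompactSupport hφ')
  have h2 := H.continuous_integral (H.isL₁.contDiff hφ).continuous (H.isL₁.hasCompactSupport hφ')
  have e : ∀ t, ∫ p, opPencil c₀ c₁ L₀ L₁ t φ p * u t p ∂μ =
      c₀ t * (∫ p, L₀ φ p * u t p ∂μ) + c₁ t * ∫ p, L₁ φ p * u t p ∂μ := by
    intro t
    rw [← integral_const_mul, ← integral_const_mul, ← integral_add]
    · congr 1; ext p; rw [opPencil]; ring
    · exact (integrable_mul_of_hasCompactSupport (H.isL₀.contDiff hφ)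
        (H.isL₀.hasCompactSupport hφ') (H.contDiff t)).const_mul _
    · exact (integrable_mul_of_hasCompactSupport (H.isL₁.contDiff hφ)
        (H.isL₁.hasCompactSupport hφ') (H.contDiff t)).const_mul _
  simp_rw [e]
  exact (H.cont₀.mul h1).add (H.cont₁.mul h2)

/-- The times at which the densities have derivatives up to order `N` bounded by `k` on an open
set form a closed set. -/
theorem isClosed_setOf_norm_iteratedFDeriv_le (H : IsDensityFlow μ u c₀ c₁ L₀ L₁ K₀ K₁)
    {B : Set E} (hB : IsOpen B) (N : ℕ) (k : ℝ) :
    IsClosed {t | ∀ p ∈ B, ∀ j ≤ N, ‖iteratedFDeriv ℝ j (u t) p‖ ≤ k} := by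
  refine isClosed_of_closure_subset fun t ht p hp j hj => ?_
  obtain ⟨x, hx, hxt⟩ := mem_closure_iff_seq_limit.1 ht
  have hk : 0 ≤ k := (norm_nonneg _).trans (hx 0 p hp j hj)
  refine ContinuousMultilinearMap.opNorm_le_bound hk fun m => ?_
  obtain ⟨P, hP, hPe⟩ := exists_isDiffOp_iteratedFDeriv j m
  set M := k * ∏ i, ‖m i‖ with hM
  have hxP : ∀ n, ∀ q ∈ B, |P (u (x n)) q| ≤ M := fun n q hq => by
    rw [← hPe _ (H.contDiff _)]
    exact (ContinuousMultilinearMap.le_opNorm _ _).trans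
      (mul_le_mul_of_nonneg_right (hx n q hq j hj) (Finset.prod_nonneg fun _ _ => norm_nonneg _))
  rw [hPe _ (H.contDiff _), Real.norm_eq_abs]
  by_contra! hlt
  have hcont := (hP.contDiff (H.contDiff t)).continuous
  -- a test function concentrated where `P (u t)` is larger than `M`
  have hnear : {q | M < |P (u t) q|} ∩ B ∈ 𝓝 p :=
    inter_mem ((isOpen_lt continuous_const hcont.abs).mem_nhds hlt) (hB.mem_nhds hp)
  obtain ⟨φ, hφs, hφc, hφ, hφ01, hφp⟩ := exists_contDiff_tsupport_subset (n := ⊤) hnear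
  have hφ0 : ∀ q, 0 ≤ φ q := fun q => (hφ01 (Set.mem_range_self q)).1
  set ψ : E → ℝ := fun q => φ q * P (u t) q with hψ
  have hψs : ContDiff ℝ ∞ ψ := hφ.mul (hP.contDiff (H.contDiff t))
  have hψc : HasCompactSupport ψ := hφc.mul_right
  obtain ⟨ζ, hζ, hζc, hζe⟩ := hP.exists_adjoint μ ψ hψs hψc
  have hlim : Tendsto (fun n => ∫ q, ψ q * P (u (x n)) q ∂μ) atTop
      (𝓝 (∫ q, ψ q * P (u t) q ∂μ)) := by
    simp_rw [hζe _ (H.contDiff _)]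
    exact ((H.continuous_integral hζ.continuous hζc).tendsto t).comp hxt
  have hle : ∫ q, ψ q * P (u t) q ∂μ ≤ ∫ q, M * |ψ q| ∂μ := by
    refine le_of_tendsto hlim (.of_forall fun n => ?_)
    refine integral_mono
      (integrable_mul_of_hasCompactSupport hψs hψc (hP.contDiff (H.contDiff _)))
      ((hψs.continuous.integrable_of_hasCompactSupport hψc).abs.const_mul M) fun q => ?_
    by_cases hq : q ∈ tsupport φ
    · refine (le_abs_self _).trans ?_
      rw [abs_mul, mul_comm]
      exact mul_le_mul_of_nonneg_right (hxP n q (hφs hq).2) (abs_nonneg _)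
    · simp [hψ, image_eq_zero_of_notMem_tsupport hq]
  have hi1 : Integrable (fun q => ψ q * P (u t) q) μ :=
    integrable_mul_of_hasCompactSupport hψs hψc (hP.contDiff (H.contDiff _))
  have hi2 : Integrable (fun q => M * |ψ q|) μ :=
    (hψs.continuous.integrable_of_hasCompactSupport hψc).abs.const_mul M
  have hpt : ∀ q, M * |ψ q| ≤ ψ q * P (u t) q := fun q => by
    have e : ψ q * P (u t) q = |ψ q| * |P (u t) q| := by
      rw [hψ]
      simp only [abs_mul, abs_of_nonneg (hφ0 q)]
      rw [mul_assoc, mul_assoc, abs_mul_abs_self]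
    rw [e, mul_comm]
    by_cases hq : q ∈ tsupport φ
    · exact mul_le_mul_of_nonneg_left (hφs hq).1.le (abs_nonneg _)
    · simp [hψ, image_eq_zero_of_notMem_tsupport hq]
  have hc : Continuous fun q => ψ q * P (u t) q - M * |ψ q| := by fun_prop
  have hpos : 0 < ∫ q, (ψ q * P (u t) q - M * |ψ q|) ∂μ := by
    refine hc.integral_pos_of_hasCompactSupport_nonneg_nonzero ?_ (fun q => sub_nonneg.2 (hpt q))
      (x := p) ?_
    · exact (hψc.mul_right).sub (HasCompactSupport.mul_left (hψc.norm))
    · have e : ψ p = P (u t) p := by rw [hψ]; simp [hφp]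
      rw [e, ← abs_mul_abs_self, ← sub_mul]
      have := hM ▸ hlt
      have h0 : 0 ≤ M := mul_nonneg hk (Finset.prod_nonneg fun _ _ => norm_nonneg _)
      exact (mul_pos (sub_pos.2 hlt) (h0.trans_lt hlt)).ne'
  rw [integral_sub hi1 hi2] at hpos
  linarith

end IsDensityFlow

end Flow

section Energy

variable {E : Type*} [NormedAddCommGroup E] [NormedSpace ℝ E]
  [FiniteDimensional ℝ E] [MeasurableSpace E] [BorelSpace E] {μ : Measure E}
  [μ.IsAddHaarMeasure]

/-- The weak form of the flow equation at time `s`, tested against `φ`. -/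
def WeakDerivAt (μ : Measure E) (u : ℝ → E → ℝ) (c₀ c₁ : ℝ → ℝ) (L₀ L₁ : (E → ℝ) → E → ℝ)
    (φ : E → ℝ) (s : ℝ) : Prop :=
  HasDerivAt (fun t => ∫ p, φ p * u t p ∂μ) (∫ p, opPencil c₀ c₁ L₀ L₁ s φ p * u s p ∂μ) s

namespace IsDensityFlow

variable {u : ℝ → E → ℝ} {c₀ c₁ : ℝ → ℝ} {L₀ L₁ K₀ K₁ : (E → ℝ) → E → ℝ}

theorem integral_sub_eq (H : IsDensityFlow μ u c₀ c₁ L₀ L₁ K₀ K₁) {φ : E → ℝ} {a b : ℝ}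
    (hφ : ContDiff ℝ ∞ φ) (hφ' : HasCompactSupport φ) (hab : a ≤ b)
    (h : ∀ s ∈ Set.Ioo a b, WeakDerivAt μ u c₀ c₁ L₀ L₁ φ s) :
    (∫ p, φ p * u b p ∂μ) - ∫ p, φ p * u a p ∂μ =
      ∫ τ in a..b, ∫ p, opPencil c₀ c₁ L₀ L₁ τ φ p * u τ p ∂μ :=
  (intervalIntegral.integral_eq_sub_of_hasDerivAt_of_le hab
    (H.continuous_integral hφ.continuous hφ').continuousOn h
    ((H.continuous_integral_opPencil hφ hφ').intervalIntegrable _ _)).symm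

/-- Two densities with uniform `C⁴` bounds are `O(b - a)`-close in `L¹` if the flow equation holds
weakly between them. -/
theorem exists_integral_abs_sub_le (H : IsDensityFlow μ u c₀ c₁ L₀ L₁ K₀ K₁) {χ : E → ℝ}
    (hχ : ContDiff ℝ ∞ χ) (hχc : HasCompactSupport χ) (hχ0 : ∀ p, 0 ≤ χ p) {α β : ℝ} {A : Set ℝ}
    (hA : A ⊆ Set.Icc α β) (hu : UnifCk (tsupport χ) 4 fun a : A => u a) :
    ∃ C, 0 ≤ C ∧ ∀ a ∈ A, ∀ b ∈ A, a < b →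
      (∀ φ : E → ℝ, ContDiff ℝ ∞ φ → tsupport φ ⊆ tsupport χ →
        ∀ s ∈ Set.Ioo a b, WeakDerivAt μ u c₀ c₁ L₀ L₁ φ s) →
      ∫ p, χ p * |u b p - u a p| ∂μ ≤ C * (b - a) := by
  obtain ⟨R₀, hR₀⟩ := isCompact_Icc (a := α) (b := β) |>.exists_bound_of_continuousOn
    H.cont₀.continuousOn
  obtain ⟨R₁, hR₁⟩ := isCompact_Icc (a := α) (b := β) |>.exists_bound_of_continuousOn
    H.cont₁.continuousOn
  set R := max R₀ R₁
  have hr₀ : ∀ τ : Set.Icc α β, |c₀ τ| ≤ R := fun τ => (hR₀ τ τ.2).trans (le_max_left _ _)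
  have hr₁ : ∀ τ : Set.Icc α β, |c₁ τ| ≤ R := fun τ => (hR₁ τ τ.2).trans (le_max_right _ _)
  have hK : IsCompact (tsupport χ) := hχc
  obtain ⟨C₁, hC₁0, hC₁⟩ : ∃ C₁, 0 ≤ C₁ ∧ ∀ a ∈ A, ∀ b ∈ A, ∀ σ ∈ Set.Icc α β, ∀ τ ∈ Set.Icc α β,
      ∀ p, |opPencil c₀ c₁ L₀ L₁ σ (opPencil c₀ c₁ L₀ L₁ τ fun q => χ q * (u b q - u a q)) p|
        ≤ C₁ := by
    have h1 : UnifCk (tsupport χ) 4 fun i : A × A × Set.Icc α β × Set.Icc α β =>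
        fun q => χ q * (u i.2.1 q - u i.1 q) :=
      (UnifCk.const hK hχ).mul ((hu.reindex fun i : A × A × Set.Icc α β × Set.Icc α β => i.2.1).sub
        (hu.reindex fun i : A × A × Set.Icc α β × Set.Icc α β => i.1))
    have h2 := UnifCk.opPencil (N := 2) (c₀ := c₀) (c₁ := c₁) (τ := fun i => i.2.2.2) H.isL₀ H.isL₁
      hK h1 (fun i => hr₀ i.2.2.2) (fun i => hr₁ i.2.2.2)
    have h3 := UnifCk.opPencil (N := 0) (c₀ := c₀) (c₁ := c₁) (τ := fun i => i.2.2.1) H.isL₀ H.isL₁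
      hK h2 (fun i => hr₀ i.2.2.1) (fun i => hr₁ i.2.2.1)
    obtain ⟨C, hC0, hC⟩ := h3.exists_bound
    refine ⟨C, hC0, fun a ha b hb σ hσ τ hτ p => ?_⟩
    by_cases hp : p ∈ tsupport χ
    · exact hC (⟨a, ha⟩, ⟨b, hb⟩, ⟨σ, hσ⟩, ⟨τ, hτ⟩) p hp
    · have : p ∉ tsupport (opPencil c₀ c₁ L₀ L₁ σ
          (opPencil c₀ c₁ L₀ L₁ τ fun q => χ q * (u b q - u a q))) := fun h =>
        hp (tsupport_mul_subset_left ((isDiffOp_opPencil H.isL₀ H.isL₁ τ).tsupport_subset _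
          ((isDiffOp_opPencil H.isL₀ H.isL₁ σ).tsupport_subset _ h)))
      rw [image_eq_zero_of_notMem_tsupport this, abs_zero]
      exact hC0
  obtain ⟨C₂, hC₂0, hC₂⟩ : ∃ C₂, 0 ≤ C₂ ∧ ∀ a ∈ A, ∀ τ ∈ Set.Icc α β, ∀ p ∈ tsupport χ,
      |opPencil c₀ c₁ K₀ K₁ τ (u a) p| ≤ C₂ := by
    obtain ⟨C, hC0, hC⟩ := (UnifCk.opPencil (N := 2) (c₀ := c₀) (c₁ := c₁) (ι := A × Set.Icc α β)
      (τ := fun i => i.2) H.isK₀ H.isK₁ hK (hu.reindex fun i => i.1) (fun i => hr₀ i.2)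
      (fun i => hr₁ i.2)).exists_bound
    exact ⟨C, hC0, fun a ha τ hτ p hp => hC (⟨a, ha⟩, ⟨τ, hτ⟩) p hp⟩
  refine ⟨C₁ + (C₂ + 1) ^ 2 * ∫ p, χ p ∂μ, ?_, fun a ha b hb hab hw => ?_⟩
  · have := integral_nonneg (μ := μ) (f := χ) fun p => hχ0 p
    positivity
  set w : E → ℝ := fun q => u b q - u a q with hwdef
  have hws : ContDiff ℝ ∞ w := (H.contDiff b).sub (H.contDiff a)
  set ψ : E → ℝ := fun q => χ q * w q with hψ
  have hψs : ContDiff ℝ ∞ ψ := hχ.mul hws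
  have hψc : HasCompactSupport ψ := hχc.mul_right
  have hψχ : tsupport ψ ⊆ tsupport χ := tsupport_mul_subset_left
  set J := ∫ p, χ p * |w p| ∂μ with hJ
  have hJi : Integrable (fun p => χ p * |w p|) μ :=
    (hχ.continuous.mul hws.continuous.abs).integrable_of_hasCompactSupport hχc.mul_right
  have hab' : Set.Icc a b ⊆ Set.Icc α β := Set.Icc_subset_Icc (hA ha).1 (hA hb).2
  -- the derivative of `∫ ψ u` along the gap
  have hG : ∀ τ ∈ Set.Icc a b,
      ∫ p, opPencil c₀ c₁ L₀ L₁ τ ψ p * u τ p ∂μ ≤ C₂ * J + C₁ * (b - a) := by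
    intro τ hτ
    have hop := isDiffOp_opPencil (c₀ := c₀) (c₁ := c₁) H.isL₀ H.isL₁ τ
    have hs := hop.contDiff hψs
    have hsc := hop.hasCompactSupport hψc
    have h1 := H.integral_sub_eq hs hsc hτ.1 fun s hs' =>
      hw _ hs ((hop.tsupport_subset ψ).trans hψχ) s ⟨hs'.1, hs'.2.trans_le hτ.2⟩
    have h2 : |∫ σ in a..τ, ∫ p, opPencil c₀ c₁ L₀ L₁ σ (opPencil c₀ c₁ L₀ L₁ τ ψ) p * u σ p ∂μ|
        ≤ C₁ * |τ - a| := by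
      rw [← Real.norm_eq_abs]
      refine intervalIntegral.norm_integral_le_of_norm_le_const fun σ hσ => ?_
      rw [Set.uIoc_of_le hτ.1] at hσ
      exact H.abs_integral_le (hC₁ a ha b hb σ (hab' ⟨hσ.1.le, hσ.2.trans hτ.2⟩) τ (hab' hτ)) σ
    rw [abs_of_nonneg (sub_nonneg.2 hτ.1)] at h2
    have h3 : ∫ p, opPencil c₀ c₁ L₀ L₁ τ ψ p * u a p ∂μ ≤ C₂ * J := by
      rw [← H.adj τ hψs hψc (H.contDiff a), hJ, ← integral_const_mul]
      refine integral_mono (integrable_mul_of_hasCompactSupport hψs hψc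
        ((isDiffOp_opPencil H.isK₀ H.isK₁ τ).contDiff (H.contDiff a))) (hJi.const_mul _)
        fun p => ?_
      by_cases hp : p ∈ tsupport χ
      · refine (le_abs_self _).trans ?_
        rw [abs_mul, hψ, abs_mul, abs_of_nonneg (hχ0 p), mul_comm C₂]
        exact mul_le_mul_of_nonneg_left (hC₂ a ha τ (hab' hτ) p hp)
          (mul_nonneg (hχ0 p) (abs_nonneg _))
      · simp [hψ, image_eq_zero_of_notMem_tsupport hp]
    have h4 : C₁ * (τ - a) ≤ C₁ * (b - a) :=
      mul_le_mul_of_nonneg_left (by linarith [hτ.2]) hC₁0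
    linarith [le_abs_self
      (∫ σ in a..τ, ∫ p, opPencil c₀ c₁ L₀ L₁ σ (opPencil c₀ c₁ L₀ L₁ τ ψ) p * u σ p ∂μ)]
  have hpos : 0 < b - a := sub_pos.2 hab
  have hE : ∫ p, χ p * w p ^ 2 ∂μ ≤ (C₂ * J + C₁ * (b - a)) * (b - a) := by
    have h1 := H.integral_sub_eq hψs hψc hab.le fun s hs => hw _ hψs hψχ s hs
    have h2 : ∫ p, χ p * w p ^ 2 ∂μ = (∫ p, ψ p * u b p ∂μ) - ∫ p, ψ p * u a p ∂μ := by
      rw [← integral_sub (integrable_mul_of_hasCompactSupport hψs hψc (H.contDiff b))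
        (integrable_mul_of_hasCompactSupport hψs hψc (H.contDiff a))]
      congr 1; ext p; simp only [hψ, hwdef]; ring
    rw [h2, h1]
    have h3 := intervalIntegral.integral_mono_on (μ := volume) hab.le
      ((H.continuous_integral_opPencil hψs hψc).intervalIntegrable a b)
      (continuous_const.intervalIntegrable a b) hG
    refine h3.trans_eq ?_
    rw [intervalIntegral.integral_const, smul_eq_mul, mul_comm]
  have hAG : 2 * ((C₂ + 1) * (b - a)) * J ≤
      (∫ p, χ p * w p ^ 2 ∂μ) + ((C₂ + 1) * (b - a)) ^ 2 * ∫ p, χ p ∂μ := by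
    have i1 : Integrable (fun p => χ p * w p ^ 2) μ :=
      integrable_mul_of_hasCompactSupport hχ hχc (hws.pow 2)
    have i2 : Integrable χ μ := hχ.continuous.integrable_of_hasCompactSupport hχc
    rw [hJ, ← integral_const_mul, ← integral_const_mul, ← integral_add i1 (i2.const_mul _)]
    refine integral_mono (hJi.const_mul _) (i1.add (i2.const_mul _)) fun p => ?_
    have := mul_nonneg (hχ0 p) (sq_nonneg (|w p| - (C₂ + 1) * (b - a)))
    have e : χ p * (|w p| - (C₂ + 1) * (b - a)) ^ 2 = (χ p * w p ^ 2 +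
        ((C₂ + 1) * (b - a)) ^ 2 * χ p) - 2 * ((C₂ + 1) * (b - a)) * (χ p * |w p|) := by
      rw [← sq_abs (w p)]; ring
    exact sub_nonneg.1 (e ▸ this)
  have hJ0 : 0 ≤ J := integral_nonneg fun p => mul_nonneg (hχ0 p) (abs_nonneg _)
  have h5 : (b - a) * J ≤ (b - a) * ((C₁ + (C₂ + 1) ^ 2 * ∫ p, χ p ∂μ) * (b - a)) := by
    have : 0 ≤ C₂ * ((b - a) * J) := by positivity
    nlinarith
  exact le_of_mul_le_mul_left h5 hpos

end IsDensityFlow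

end Energy

section Weak

variable {E : Type*} [NormedAddCommGroup E] [NormedSpace ℝ E]
  [FiniteDimensional ℝ E] [MeasurableSpace E] [BorelSpace E] {μ : Measure E}
  [μ.IsAddHaarMeasure]

namespace IsDensityFlow

variable {u : ℝ → E → ℝ} {c₀ c₁ : ℝ → ℝ} {L₀ L₁ K₀ K₁ : (E → ℝ) → E → ℝ}

theorem measurable_uncurry (H : IsDensityFlow μ u c₀ c₁ L₀ L₁ K₀ K₁) :
    Measurable fun q : ℝ × E => u q.1 q.2 :=
  (stronglyMeasurable_uncurry_of_continuous_of_stronglyMeasurable H.continuous_apply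
    fun t => (H.contDiff t).continuous.stronglyMeasurable).measurable

theorem measurable_opPencil (H : IsDensityFlow μ u c₀ c₁ L₀ L₁ K₀ K₁) :
    Measurable fun q : ℝ × E => opPencil c₀ c₁ K₀ K₁ q.1 (u q.1) q.2 := by
  have hlim : Tendsto (fun n : ℕ => 1 / ((n : ℝ) + 1)) atTop (𝓝[≠] 0) :=
    tendsto_nhdsWithin_iff.2 ⟨tendsto_one_div_add_atTop_nhds_zero_nat,
      .of_forall fun n => (Nat.one_div_pos_of_nat (α := ℝ)).ne'⟩
  refine measurable_of_tendsto_metrizable (f := fun (n : ℕ) (q : ℝ × E) =>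
    (1 / ((n : ℝ) + 1))⁻¹ • (u (q.1 + 1 / ((n : ℝ) + 1)) q.2 - u q.1 q.2)) (fun n => ?_) ?_
  · have h1 : Measurable fun q : ℝ × E => u (q.1 + 1 / ((n : ℝ) + 1)) q.2 :=
      H.measurable_uncurry.comp ((measurable_fst.add_const _).prodMk measurable_snd)
    simp only [smul_eq_mul]
    exact (h1.sub H.measurable_uncurry).const_mul _
  · rw [tendsto_pi_nhds]
    rintro ⟨t, p⟩
    exact (hasDerivAt_iff_tendsto_slope_zero.1 (H.hasDerivAt t p)).comp hlim

/-- The weak form of the equation between two times of a closed set `S` on which the densities are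
uniformly bounded in `C⁴`, if it is known off `S`. -/
theorem integral_sub_eq_of_mem (H : IsDensityFlow μ u c₀ c₁ L₀ L₁ K₀ K₁) {χ φ : E → ℝ}
    (hχ : ContDiff ℝ ∞ χ) (hχc : HasCompactSupport χ) (hχ0 : ∀ p, 0 ≤ χ p) {S A : Set ℝ}
    (hS : IsClosed S) {s t M : ℝ} (hAs : S ∩ Set.Icc s t ⊆ A) (hA : A ⊆ Set.Icc s t)
    (hu : UnifCk (tsupport χ) 4 fun a : A => u a)
    (hw : ∀ φ : E → ℝ, ContDiff ℝ ∞ φ → tsupport φ ⊆ tsupport χ →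
        ∀ τ ∉ S, WeakDerivAt μ u c₀ c₁ L₀ L₁ φ τ)
    (hφ : ContDiff ℝ ∞ φ) (hφχ : tsupport φ ⊆ tsupport χ) (hφM : ∀ p, |φ p| ≤ M * χ p)
    (hs : s ∈ S) (ht : t ∈ S) (hst : s < t) :
    (∫ p, φ p * u t p ∂μ) - ∫ p, φ p * u s p ∂μ =
      ∫ τ in s..t, ∫ p, opPencil c₀ c₁ L₀ L₁ τ φ p * u τ p ∂μ := by
  have hφc : HasCompactSupport φ := hχc.of_isClosed_subset (isClosed_tsupport _) hφχ
  have hK : IsCompact (tsupport χ) := hχc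
  set S' := S ∪ Set.Iic s ∪ Set.Ici t with hS'def
  have hS' : IsClosed S' := (hS.union isClosed_Iic).union isClosed_Ici
  have ha : Set.Iic s ⊆ S' := fun x hx => Or.inl (Or.inr hx)
  have hb : Set.Ici t ⊆ S' := fun x hx => Or.inr hx
  have hSS : ∀ x ∈ S', x ∈ Set.Icc s t → x ∈ S := by
    rintro x ((h | h) | h) hx
    · exact h
    · exact (le_antisymm h hx.1) ▸ hs
    · exact (le_antisymm hx.2 h) ▸ ht
  have hl : ∀ τ ∈ Set.Ioo s t, s ≤ gapLeft S' τ ∧ gapLeft S' τ ≤ τ ∧ gapLeft S' τ ∈ S := by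
    intro τ hτ
    have h1 := le_gapLeft (S := S') (ha Set.self_mem_Iic) hτ.1.le
    have h2 := gapLeft_le ha τ
    exact ⟨h1, h2, hSS _ (gapLeft_mem hS' ha τ) ⟨h1, h2.trans hτ.2.le⟩⟩
  have hr : ∀ τ ∈ Set.Ioo s t, τ ≤ gapRight S' τ ∧ gapRight S' τ ≤ t ∧ gapRight S' τ ∈ S := by
    intro τ hτ
    have h1 := gapRight_le (S := S') (hb Set.self_mem_Ici) hτ.2
    have h2 := le_gapRight hb τ
    exact ⟨h2, h1, hSS _ (gapRight_mem hS' hb τ) ⟨hτ.1.le.trans h2, h1⟩⟩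
  set k : ℝ → E → ℝ := fun τ p =>
    gapSlope S' (fun σ => u σ p) (fun σ => opPencil c₀ c₁ K₀ K₁ σ (u σ) p) τ with hk
  have hkgap : ∀ τ, τ < gapRight S' τ → k τ = fun p =>
      (u (gapRight S' τ) p - u (gapLeft S' τ) p) / (gapRight S' τ - gapLeft S' τ) := by
    intro τ h; ext p; simp only [hk, gapSlope, if_pos h]
  have hknot : ∀ τ, ¬ τ < gapRight S' τ → k τ = opPencil c₀ c₁ K₀ K₁ τ (u τ) := by
    intro τ h; ext p; simp only [hk, gapSlope, if_neg h]
  have hkcont : ∀ τ, Continuous (k τ) := by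
    intro τ
    by_cases h : τ < gapRight S' τ
    · rw [hkgap τ h]
      exact ((H.contDiff _).continuous.sub (H.contDiff _).continuous).div_const _
    · rw [hknot τ h]
      exact ((isDiffOp_opPencil H.isK₀ H.isK₁ τ).contDiff (H.contDiff τ)).continuous
  have hkmeas : Measurable fun q : ℝ × E => k q.1 q.2 := by
    have mr := (monotone_gapRight hb).measurable
    have ml := (monotone_gapLeft ha).measurable
    have e : (fun q : ℝ × E => k q.1 q.2) = fun q =>
        Set.indicator {q : ℝ × E | q.1 < gapRight S' q.1} (fun q => (u (gapRight S' q.1) q.2 -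
          u (gapLeft S' q.1) q.2) / (gapRight S' q.1 - gapLeft S' q.1)) q +
        Set.indicator {q : ℝ × E | q.1 < gapRight S' q.1}ᶜ
          (fun q => opPencil c₀ c₁ K₀ K₁ q.1 (u q.1) q.2) q := by
      ext q
      by_cases h : q.1 < gapRight S' q.1
      · rw [Set.indicator_of_mem (by exact h), Set.indicator_of_notMem (by simpa using h),
          add_zero, hkgap _ h]
      · rw [Set.indicator_of_notMem (by exact h), Set.indicator_of_mem (by exact h),
          zero_add, hknot _ h]
    have hset : MeasurableSet {q : ℝ × E | q.1 < gapRight S' q.1} :=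
      measurableSet_lt measurable_fst (mr.comp measurable_fst)
    rw [e]
    refine Measurable.add (Measurable.indicator ?_ hset)
      (H.measurable_opPencil.indicator hset.compl)
    have m1 : Measurable fun q : ℝ × E => u (gapRight S' q.1) q.2 :=
      H.measurable_uncurry.comp ((mr.comp measurable_fst).prodMk measurable_snd)
    have m2 : Measurable fun q : ℝ × E => u (gapLeft S' q.1) q.2 :=
      H.measurable_uncurry.comp ((ml.comp measurable_fst).prodMk measurable_snd)
    exact (m1.sub m2).div ((mr.comp measurable_fst).sub (ml.comp measurable_fst))
  -- uniform bound of the slopes in weighted `L¹`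
  obtain ⟨D, hD0, hD⟩ : ∃ D, 0 ≤ D ∧ ∀ τ ∈ Set.Ioo s t, ∫ p, |φ p * k τ p| ∂μ ≤ D := by
    obtain ⟨C, hC0, hC⟩ := H.exists_integral_abs_sub_le hχ hχc hχ0 hA hu
    obtain ⟨R₀, hR₀⟩ := isCompact_Icc (a := s) (b := t) |>.exists_bound_of_continuousOn
      H.cont₀.continuousOn
    obtain ⟨R₁, hR₁⟩ := isCompact_Icc (a := s) (b := t) |>.exists_bound_of_continuousOn
      H.cont₁.continuousOn
    obtain ⟨C', hC'0, hC'⟩ := (UnifCk.opPencil (N := 2) (c₀ := c₀) (c₁ := c₁) (ι := A)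
      (τ := fun i => i) (R := max R₀ R₁) H.isK₀ H.isK₁ hK hu
      (fun i => (hR₀ i (hA i.2)).trans (le_max_left _ _))
      (fun i => (hR₁ i (hA i.2)).trans (le_max_right _ _))).exists_bound
    have hχi : Integrable χ μ := hχ.continuous.integrable_of_hasCompactSupport hχc
    refine ⟨|M| * C + |M| * (C' * ∫ p, χ p ∂μ), ?_, fun τ hτ => ?_⟩
    · have := integral_nonneg (μ := μ) (f := χ) fun p => hχ0 p
      positivity
    have hint := integral_nonneg (μ := μ) (f := χ) fun p => hχ0 p
    have hki : Integrable (fun p => χ p * |k τ p|) μ :=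
      (hχ.continuous.mul (hkcont τ).abs).integrable_of_hasCompactSupport hχc.mul_right
    have h1 : ∫ p, |φ p * k τ p| ∂μ ≤ |M| * ∫ p, χ p * |k τ p| ∂μ := by
      rw [← integral_const_mul]
      refine integral_mono (((hφ.continuous.mul (hkcont τ)).integrable_of_hasCompactSupport
        hφc.mul_right).abs) (hki.const_mul _) fun p => ?_
      simp only
      rw [abs_mul, ← mul_assoc]
      exact mul_le_mul_of_nonneg_right ((hφM p).trans
        (mul_le_mul_of_nonneg_right (le_abs_self M) (hχ0 p))) (abs_nonneg _)
    rw [← mul_add]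
    refine h1.trans (mul_le_mul_of_nonneg_left ?_ (abs_nonneg _))
    by_cases h : τ < gapRight S' τ
    · have hlτ := hl τ hτ
      have hrτ := hr τ hτ
      have hlt : gapLeft S' τ < gapRight S' τ := hlτ.2.1.trans_lt h
      have h2 := hC _ (hAs ⟨hlτ.2.2, hlτ.1, hlτ.2.1.trans hτ.2.le⟩) _
        (hAs ⟨hrτ.2.2, hτ.1.le.trans hrτ.1, hrτ.2.1⟩) hlt fun φ h1 h2 σ hσ =>
          hw φ h1 h2 σ fun hσS => notMem_of_gap hσ.1 hσ.2 (Or.inl (Or.inl hσS))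
      have e : ∀ p, χ p * |k τ p| = (gapRight S' τ - gapLeft S' τ)⁻¹ *
          (χ p * |u (gapRight S' τ) p - u (gapLeft S' τ) p|) := fun p => by
        rw [hkgap τ h, abs_div, abs_of_pos (sub_pos.2 hlt)]; ring
      simp_rw [e]
      rw [integral_const_mul, inv_mul_le_iff₀ (sub_pos.2 hlt), mul_comm]
      have : 0 ≤ C' * (∫ p, χ p ∂μ) * (gapRight S' τ - gapLeft S' τ) := by
        have := sub_pos.2 hlt; positivity
      linarith
    · have hmem : τ ∈ S := by
        have he : gapRight S' τ = τ := le_antisymm (not_lt.1 h) (hr τ hτ).1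
        exact he ▸ (hr τ hτ).2.2
      have h2 : ∫ p, χ p * |k τ p| ∂μ ≤ C' * ∫ p, χ p ∂μ := by
        rw [← integral_const_mul]
        refine integral_mono hki (hχi.const_mul _) fun p => ?_
        by_cases hp : p ∈ tsupport χ
        · simp only
          rw [hknot τ h, mul_comm]
          exact mul_le_mul_of_nonneg_right
            (hC' ⟨τ, hAs ⟨hmem, hτ.1.le, hτ.2.le⟩⟩ p hp) (hχ0 p)
        · simp [image_eq_zero_of_notMem_tsupport hp]
      linarith
  set ν := (volume : Measure ℝ).restrict (Set.Ioo s t) with hν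
  have hmeas : Measurable fun q : ℝ × E => φ q.2 * k q.1 q.2 :=
    (hφ.continuous.measurable.comp measurable_snd).mul hkmeas
  have hint : Integrable (fun q : ℝ × E => φ q.2 * k q.1 q.2) (ν.prod μ) := by
    rw [integrable_prod_iff hmeas.aestronglyMeasurable]
    refine ⟨.of_forall fun τ => (hφ.continuous.mul (hkcont τ)).integrable_of_hasCompactSupport
      hφc.mul_right, ?_⟩
    refine Integrable.of_bound (C := D) hmeas.aestronglyMeasurable.norm.integral_prod_right' ?_
    refine (ae_restrict_iff' measurableSet_Ioo).2 (.of_forall fun τ hτ => ?_)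
    rw [Real.norm_eq_abs, abs_of_nonneg (integral_nonneg fun _ => norm_nonneg _)]
    exact hD τ hτ
  set G : ℝ → ℝ := fun τ => ∫ p, opPencil c₀ c₁ L₀ L₁ τ φ p * u τ p ∂μ with hG
  have hGc : Continuous G := H.continuous_integral_opPencil hφ hφc
  set N : ℝ → ℝ := fun τ => ∫ σ in s..τ, G σ with hN
  have hNd : ∀ τ, HasDerivAt N (G τ) τ := fun τ =>
    intervalIntegral.integral_hasDerivAt_right (hGc.intervalIntegrable _ _)
      (hGc.stronglyMeasurableAtFilter _ _) hGc.continuousAt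
  have hNc : Continuous N := continuous_iff_continuousAt.2 fun τ => (hNd τ).continuousAt
  have hNs : ∀ τ ∈ Set.Ioo s t, ∫ p, φ p * k τ p ∂μ = gapSlope S' N G τ := by
    intro τ hτ
    by_cases h : τ < gapRight S' τ
    · have hlt : gapLeft S' τ < gapRight S' τ := (hl τ hτ).2.1.trans_lt h
      have h1 := H.integral_sub_eq hφ hφc hlt.le fun σ hσ =>
        hw φ hφ hφχ σ fun hσS => notMem_of_gap hσ.1 hσ.2 (Or.inl (Or.inl hσS))
      have h2 : N (gapRight S' τ) - N (gapLeft S' τ) =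
          ∫ σ in (gapLeft S' τ)..(gapRight S' τ), G σ :=
        intervalIntegral.integral_interval_sub_left (hGc.intervalIntegrable _ _)
          (hGc.intervalIntegrable _ _)
      rw [gapSlope, if_pos h, h2, ← h1, ← integral_sub
        (integrable_mul_of_hasCompactSupport hφ hφc (H.contDiff _))
        (integrable_mul_of_hasCompactSupport hφ hφc (H.contDiff _)), ← integral_div]
      congr 1; ext p
      rw [hkgap τ h]; ring
    · rw [gapSlope, if_neg h, hknot τ h]
      exact H.adj τ hφ hφc (H.contDiff τ)
  have hleft : (∫ p, φ p * u t p ∂μ) - ∫ p, φ p * u s p ∂μ = ∫ p, ∫ τ, φ p * k τ p ∂ν ∂μ := by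
    rw [← integral_sub (integrable_mul_of_hasCompactSupport hφ hφc (H.contDiff _))
      (integrable_mul_of_hasCompactSupport hφ hφc (H.contDiff _))]
    refine integral_congr_ae ?_
    filter_upwards [hint.prod_left_ae] with p hp
    rw [integral_const_mul, ← mul_sub]
    by_cases h0 : φ p = 0
    · simp [h0]
    congr 1
    have hki : Integrable (fun τ => k τ p) ν := by
      have := hp.const_mul (φ p)⁻¹
      refine this.congr (.of_forall fun τ => ?_)
      simp only
      rw [← mul_assoc, inv_mul_cancel₀ h0, one_mul]
    have hii : IntervalIntegrable (fun τ => k τ p) volume s t :=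
      (intervalIntegrable_iff_integrableOn_Ioo_of_le hst.le).2 hki
    rw [← integral_gapSlope hS' hst.le ha hb (H.continuous_apply p)
      (fun τ _ _ => (H.hasDerivAt τ p).hasDerivWithinAt) hii,
      intervalIntegral.integral_of_le hst.le, integral_Ioc_eq_integral_Ioo]
  have hNi : IntervalIntegrable (gapSlope S' N G) volume s t := by
    rw [intervalIntegrable_iff_integrableOn_Ioo_of_le hst.le]
    refine hint.integral_prod_left.congr ?_
    exact (ae_restrict_iff' measurableSet_Ioo).2 (.of_forall hNs)
  rw [hleft, ← integral_integral_swap hint]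
  calc ∫ τ, ∫ p, φ p * k τ p ∂μ ∂ν = ∫ τ, gapSlope S' N G τ ∂ν :=
        integral_congr_ae ((ae_restrict_iff' measurableSet_Ioo).2 (.of_forall hNs))
    _ = ∫ τ in s..t, gapSlope S' N G τ := by
        rw [intervalIntegral.integral_of_le hst.le, integral_Ioc_eq_integral_Ioo]
    _ = N t - N s := integral_gapSlope hS' hst.le ha hb hNc
        (fun τ _ _ => (hNd τ).hasDerivWithinAt) hNi
    _ = ∫ τ in s..t, G τ := by simp [hN]

end IsDensityFlow

end Weak

theorem exists_Ioo_inter_subset {S : Set ℝ} (hS : IsClosed S) (hne : S.Nonempty) {M : ℕ → Set ℝ}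
    (hM : ∀ k, IsClosed (M k)) (hcover : ∀ t, ∃ k, t ∈ M k) :
    ∃ k α β x, x ∈ S ∧ x ∈ Set.Ioo α β ∧ S ∩ Set.Ioo α β ⊆ M k := by
  have : Nonempty S := hne.to_subtype
  have : CompleteSpace S := hS.completeSpace_coe
  obtain ⟨k, x, hx⟩ := nonempty_interior_of_iUnion_of_closed (X := S)
    (f := fun k => Subtype.val ⁻¹' M k) (fun k => (hM k).preimage continuous_subtype_val)
    (Set.eq_univ_of_forall fun t => Set.mem_iUnion.2 (hcover t))
  obtain ⟨V, hV, hxV⟩ := (mem_nhds_subtype S x _).1 (mem_interior_iff_mem_nhds.1 hx)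
  obtain ⟨α, β, hαβ, hαβV⟩ := mem_nhds_iff_exists_Ioo_subset.1 hV
  refine ⟨k, α, β, x, x.2, hαβ, fun t ht => ?_⟩
  have h1 : (⟨t, ht.1⟩ : S) ∈ Subtype.val ⁻¹' V := hαβV ht.2
  exact hxV h1

theorem hasDerivAt_of_sub_eq_integral {F G : ℝ → ℝ} (hG : Continuous G) {S : Set ℝ}
    (hS : IsClosed S) {α β : ℝ}
    (hoff : ∀ s t, s ≤ t → (∀ τ ∈ Set.Ioo s t, τ ∉ S) → F t - F s = ∫ τ in s..t, G τ)
    (hon : ∀ s ∈ S ∩ Set.Ioo α β, ∀ t ∈ S ∩ Set.Ioo α β, s < t → F t - F s = ∫ τ in s..t, G τ)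
    {x : ℝ} (hx : x ∈ Set.Ioo α β) : HasDerivAt F (G x) x := by
  have hall : ∀ s ∈ Set.Ioo α β, ∀ t ∈ Set.Ioo α β, s ≤ t → F t - F s = ∫ τ in s..t, G τ := by
    intro s hs t ht hst
    by_cases hne : (S ∩ Set.Icc s t).Nonempty
    · have hcomp : IsCompact (S ∩ Set.Icc s t) := isCompact_Icc.inter_left hS
      obtain ⟨a, ha⟩ := hcomp.exists_isLeast hne
      obtain ⟨b, hb⟩ := hcomp.exists_isGreatest hne
      have hab : a ≤ b := ha.2 hb.1
      have h1 := hoff s a ha.1.2.1 fun τ hτ hτS =>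
        (ha.2 ⟨hτS, hτ.1.le, hτ.2.le.trans ha.1.2.2⟩).not_gt hτ.2
      have h2 := hoff b t hb.1.2.2 fun τ hτ hτS =>
        (hb.2 ⟨hτS, hb.1.2.1.trans hτ.1.le, hτ.2.le⟩).not_gt hτ.1
      have h3 : F b - F a = ∫ τ in a..b, G τ := by
        rcases hab.eq_or_lt with rfl | hlt
        · simp
        · exact hon a ⟨ha.1.1, hs.1.trans_le ha.1.2.1, ha.1.2.2.trans_lt ht.2⟩ b
            ⟨hb.1.1, hs.1.trans_le hb.1.2.1, hb.1.2.2.trans_lt ht.2⟩ hlt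
      have h4 := intervalIntegral.integral_add_adjacent_intervals
        (hG.intervalIntegrable (μ := volume) s a) (hG.intervalIntegrable a b)
      have h5 := intervalIntegral.integral_add_adjacent_intervals
        (hG.intervalIntegrable (μ := volume) s b) (hG.intervalIntegrable b t)
      linarith
    · exact hoff s t hst fun τ hτ hτS => hne ⟨τ, hτS, hτ.1.le, hτ.2.le⟩
  have hd : HasDerivAt (fun t => F x + ∫ τ in x..t, G τ) (G x) x :=
    (intervalIntegral.integral_hasDerivAt_right (hG.intervalIntegrable _ _)
      (hG.stronglyMeasurableAtFilter _ _) hG.continuousAt).const_add _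
  refine hd.congr_of_eventuallyEq ?_
  filter_upwards [isOpen_Ioo.mem_nhds hx] with t ht
  rcases le_total x t with h | h
  · linarith [hall x hx t ht h]
  · rw [intervalIntegral.integral_symm]
    linarith [hall t ht x hx h]

section Weak

variable {E : Type*} [NormedAddCommGroup E] [NormedSpace ℝ E]
  [FiniteDimensional ℝ E] [MeasurableSpace E] [BorelSpace E] {μ : Measure E}
  [μ.IsAddHaarMeasure]

namespace IsDensityFlow

variable {u : ℝ → E → ℝ} {c₀ c₁ : ℝ → ℝ} {L₀ L₁ K₀ K₁ : (E → ℝ) → E → ℝ}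

/-- A pointwise solution of the Fokker-Planck equation is a weak solution. -/
theorem weakDerivAt (H : IsDensityFlow μ u c₀ c₁ L₀ L₁ K₀ K₁) {φ : E → ℝ}
    (hφ : ContDiff ℝ ∞ φ) (hφ' : HasCompactSupport φ) (s : ℝ) :
    WeakDerivAt μ u c₀ c₁ L₀ L₁ φ s := by
  obtain ⟨R, hR0, hR⟩ : ∃ R : ℝ, 0 < R ∧ tsupport φ ⊆ Metric.ball 0 R := by
    obtain ⟨R, hR⟩ := (IsCompact.isBounded hφ').subset_ball 0
    exact ⟨max R 1, by positivity, hR.trans (Metric.ball_subset_ball (le_max_left _ _))⟩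
  set good : Set ℝ := {s | ∀ φ : E → ℝ, ContDiff ℝ ∞ φ → tsupport φ ⊆ Metric.ball 0 R →
    WeakDerivAt μ u c₀ c₁ L₀ L₁ φ s} with hgood
  set S : Set ℝ := (interior good)ᶜ with hSdef
  have hS : IsClosed S := isOpen_interior.isClosed_compl
  have hoff : ∀ τ ∉ S, τ ∈ good := fun τ hτ => interior_subset (not_not.1 hτ)
  have hcpt : ∀ ψ : E → ℝ, tsupport ψ ⊆ Metric.ball 0 R → HasCompactSupport ψ := fun ψ hψ =>
    (isCompact_closedBall (0 : E) R).of_isClosed_subset (isClosed_tsupport _)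
      (hψ.trans Metric.ball_subset_closedBall)
  suffices hempty : S = ∅ from hoff s (by rw [hempty]; exact Set.notMem_empty s) φ hφ hR
  by_contra hne
  rw [← Ne, ← Set.nonempty_iff_ne_empty] at hne
  set Mk : ℕ → Set ℝ := fun k =>
    {t | ∀ p ∈ Metric.ball (0 : E) R, ∀ j ≤ 4, ‖iteratedFDeriv ℝ j (u t) p‖ ≤ k} with hMk
  have hcover : ∀ t, ∃ k, t ∈ Mk k := by
    intro t
    have h1 : ∀ j : ℕ, ∃ C, ∀ p ∈ Metric.closedBall (0 : E) R, ‖iteratedFDeriv ℝ j (u t) p‖ ≤ C :=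
      fun j => (isCompact_closedBall (0 : E) R).exists_bound_of_continuousOn
        ((H.contDiff t).continuous_iteratedFDeriv (m := j)
          (mod_cast le_top)).continuousOn
    choose C hC using h1
    obtain ⟨k, hk⟩ := exists_nat_ge (∑ j ∈ Finset.range 5, |C j|)
    refine ⟨k, fun p hp j hj => (hC j p (Metric.ball_subset_closedBall hp)).trans
      (((le_abs_self _).trans ?_).trans hk)⟩
    exact Finset.single_le_sum (f := fun j => |C j|) (fun _ _ => abs_nonneg _)
      (Finset.mem_range.2 (by omega))
  obtain ⟨k, α, β, x, hxS, hαβ, hsub⟩ := exists_Ioo_inter_subset hS hne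
    (fun k => H.isClosed_setOf_norm_iteratedFDeriv_le (Metric.isOpen_ball (x := (0 : E)) (ε := R))
      4 (k : ℝ)) hcover
  refine hxS (mem_interior.2 ⟨Set.Ioo α β, fun y hy ψ hψ hψR => ?_, isOpen_Ioo, hαβ⟩)
  have hψc := hcpt ψ hψR
  refine hasDerivAt_of_sub_eq_integral (S := S) (α := α) (β := β)
    (F := fun t => ∫ p, ψ p * u t p ∂μ)
    (G := fun τ => ∫ p, opPencil c₀ c₁ L₀ L₁ τ ψ p * u τ p ∂μ)
    (H.continuous_integral_opPencil hψ hψc) hS (fun s t hst h => ?_) (fun s hs t ht hst => ?_) hy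
  · exact H.integral_sub_eq hψ hψc hst fun τ hτ => hoff τ (h τ hτ) ψ hψ hψR
  obtain ⟨r, hr, hψr⟩ := exists_pos_lt_subset_ball hR0 (isClosed_tsupport ψ) hψR
  let χ : ContDiffBump (0 : E) := ⟨r, (r + R) / 2, hr.1, by linarith [hr.2]⟩
  have hχs : tsupport χ ⊆ Metric.ball 0 R := by
    rw [χ.tsupport_eq]
    exact Metric.closedBall_subset_ball (by change (r + R) / 2 < R; linarith [hr.2])
  have hψχ : ∀ p ∈ tsupport ψ, χ p = 1 := fun p hp =>
    χ.one_of_mem_closedBall (Metric.ball_subset_closedBall (hψr hp))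
  obtain ⟨M, hM⟩ := hψc.exists_bound_of_continuous hψ.continuous
  refine H.integral_sub_eq_of_mem (χ := χ) (A := S ∩ Set.Icc s t) (M := M) χ.contDiff
    χ.hasCompactSupport (fun _ => χ.nonneg) hS subset_rfl Set.inter_subset_right
    ⟨fun a => H.contDiff a, k, fun a p hp => ?_⟩
    (fun ξ hξ hξχ τ hτ => hoff τ hτ ξ hξ (hξχ.trans hχs)) hψ (fun p hp => ?_) (fun p => ?_)
    hs.1 ht.1 hst
  · exact hsub ⟨a.2.1, hs.2.1.trans_le a.2.2.1, lt_of_le_of_lt a.2.2.2 ht.2.2⟩ p (hχs hp)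
  · exact subset_tsupport _ (by rw [Function.mem_support, hψχ p hp]; exact one_ne_zero)
  · by_cases hp : p ∈ tsupport ψ
    · rw [hψχ p hp, mul_one]; exact hM p
    · rw [image_eq_zero_of_notMem_tsupport hp, abs_zero]
      exact mul_nonneg ((norm_nonneg _).trans (hM p)) χ.nonneg

end IsDensityFlow

end Weak

section Adjoint

variable {E : Type*} [NormedAddCommGroup E] [NormedSpace ℝ E]

theorem IsDiffOp.sum {ι : Type*} {k : ℕ} {P : ι → (E → ℝ) → E → ℝ} (s : Finset ι)
    (hP : ∀ i, IsDiffOp k (P i)) : IsDiffOp k fun f p => ∑ i ∈ s, P i f p := by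
  classical
  induction s using Finset.induction_on with
  | empty =>
    have h0 : ∀ k, IsDiffOp (E := E) k fun _ _ => 0 := by
      intro k
      induction k with
      | zero => simpa using IsDiffOp.mul (g := fun _ : E => (0 : ℝ)) contDiff_const IsDiffOp.id
      | succ k ih => exact ih.succ
    simpa using h0 k
  | insert i s hi ih => simpa [Finset.sum_insert hi] using (hP i).add ih

theorem dirDeriv_eq_of_forall_add_smul {v : E} {g : E → ℝ} {c : ℝ} {p : E}
    (hg : DifferentiableAt ℝ g p) (h : ∀ s : ℝ, g (p + s • v) = g p + s * c) :
    dirDeriv v g p = c := by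
  have h1 : HasDerivAt (fun s : ℝ => g (p + s • v)) (fderiv ℝ g p v) 0 :=
    hg.hasFDerivAt.hasLineDerivAt v
  have h2 : HasDerivAt (fun s : ℝ => g p + s * c) c 0 := by
    simpa using ((hasDerivAt_id (0 : ℝ)).mul_const c).const_add (g p)
  simp_rw [h] at h1
  exact h1.unique h2

theorem dirDeriv_comm {f : E → ℝ} (hf : ContDiff ℝ ∞ f) (v w : E) :
    dirDeriv v (dirDeriv w f) = dirDeriv w (dirDeriv v f) := by
  ext p
  have hd : DifferentiableAt ℝ (fderiv ℝ f) p :=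
    (hf.fderiv_right (m := ∞) le_rfl).differentiable (by simp) p
  have e : ∀ a b : E, dirDeriv a (dirDeriv b f) p = fderiv ℝ (fderiv ℝ f) p a b := by
    intro a b
    change fderiv ℝ (fun q => fderiv ℝ f q b) p a = _
    rw [fderiv_clm_apply hd (differentiableAt_const b)]
    simp
  rw [e, e]
  exact (hf.contDiffAt.isSymmSndFDerivAt (by simpa using ENat.LEInfty.out)) v w

variable [FiniteDimensional ℝ E] [MeasurableSpace E] [BorelSpace E] {μ : Measure E}
  [μ.IsAddHaarMeasure]

theorem integral_mul_dirDeriv (v : E) {φ f : E → ℝ} (hφ : ContDiff ℝ ∞ φ)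
    (hφ' : HasCompactSupport φ) (hf : ContDiff ℝ ∞ f) :
    ∫ p, φ p * dirDeriv v f p ∂μ = -∫ p, dirDeriv v φ p * f p ∂μ := by
  have h3 := contDiff_dirDeriv v hφ
  have h4 : HasCompactSupport (dirDeriv v φ) :=
    hφ'.of_isClosed_subset (isClosed_tsupport _) (tsupport_dirDeriv_subset v φ)
  exact integral_mul_fderiv_eq_neg_fderiv_mul_of_integrable (μ := μ) (f := φ) (g := f)
      (v := v) ((h3.continuous.mul hf.continuous).integrable_of_hasCompactSupport h4.mul_right)
      (integrable_mul_of_hasCompactSupport hφ hφ' (contDiff_dirDeriv v hf))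
      (integrable_mul_of_hasCompactSupport hφ hφ' hf)
      (fun x _ => hφ.differentiable (by simp) x) (fun x _ => hf.differentiable (by simp) x)

/-- `L` and `K` are formally adjoint second order operators. -/
structure IsAdjointPair (μ : Measure E) (L K : (E → ℝ) → E → ℝ) : Prop where
  isL : IsDiffOp 2 L
  isK : IsDiffOp 2 K
  adj : ∀ φ f : E → ℝ, ContDiff ℝ ∞ φ → HasCompactSupport φ → ContDiff ℝ ∞ f →
    ∫ p, φ p * K f p ∂μ = ∫ p, L φ p * f p ∂μ

namespace IsAdjointPair

variable {L K L' K' : (E → ℝ) → E → ℝ}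

theorem add (h : IsAdjointPair μ L K) (h' : IsAdjointPair μ L' K') :
    IsAdjointPair μ (fun f p => L f p + L' f p) fun f p => K f p + K' f p where
  isL := h.isL.add h'.isL
  isK := h.isK.add h'.isK
  adj φ f hφ hφ' hf := by
    simp only [mul_add, add_mul]
    rw [integral_add (integrable_mul_of_hasCompactSupport hφ hφ' (h.isK.contDiff hf))
      (integrable_mul_of_hasCompactSupport hφ hφ' (h'.isK.contDiff hf)),
      integral_add (integrable_mul_of_hasCompactSupport (h.isL.contDiff hφ)
        (h.isL.hasCompactSupport hφ') hf)
      (integrable_mul_of_hasCompactSupport (h'.isL.contDiff hφ)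
        (h'.isL.hasCompactSupport hφ') hf), h.adj φ f hφ hφ' hf, h'.adj φ f hφ hφ' hf]

theorem const_mul (h : IsAdjointPair μ L K) (c : ℝ) :
    IsAdjointPair μ (fun f p => c * L f p) fun f p => c * K f p where
  isL := IsDiffOp.mul (g := fun _ => c) contDiff_const h.isL
  isK := IsDiffOp.mul (g := fun _ => c) contDiff_const h.isK
  adj φ f hφ hφ' hf := by
    simp only [mul_left_comm _ c, mul_assoc c]
    rw [integral_const_mul, integral_const_mul, h.adj φ f hφ hφ' hf]

theorem sum {ι : Type*} {L K : ι → (E → ℝ) → E → ℝ} (s : Finset ι)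
    (h : ∀ i, IsAdjointPair μ (L i) (K i)) :
    IsAdjointPair μ (fun f p => ∑ i ∈ s, L i f p) fun f p => ∑ i ∈ s, K i f p where
  isL := IsDiffOp.sum s fun i => (h i).isL
  isK := IsDiffOp.sum s fun i => (h i).isK
  adj φ f hφ hφ' hf := by
    simp only [Finset.mul_sum, Finset.sum_mul]
    rw [integral_finsetSum _ fun i _ => integrable_mul_of_hasCompactSupport hφ hφ'
        ((h i).isK.contDiff hf),
      integral_finsetSum _ fun i _ => integrable_mul_of_hasCompactSupport
        ((h i).isL.contDiff hφ) ((h i).isL.hasCompactSupport hφ') hf]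
    exact Finset.sum_congr rfl fun i _ => (h i).adj φ f hφ hφ' hf

theorem transport {g : E → ℝ} {c : ℝ} {v : E} (hg : ContDiff ℝ ∞ g)
    (hgv : ∀ p, ∀ s : ℝ, g (p + s • v) = g p + s * c) :
    IsAdjointPair μ (fun f p => g p * dirDeriv v f p)
      fun f p => -(g p * dirDeriv v f p) - c * f p where
  isL := (IsDiffOp.mul hg (IsDiffOp.id.deriv v)).succ
  isK := by
    have := ((IsDiffOp.mul (g := fun p => - g p) hg.neg (IsDiffOp.id.deriv v)).add
      (IsDiffOp.mul (g := fun _ => -c) contDiff_const IsDiffOp.id.succ)).succ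
    simpa [sub_eq_add_neg] using this
  adj φ f hφ hφ' hf := by
    have h1 := integral_mul_dirDeriv (μ := μ) v (φ := fun p => g p * φ p) (hg.mul hφ)
      (hφ'.mul_left) hf
    have e : ∀ p, dirDeriv v (fun q => g q * φ q) p = g p * dirDeriv v φ p + c * φ p := by
      intro p
      have hc : dirDeriv v g p = c :=
        dirDeriv_eq_of_forall_add_smul (hg.differentiable (by simp) p) (hgv p)
      simp only [dirDeriv] at hc ⊢
      rw [fderiv_fun_mul (hg.differentiable (by simp) p) (hφ.differentiable (by simp) p)]
      simp [hc, mul_comm c]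
    simp_rw [e] at h1
    have i1 := integrable_mul_of_hasCompactSupport (μ := μ) hφ hφ'
      (hg.mul (contDiff_dirDeriv v hf))
    have i2 := (integrable_mul_of_hasCompactSupport (μ := μ) hφ hφ' hf).const_mul c
    have i3 := integrable_mul_of_hasCompactSupport (μ := μ) (hg.mul (contDiff_dirDeriv v hφ))
      (HasCompactSupport.mul_left (hφ'.of_isClosed_subset (isClosed_tsupport _)
        (tsupport_dirDeriv_subset v φ))) hf
    have e1 : ∀ p, φ p * (-(g p * dirDeriv v f p) - c * f p) =
        -(φ p * (g p * dirDeriv v f p)) - c * (φ p * f p) := fun p => by ring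
    have e2 : ∀ p, g p * φ p * dirDeriv v f p = φ p * (g p * dirDeriv v f p) := fun p => by ring
    have e3 : ∀ p, (g p * dirDeriv v φ p + c * φ p) * f p =
        g p * dirDeriv v φ p * f p + c * (φ p * f p) := fun p => by ring
    simp_rw [e2, e3] at h1
    simp_rw [e1]
    rw [integral_add i3 i2] at h1
    rw [integral_sub (f := fun p => -(φ p * (g p * dirDeriv v f p))) i1.neg i2, integral_neg, h1]
    ring

theorem second (v w : E) :
    IsAdjointPair μ (fun f p => dirDeriv v (dirDeriv w f) p)
      fun f p => dirDeriv v (dirDeriv w f) p where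
  isL := (IsDiffOp.id.deriv w).deriv v
  isK := (IsDiffOp.id.deriv w).deriv v
  adj φ f hφ hφ' hf := by
    have hφv : HasCompactSupport (dirDeriv v φ) :=
      hφ'.of_isClosed_subset (isClosed_tsupport _) (tsupport_dirDeriv_subset v φ)
    rw [integral_mul_dirDeriv v hφ hφ' (contDiff_dirDeriv w hf),
      integral_mul_dirDeriv w (contDiff_dirDeriv v hφ) hφv hf, neg_neg, dirDeriv_comm hφ]

end IsAdjointPair

/-- Densities solving the Fokker-Planck equation at positive times solve it weakly. -/
theorem hasDerivAt_integral_of_fokkerPlanck {m : ℝ → E → ℝ} {a : ℝ → ℝ}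
    {L₀ L₁ K₀ K₁ : (E → ℝ) → E → ℝ} (h₀ : IsAdjointPair μ L₀ K₀) (h₁ : IsAdjointPair μ L₁ K₁)
    (hm : ∀ t, ContDiff ℝ ∞ (m t)) (hm0 : ∀ t p, 0 ≤ m t p) (hm1 : ∀ t, ∫ p, m t p ∂μ = 1)
    (ha : Continuous a)
    (hfp : ∀ t, 0 < t → ∀ p, HasDerivAt (fun s => m s p) (K₀ (m t) p + a t * K₁ (m t) p) t)
    {φ : E → ℝ} (hφ : ContDiff ℝ ∞ φ) (hφ' : HasCompactSupport φ) {t : ℝ} (ht : 0 < t) :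
    HasDerivAt (fun s => ∫ p, φ p * m s p ∂μ)
      (∫ p, (L₀ φ p + a t * L₁ φ p) * m t p ∂μ) t := by
  have H : IsDensityFlow μ (fun τ => m (exp τ)) (fun τ => exp τ) (fun τ => exp τ * a (exp τ))
      L₀ L₁ K₀ K₁ :=
    { contDiff := fun τ => hm _
      nonneg := fun τ => hm0 _
      integral_eq := fun τ => hm1 _
      cont₀ := continuous_exp
      cont₁ := continuous_exp.mul (ha.comp continuous_exp)
      isL₀ := h₀.isL
      isL₁ := h₁.isL
      isK₀ := h₀.isK
      isK₁ := h₁.isK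
      adj₀ := h₀.adj
      adj₁ := h₁.adj
      hasDerivAt := fun τ p => by
        have := (hfp (exp τ) (exp_pos τ) p).comp τ (Real.hasDerivAt_exp τ)
        refine this.congr_deriv ?_
        simp only [opPencil]; ring }
  have h1 := H.weakDerivAt hφ hφ' (log t)
  unfold WeakDerivAt at h1
  have h2 := h1.comp t (Real.hasDerivAt_log ht.ne')
  have h3 : (fun s => ∫ p, φ p * m s p ∂μ) =ᶠ[𝓝 t]
      (fun s => ∫ p, φ p * m (exp s) p ∂μ) ∘ log := by
    filter_upwards [lt_mem_nhds ht] with s hs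
    simp [exp_log hs]
  refine (h2.congr_of_eventuallyEq h3).congr_deriv ?_
  rw [← integral_mul_const]
  congr 1; ext p
  simp only [opPencil, exp_log ht]
  field_simp

end Adjoint

section Langevin

variable {n m : ℕ}

instance instIsAddHaarMeasureSt : (volume : Measure (St n m)).IsAddHaarMeasure := by
  have h : (volume : Measure ((Fin n → ℝ) × (Fin m → ℝ))).IsAddHaarMeasure :=
    Measure.prod.instIsAddHaarMeasure _ _
  exact Measure.prod.instIsAddHaarMeasure (volume : Measure (Fin n → ℝ)) _

theorem contDiff_gradp {U : (Fin n → ℝ) → ℝ} (hU : ContDiff ℝ ∞ U) (i : Fin n) :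
    ContDiff ℝ ∞ fun x => gradp U x i :=
  (hU.fderiv_right (m := ∞) le_rfl).clm_apply contDiff_const

theorem contDiff_mulVec_apply {k l : ℕ} (M : Matrix (Fin k) (Fin l) ℝ) (i : Fin k) :
    ContDiff ℝ ∞ fun v : Fin l → ℝ => M.mulVec v i := by
  simp only [Matrix.mulVec, dotProduct]
  fun_prop

theorem mulVec_add_smul_single {k l : ℕ} (M : Matrix (Fin k) (Fin l) ℝ) (i : Fin k) (j : Fin l)
    (v : Fin l → ℝ) (s : ℝ) :
    M.mulVec (v + s • Pi.single j 1) i = M.mulVec v i + s * M i j := by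
  simp [Matrix.mulVec_add, Matrix.mulVec_smul]

/-- The part of the generator that does not carry the inverse temperature. -/
def genLZero (U : (Fin n → ℝ) → ℝ) (A : Matrix (Fin m) (Fin m) ℝ)
    (lam : Matrix (Fin m) (Fin n) ℝ) (f : St n m → ℝ) (p : St n m) : ℝ :=
  (∑ i, p.2.1 i * pX f i p) +
    (∑ i, (-gradp U p.1 i + lam.transpose.mulVec p.2.2 i) * pY f i p) +
    (∑ j, (-lam.mulVec p.2.1 j) * pZ f j p) +
    ∑ i, ∑ j, A i j * pZ (fun q => pZ f j q) i p

/-- The friction part of the generator. -/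
def genLOne (A : Matrix (Fin m) (Fin m) ℝ) (f : St n m → ℝ) (p : St n m) : ℝ :=
  ∑ j, (-A.transpose.mulVec p.2.2 j) * pZ f j p

/-- The formal adjoint of `genLZero`. -/
def genLadjZero (U : (Fin n → ℝ) → ℝ) (A : Matrix (Fin m) (Fin m) ℝ)
    (lam : Matrix (Fin m) (Fin n) ℝ) (f : St n m → ℝ) (p : St n m) : ℝ :=
  (∑ i, (-(p.2.1 i * pX f i p) - 0 * f p)) +
    (∑ i, (-((-gradp U p.1 i + lam.transpose.mulVec p.2.2 i) * pY f i p) - 0 * f p)) +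
    (∑ j, (-((-lam.mulVec p.2.1 j) * pZ f j p) - 0 * f p)) +
    ∑ i, ∑ j, A i j * pZ (fun q => pZ f j q) i p

/-- The formal adjoint of `genLOne`. -/
def genLadjOne (A : Matrix (Fin m) (Fin m) ℝ) (f : St n m → ℝ) (p : St n m) : ℝ :=
  ∑ j, (-((-A.transpose.mulVec p.2.2 j) * pZ f j p) - (-A.transpose j j) * f p)

theorem genL_eq (U : (Fin n → ℝ) → ℝ) (A : Matrix (Fin m) (Fin m) ℝ)
    (lam : Matrix (Fin m) (Fin n) ℝ) (T : ℝ) (f : St n m → ℝ) (p : St n m) :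
    genL U A lam T f p = genLZero U A lam f p + T⁻¹ * genLOne A f p := by
  simp only [genL, genLZero, genLOne, add_mul, neg_mul, Finset.sum_add_distrib,
    Finset.sum_neg_distrib]
  ring

theorem genLadj_eq (U : (Fin n → ℝ) → ℝ) (A : Matrix (Fin m) (Fin m) ℝ)
    (lam : Matrix (Fin m) (Fin n) ℝ) (T : ℝ) (f : St n m → ℝ) (p : St n m) :
    genLadj U A lam T f p = genLadjZero U A lam f p + T⁻¹ * genLadjOne A f p := by
  simp only [genLadj, genLadjZero, genLadjOne, add_mul, sub_mul, neg_mul, Finset.sum_add_distrib,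
    Finset.sum_neg_distrib, Finset.sum_sub_distrib, zero_mul, sub_zero,
    neg_add, neg_neg, sub_neg_eq_add, Matrix.trace, Matrix.diag, Matrix.transpose_apply,
    ← Finset.sum_mul, mul_assoc, ← Finset.mul_sum]
  ring

theorem isAdjointPair_genLZero {U : (Fin n → ℝ) → ℝ} (hU : ContDiff ℝ ∞ U)
    (A : Matrix (Fin m) (Fin m) ℝ) (lam : Matrix (Fin m) (Fin n) ℝ) :
    IsAdjointPair (volume : Measure (St n m)) (genLZero U A lam) (genLadjZero U A lam) := by
  refine ((IsAdjointPair.add (.sum _ fun i => ?_) (.sum _ fun i => ?_)).add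
    (.sum _ fun j => ?_)).add (.sum _ fun i => .sum _ fun j => ?_)
  · exact IsAdjointPair.transport (g := fun p : St n m => p.2.1 i) (by fun_prop) fun p s => by simp
  · refine IsAdjointPair.transport (g := fun p : St n m => -gradp U p.1 i +
      lam.transpose.mulVec p.2.2 i) ?_ fun p s => by simp
    exact ((contDiff_gradp hU i).comp contDiff_fst).neg.add
      ((contDiff_mulVec_apply _ i).comp (contDiff_snd.comp contDiff_snd))
  · refine IsAdjointPair.transport (g := fun p : St n m => -lam.mulVec p.2.1 j) ?_
      fun p s => by simp
    exact ((contDiff_mulVec_apply _ j).comp (contDiff_fst.comp contDiff_snd)).neg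
  · exact (IsAdjointPair.second _ _).const_mul _

theorem isAdjointPair_genLOne (A : Matrix (Fin m) (Fin m) ℝ) :
    IsAdjointPair (volume : Measure (St n m)) (genLOne A) (genLadjOne A) := by
  refine .sum _ fun j => ?_
  refine IsAdjointPair.transport (g := fun p : St n m => -A.transpose.mulVec p.2.2 j) ?_
      fun p s => ?_
  · exact ((contDiff_mulVec_apply _ j).comp (contDiff_snd.comp contDiff_snd)).neg
  · simp only [Prod.snd_add, Prod.smul_snd, mulVec_add_smul_single]
    ring

/-- The weak form of the Fokker-Planck equation of the Langevin dynamics. -/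
theorem hasDerivAt_integral_genL {U : (Fin n → ℝ) → ℝ} (hU : ContDiff ℝ ∞ U)
    {A : Matrix (Fin m) (Fin m) ℝ} {lam : Matrix (Fin m) (Fin n) ℝ} {T : ℝ → ℝ}
    (hT : Continuous T) (hT0 : ∀ t, 0 < T t) {u : ℝ → St n m → ℝ}
    (hu : ∀ t, ContDiff ℝ ∞ (u t)) (hu0 : ∀ t p, 0 ≤ u t p) (hu1 : ∀ t, ∫ p, u t p = 1)
    (hfp : ∀ t, 0 < t → ∀ p, HasDerivAt (fun s => u s p) (genLadj U A lam (T t) (u t) p) t)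
    {φ : St n m → ℝ} (hφ : ContDiff ℝ ∞ φ) (hφ' : HasCompactSupport φ) {t : ℝ} (ht : 0 < t) :
    HasDerivAt (fun s => ∫ p, φ p * u s p) (∫ p, genL U A lam (T t) φ p * u t p) t := by
  simp_rw [genL_eq]
  simp_rw [genLadj_eq] at hfp
  exact hasDerivAt_integral_of_fokkerPlanck (isAdjointPair_genLZero hU A lam)
    (isAdjointPair_genLOne A) hu hu0 hu1 (hT.inv₀ fun t => (hT0 t).ne') hfp hφ hφ' ht

end Langevin

section Scalar

theorem le_of_abs_deriv_le {F F' : ℝ → ℝ} {C η t₁ : ℝ} (hC : 0 ≤ C) (hη : 0 ≤ η)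
    (hF : ContinuousOn F (Set.Icc 0 t₁)) (hF0 : ∀ t ∈ Set.Icc 0 t₁, 0 ≤ F t)
    (hF' : ∀ t ∈ Set.Ioo 0 t₁, HasDerivAt F (F' t) t)
    (hb : ∀ t ∈ Set.Ioo 0 t₁, |F' t| ≤ C * F t + η) {s t : ℝ} (hs : s ∈ Set.Icc 0 t₁)
    (ht : t ∈ Set.Icc 0 t₁) : F t ≤ exp (C * t₁) * (F s + η * t₁) := by
  have key : ∀ (F F' : ℝ → ℝ), ContinuousOn F (Set.Icc 0 t₁) → (∀ t ∈ Set.Icc 0 t₁, 0 ≤ F t) →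
      (∀ t ∈ Set.Ioo 0 t₁, HasDerivAt F (F' t) t) →
      (∀ t ∈ Set.Ioo 0 t₁, |F' t| ≤ C * F t + η) → ∀ s ∈ Set.Icc 0 t₁, ∀ t ∈ Set.Icc 0 t₁,
      s ≤ t → F t ≤ exp (C * t₁) * (F s + η * t₁) := by
    intro F F' hF hF0 hF' hb s hs t ht hst
    have hanti : AntitoneOn (fun τ => exp (-C * τ) * F τ - η * τ) (Set.Icc 0 t₁) := by
      refine antitoneOn_of_hasDerivWithinAt_nonpos (convex_Icc _ _)
        (f' := fun τ => exp (-C * τ) * (F' τ - C * F τ) - η) ?_ ?_ ?_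
      · exact ((by fun_prop : Continuous fun τ => exp (-C * τ)).continuousOn.mul hF).sub
          (by fun_prop)
      · intro τ hτ
        rw [interior_Icc] at hτ
        have h1 : HasDerivAt (fun τ => exp (-C * τ)) (exp (-C * τ) * (-C)) τ := by
          simpa using (((hasDerivAt_id τ).const_mul (-C)).exp)
        have h2 := (h1.mul (hF' τ hτ)).sub ((hasDerivAt_id τ).const_mul η)
        refine (h2.congr_deriv ?_).hasDerivWithinAt
        ring
      · intro τ hτ
        rw [interior_Icc] at hτ
        have h1 : F' τ - C * F τ ≤ η := by linarith [(abs_le.1 (hb τ hτ)).2]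
        have h2 : exp (-C * τ) ≤ 1 := exp_le_one_iff.2 (by nlinarith [hτ.1])
        have h3 := mul_le_mul_of_nonneg_left h1 (exp_pos (-C * τ)).le
        nlinarith
    have h := hanti hs ht hst
    simp only at h
    have hFs := hF0 s hs
    have h1 : exp (-C * s) ≤ 1 := exp_le_one_iff.2 (by nlinarith [hs.1])
    have h2 : exp (-C * t) * F t ≤ F s + η * t₁ := by
      have : η * (t - s) ≤ η * t₁ := mul_le_mul_of_nonneg_left (by linarith [hs.1, ht.2]) hη
      nlinarith
    have h3 : F t = exp (C * t) * (exp (-C * t) * F t) := by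
      rw [← mul_assoc, ← exp_add]; simp
    rw [h3]
    have ht1 : 0 ≤ t₁ := hs.1.trans hs.2
    refine mul_le_mul (exp_le_exp.2 (mul_le_mul_of_nonneg_left ht.2 hC)) h2
      (mul_nonneg (exp_pos _).le (hF0 t ht)) (exp_pos _).le
  rcases le_total s t with h | h
  · exact key F F' hF hF0 hF' hb s hs t ht h
  · have hmem : ∀ τ ∈ Set.Icc 0 t₁, t₁ - τ ∈ Set.Icc 0 t₁ := fun τ hτ =>
      ⟨by linarith [hτ.2], by linarith [hτ.1]⟩
    have hmem' : ∀ τ ∈ Set.Ioo 0 t₁, t₁ - τ ∈ Set.Ioo 0 t₁ := fun τ hτ =>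
      ⟨by linarith [hτ.2], by linarith [hτ.1]⟩
    have := key (fun τ => F (t₁ - τ)) (fun τ => -F' (t₁ - τ))
      (hF.comp (by fun_prop) hmem) (fun τ hτ => hF0 _ (hmem τ hτ))
      (fun τ hτ => by
        have h1 := (hF' _ (hmem' τ hτ)).comp τ ((hasDerivAt_id τ).const_sub t₁)
        simpa [Function.comp_def] using h1)
      (fun τ hτ => by rw [abs_neg]; exact hb _ (hmem' τ hτ))
      (t₁ - s) (hmem s hs) (t₁ - t) (hmem t ht) (by linarith)
    simpa using this

theorem le_max_add_of_deriv_le {F F' κ : ℝ → ℝ} {b c η t : ℝ} (ht : 0 ≤ t) (hc : 0 < c)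
    (hη : 0 ≤ η) (hκ : ∀ τ ∈ Set.Ioo 0 t, 0 ≤ κ τ)
    (hF : ContinuousOn F (Set.Icc 0 t)) (hF' : ∀ τ ∈ Set.Ioo 0 t, HasDerivAt F (F' τ) τ)
    (hb : ∀ τ ∈ Set.Ioo 0 t, F' τ ≤ κ τ * (b - c * F τ) + η) :
    F t ≤ max (F 0) (b / c) + η * t := by
  set M := max (F 0) (b / c)
  by_contra! hlt
  set G : ℝ → ℝ := fun τ => F τ - η * τ with hG
  have hGc : ContinuousOn G (Set.Icc 0 t) := hF.sub (by fun_prop)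
  set S : Set ℝ := {τ ∈ Set.Icc 0 t | G τ ≤ M} with hS
  have hSc : IsCompact S := by
    have : IsClosed S := isClosed_Icc.isClosed_le hGc continuousOn_const
    exact isCompact_Icc.of_isClosed_subset this fun τ hτ => hτ.1
  have h0S : (0 : ℝ) ∈ S := ⟨⟨le_rfl, ht⟩, by
    simp only [hG, mul_zero, sub_zero]; exact le_max_left _ _⟩
  obtain ⟨s, hsS, hs⟩ := hSc.exists_isGreatest ⟨0, h0S⟩
  have hst : s ≤ t := hsS.1.2
  have hsub : Set.Icc s t ⊆ Set.Icc 0 t := Set.Icc_subset_Icc_left hsS.1.1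
  have hanti : AntitoneOn G (Set.Icc s t) := by
    refine antitoneOn_of_hasDerivWithinAt_nonpos (convex_Icc _ _) (f' := fun τ => F' τ - η)
      (hGc.mono hsub) ?_ ?_
    · intro τ hτ
      rw [interior_Icc] at hτ
      have h1 := (hF' τ ⟨hsS.1.1.trans_lt hτ.1, hτ.2⟩).sub ((hasDerivAt_id τ).const_mul η)
      exact (h1.congr_deriv (by ring)).hasDerivWithinAt
    · intro τ hτ
      rw [interior_Icc] at hτ
      have hτ0 : 0 < τ := hsS.1.1.trans_lt hτ.1
      have hGM : M < G τ := by
        by_contra! h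
        exact (hs (a := τ) ⟨⟨hτ0.le, hτ.2.le⟩, h⟩).not_gt hτ.1
      have h1 : b / c < F τ := by
        have h2 : b / c ≤ M := le_max_right _ _
        have h3 : 0 ≤ η * τ := by positivity
        simp only [hG] at hGM
        linarith
      rw [div_lt_iff₀ hc] at h1
      have h2 := hb τ ⟨hτ0, hτ.2⟩
      have h3 := hκ τ ⟨hτ0, hτ.2⟩
      nlinarith
  have h1 := hanti ⟨le_rfl, hst⟩ ⟨hst, le_rfl⟩ hst
  have h2 : G t ≤ M := h1.trans hsS.2
  simp only [hG] at h2
  linarith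

end Scalar

section Cutoff

theorem exists_cutoff : ∃ (χ : ℝ → ℝ) (K : ℝ), ContDiff ℝ ∞ χ ∧ HasCompactSupport χ ∧
    (∀ s, 0 ≤ χ s) ∧ (∀ s, χ s ≤ 1) ∧ (∀ s, |s| ≤ 1 → χ s = 1) ∧ 0 ≤ K ∧
    (∀ s, |deriv χ s| ≤ K) ∧ ∀ s, |deriv (deriv χ) s| ≤ K := by
  let χ : ContDiffBump (0 : ℝ) := ⟨1, 2, one_pos, one_lt_two⟩
  have h0 : ContDiff ℝ ∞ χ := χ.contDiff
  have h1 : ContDiff ℝ ∞ (deriv χ) := (contDiff_infty_iff_deriv.1 h0).2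
  have h2 : ContDiff ℝ ∞ (deriv (deriv χ)) := (contDiff_infty_iff_deriv.1 h1).2
  have c1 : HasCompactSupport (deriv χ) := χ.hasCompactSupport.deriv
  obtain ⟨K₁, hK₁⟩ := c1.exists_bound_of_continuous h1.continuous
  obtain ⟨K₂, hK₂⟩ := c1.deriv.exists_bound_of_continuous h2.continuous
  refine ⟨χ, max K₁ K₂, h0, χ.hasCompactSupport, fun _ => χ.nonneg, fun _ => χ.le_one,
    fun s hs => χ.one_of_mem_closedBall (by simpa [Real.dist_eq] using hs),
    ((norm_nonneg _).trans (hK₁ 0)).trans (le_max_left _ _),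
    fun s => (hK₁ s).trans (le_max_left _ _), fun s => (hK₂ s).trans (le_max_right _ _)⟩

/-- The regularised exponential `(e^{-s} + δ)^{-k}`. -/
def regExp (k δ s : ℝ) : ℝ := exp (-k * log (exp (-s) + δ))

theorem regExp_zero (k s : ℝ) : regExp k 0 s = exp (k * s) := by simp [regExp]

theorem regExp_pos (k δ s : ℝ) : 0 < regExp k δ s := exp_pos _

theorem regExp_le {k δ : ℝ} (hk : 0 ≤ k) (hδ : 0 < δ) (s : ℝ) :
    regExp k δ s ≤ exp (-k * log δ) := by
  refine exp_le_exp.2 ?_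
  have : log δ ≤ log (exp (-s) + δ) := log_le_log hδ (by linarith [exp_pos (-s)])
  nlinarith

theorem regExp_le_exp {k δ : ℝ} (hk : 0 ≤ k) (hδ : 0 ≤ δ) (s : ℝ) :
    regExp k δ s ≤ exp (k * s) := by
  refine exp_le_exp.2 ?_
  have : log (exp (-s)) ≤ log (exp (-s) + δ) := log_le_log (exp_pos _) (by linarith)
  rw [log_exp] at this
  nlinarith

theorem contDiff_regExp {k δ : ℝ} (hδ : 0 ≤ δ) : ContDiff ℝ ∞ (regExp k δ) := by
  unfold regExp
  refine (contDiff_const.mul (ContDiff.log ?_ fun s => ?_)).exp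
  · fun_prop
  · have := exp_pos (-s); positivity

theorem hasDerivAt_regExp {k δ : ℝ} (hδ : 0 ≤ δ) (s : ℝ) :
    HasDerivAt (regExp k δ) (k * (exp (-s) / (exp (-s) + δ)) * regExp k δ s) s := by
  have hp : 0 < exp (-s) + δ := by have := exp_pos (-s); positivity
  have h1 : HasDerivAt (fun s => exp (-s) + δ) (-exp (-s)) s := by
    simpa using ((hasDerivAt_id s).neg.exp).add_const δ
  have h2 := ((h1.log hp.ne').const_mul (-k)).exp
  refine h2.congr_deriv ?_
  simp only [regExp]
  ring

theorem deriv_regExp {k δ : ℝ} (hδ : 0 ≤ δ) :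
    deriv (regExp k δ) = fun s => k * (exp (-s) / (exp (-s) + δ)) * regExp k δ s :=
  funext fun s => (hasDerivAt_regExp hδ s).deriv

theorem deriv_deriv_regExp {k δ : ℝ} (hδ : 0 ≤ δ) (s : ℝ) :
    deriv (deriv (regExp k δ)) s = ((k * (exp (-s) / (exp (-s) + δ))) ^ 2 -
      k * (exp (-s) / (exp (-s) + δ)) * (1 - exp (-s) / (exp (-s) + δ))) * regExp k δ s := by
  have hp : 0 < exp (-s) + δ := by have := exp_pos (-s); positivity
  have h0 : HasDerivAt (fun s => exp (-s)) (-exp (-s)) s := by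
    simpa using (hasDerivAt_id s).neg.exp
  have h1 := ((h0.div (h0.add_const δ) hp.ne').const_mul k).mul (hasDerivAt_regExp (k := k) hδ s)
  rw [deriv_regExp hδ]
  refine h1.deriv.trans ?_
  simp only [Pi.div_apply]
  field_simp
  ring

theorem abs_deriv_regExp_le {k δ : ℝ} (hk : 0 ≤ k) (hδ : 0 ≤ δ) (s : ℝ) :
    |deriv (regExp k δ) s| ≤ (k + k ^ 2) * regExp k δ s := by
  have hp := exp_pos (-s)
  have h1 : exp (-s) / (exp (-s) + δ) ≤ 1 := div_le_one_of_le₀ (by linarith) (by linarith)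
  have h0 : 0 ≤ exp (-s) / (exp (-s) + δ) := by positivity
  have hG := (regExp_pos k δ s).le
  rw [deriv_regExp hδ, abs_mul, abs_of_nonneg hG, abs_of_nonneg (mul_nonneg hk h0)]
  refine mul_le_mul_of_nonneg_right ?_ hG
  nlinarith [mul_le_mul_of_nonneg_left h1 hk]

theorem abs_deriv_deriv_regExp_le {k δ : ℝ} (hk : 0 ≤ k) (hδ : 0 ≤ δ) (s : ℝ) :
    |deriv (deriv (regExp k δ)) s| ≤ (k + k ^ 2) * regExp k δ s := by
  have hp := exp_pos (-s)
  have h1 : exp (-s) / (exp (-s) + δ) ≤ 1 := div_le_one_of_le₀ (by linarith) (by linarith)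
  have h0 : 0 ≤ exp (-s) / (exp (-s) + δ) := by positivity
  have hG := (regExp_pos k δ s).le
  rw [deriv_deriv_regExp hδ, abs_mul, abs_of_nonneg hG]
  refine mul_le_mul_of_nonneg_right ?_ hG
  set θ := exp (-s) / (exp (-s) + δ)
  have h2 : k * θ * (1 - θ) ≤ k := by
    have : θ * (1 - θ) ≤ 1 := by nlinarith
    nlinarith
  have h3 : 0 ≤ k * θ * (1 - θ) := mul_nonneg (mul_nonneg hk h0) (by linarith)
  have h4 : (k * θ) ^ 2 ≤ k ^ 2 := by
    rw [mul_pow]; nlinarith [sq_nonneg k, mul_le_one₀ h1 h0 h1]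
  rw [abs_le]
  constructor <;> nlinarith [sq_nonneg (k * θ), sq_nonneg k]

end Cutoff

section Moment

theorem exists_truncation {k : ℝ} (hk : 0 ≤ k) : ∃ K, 0 ≤ K ∧ ∀ δ, 0 ≤ δ → ∀ M, 1 ≤ M →
    ∃ θ : ℝ → ℝ, (∀ s, 0 ≤ θ s) ∧ (∀ s, θ s ≤ 1) ∧ (∀ s, |s| ≤ M → θ s = 1) ∧
      ContDiff ℝ ∞ (fun s => θ s * regExp k δ s) ∧
      HasCompactSupport (fun s => θ s * regExp k δ s) ∧
      ∀ s a b B, |a| ≤ B → |b| ≤ B →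
        |(deriv (fun s => θ s * regExp k δ s) s * a +
            deriv (deriv fun s => θ s * regExp k δ s) s * b) -
          θ s * (deriv (regExp k δ) s * a + deriv (deriv (regExp k δ)) s * b)| ≤
            K * B / M * regExp k δ s := by
  obtain ⟨χ, K, hχ, hχc, hχ0, hχ1, hχe, hK, hK1, hK2⟩ := exists_cutoff
  refine ⟨K * (2 + 2 * (k + k ^ 2)), by positivity, fun δ hδ M hM => ?_⟩
  have hM0 : 0 < M := by linarith
  have hG : ContDiff ℝ ∞ (regExp k δ) := contDiff_regExp hδ
  have hG' := (contDiff_infty_iff_deriv.1 hG).2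
  have hχ' := (contDiff_infty_iff_deriv.1 hχ).2
  have hlin : ∀ s, HasDerivAt (fun s : ℝ => s / M) (1 / M) s := fun s =>
    (hasDerivAt_id s).div_const M
  have hd1 : ∀ s, HasDerivAt (fun s => χ (s / M)) (deriv χ (s / M) * (1 / M)) s := fun s =>
    ((hχ.differentiable (by simp) _).hasDerivAt).comp s (hlin s)
  have hd2 : ∀ s, HasDerivAt (fun s => deriv χ (s / M)) (deriv (deriv χ) (s / M) * (1 / M)) s :=
    fun s => ((hχ'.differentiable (by simp) _).hasDerivAt).comp s (hlin s)
  have hg1 : ∀ s, HasDerivAt (regExp k δ) (deriv (regExp k δ) s) s := fun s =>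
    (hG.differentiable (by simp) _).hasDerivAt
  have hg2 : ∀ s, HasDerivAt (deriv (regExp k δ)) (deriv (deriv (regExp k δ)) s) s := fun s =>
    (hG'.differentiable (by simp) _).hasDerivAt
  have e1 : deriv (fun s => χ (s / M) * regExp k δ s) = fun s =>
      deriv χ (s / M) * (1 / M) * regExp k δ s + χ (s / M) * deriv (regExp k δ) s :=
    funext fun s => ((hd1 s).mul (hg1 s)).deriv
  have e2 : ∀ s, deriv (deriv fun s => χ (s / M) * regExp k δ s) s =
      deriv (deriv χ) (s / M) * (1 / M) * (1 / M) * regExp k δ s +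
      2 * (deriv χ (s / M) * (1 / M) * deriv (regExp k δ) s) +
      χ (s / M) * deriv (deriv (regExp k δ)) s := by
    intro s
    rw [e1]
    refine ((((hd2 s).mul_const (1 / M)).mul (hg1 s)).add
      ((hd1 s).mul (hg2 s))).deriv.trans ?_
    ring
  refine ⟨fun s => χ (s / M), fun _ => hχ0 _, fun _ => hχ1 _, fun s hs => hχe _ ?_, ?_, ?_, ?_⟩
  · rw [abs_div, abs_of_pos hM0]
    exact div_le_one_of_le₀ hs hM0.le
  · exact (hχ.comp (contDiff_id.div_const M)).mul hG
  · refine HasCompactSupport.mul_right ?_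
    have := hχc.comp_homeomorph (Homeomorph.mulRight₀ M⁻¹ (inv_ne_zero hM0.ne'))
    simpa [div_eq_mul_inv, Function.comp_def] using this
  · intro s a b B ha hb
    have hB : 0 ≤ B := (abs_nonneg a).trans ha
    have g0 := (regExp_pos k δ s).le
    have g1 := abs_deriv_regExp_le hk hδ s
    rw [e2, e1]
    have hi : 0 ≤ 1 / M := by positivity
    have hi1 : 1 / M ≤ 1 := div_le_one_of_le₀ hM hM0.le
    set G := regExp k δ s
    set G1 := deriv (regExp k δ) s
    set i := 1 / M
    set x1 := deriv χ (s / M)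
    set x2 := deriv (deriv χ) (s / M)
    have hx1 : |x1| ≤ K := hK1 _
    have hx2 : |x2| ≤ K := hK2 _
    have t1 : |x1 * G * a| ≤ K * G * B := by
      rw [abs_mul, abs_mul, abs_of_nonneg g0]; gcongr
    have t2 : |i * (x2 * G * b)| ≤ K * G * B := by
      rw [abs_mul, abs_mul, abs_mul, abs_of_nonneg g0, abs_of_nonneg hi]
      calc i * (|x2| * G * |b|) ≤ 1 * (K * G * B) := by gcongr
        _ = _ := one_mul _
    have t3 : |x1 * G1 * b| ≤ K * ((k + k ^ 2) * G) * B := by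
      rw [abs_mul, abs_mul]; gcongr
    have e : (x1 * i * G + χ (s / M) * G1) * a + (x2 * i * i * G + 2 * (x1 * i * G1) +
        χ (s / M) * deriv (deriv (regExp k δ)) s) * b -
        χ (s / M) * (G1 * a + deriv (deriv (regExp k δ)) s * b) =
        i * (x1 * G * a + i * (x2 * G * b) + 2 * (x1 * G1 * b)) := by ring
    rw [e, abs_mul, abs_of_nonneg hi]
    have t4 : |x1 * G * a + i * (x2 * G * b) + 2 * (x1 * G1 * b)| ≤
        K * (2 + 2 * (k + k ^ 2)) * B * G := by
      refine (abs_add_three _ _ _).trans ?_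
      rw [abs_mul (2 : ℝ), abs_of_pos (two_pos : (0 : ℝ) < 2)]
      nlinarith
    calc i * |x1 * G * a + i * (x2 * G * b) + 2 * (x1 * G1 * b)|
        ≤ i * (K * (2 + 2 * (k + k ^ 2)) * B * G) := by gcongr
      _ = _ := by simp only [i]; ring

variable {X : Type*} [MeasurableSpace X] {μ : Measure X} {u ρ a b : ℝ → X → ℝ}

/-- A family of probability densities along which functions of `ρ` evolve by a second order
operator whose first and second order coefficients are `a` and `b`. -/
structure IsMomentFlow (μ : Measure X) (u ρ a b : ℝ → X → ℝ) : Prop where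
  nonneg : ∀ t p, 0 ≤ u t p
  integrable : ∀ t, Integrable (u t) μ
  integral_eq : ∀ t, ∫ p, u t p ∂μ = 1
  rho_nonneg : ∀ t, 0 ≤ t → ∀ p, 0 ≤ ρ t p
  measurable_rho : ∀ t, 0 ≤ t → Measurable (ρ t)
  measurable_fst : ∀ t, 0 ≤ t → Measurable (a t)
  measurable_snd : ∀ t, 0 ≤ t → Measurable (b t)
  bounded : ∀ t₁, ∃ B, ∀ t ∈ Set.Icc 0 t₁, ∀ p, |a t p| ≤ B ∧ |b t p| ≤ B
  hasDerivAt : ∀ H : ℝ → ℝ, ContDiff ℝ ∞ H → HasCompactSupport H → ∀ t, 0 < t →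
    HasDerivAt (fun s => ∫ p, H (ρ s p) * u s p ∂μ)
      (∫ p, (deriv H (ρ t p) * a t p + deriv (deriv H) (ρ t p) * b t p) * u t p ∂μ) t
  continuousWithinAt : ∀ H : ℝ → ℝ, ContDiff ℝ ∞ H → HasCompactSupport H →
    ContinuousWithinAt (fun s => ∫ p, H (ρ s p) * u s p ∂μ) (Set.Ici 0) 0

namespace IsMomentFlow

theorem continuousOn (h : IsMomentFlow μ u ρ a b)
    {H : ℝ → ℝ} (hH : ContDiff ℝ ∞ H) (hc : HasCompactSupport H) (t₁ : ℝ) :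
    ContinuousOn (fun s => ∫ p, H (ρ s p) * u s p ∂μ) (Set.Icc 0 t₁) := by
  intro t ht
  rcases ht.1.eq_or_lt with rfl | h0
  · exact (h.continuousWithinAt H hH hc).mono Set.Icc_subset_Ici_self
  · exact (h.hasDerivAt H hH hc t h0).continuousAt.continuousWithinAt

theorem integrable_mul (h : IsMomentFlow μ u ρ a b)
    {g : ℝ → ℝ} (hg : Continuous g) {C : ℝ} (hC : ∀ s, |g s| ≤ C) {t : ℝ}
    (ht : 0 ≤ t) : Integrable (fun p => g (ρ t p) * u t p) μ :=
  (h.integrable t).bdd_mul (c := C)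
    (hg.measurable.comp (h.measurable_rho t ht)).aestronglyMeasurable
    (.of_forall fun _ => hC _)

theorem integrable_deriv (h : IsMomentFlow μ u ρ a b)
    {H : ℝ → ℝ} (hH : ContDiff ℝ ∞ H) (hc : HasCompactSupport H) {t : ℝ}
    (ht : 0 ≤ t) : Integrable (fun p =>
      (deriv H (ρ t p) * a t p + deriv (deriv H) (ρ t p) * b t p) * u t p) μ := by
  have h1 := (contDiff_infty_iff_deriv.1 hH).2
  have h2 := (contDiff_infty_iff_deriv.1 h1).2
  obtain ⟨C₁, hC₁⟩ := hc.deriv.exists_bound_of_continuous h1.continuous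
  obtain ⟨C₂, hC₂⟩ := hc.deriv.deriv.exists_bound_of_continuous h2.continuous
  obtain ⟨B, hB⟩ := h.bounded t
  refine (h.integrable t).bdd_mul (c := C₁ * B + C₂ * B) ?_ (.of_forall fun p => ?_)
  · exact (((h1.continuous.measurable.comp (h.measurable_rho t ht)).mul
      (h.measurable_fst t ht)).add ((h2.continuous.measurable.comp (h.measurable_rho t ht)).mul
      (h.measurable_snd t ht))).aestronglyMeasurable
  · obtain ⟨ha, hb⟩ := hB t ⟨ht, le_rfl⟩ p
    refine (norm_add_le _ _).trans ?_
    rw [norm_mul, norm_mul]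
    have := (norm_nonneg _).trans (hC₁ (ρ t p))
    have := (norm_nonneg _).trans (hC₂ (ρ t p))
    exact add_le_add (mul_le_mul (hC₁ _) ha (norm_nonneg _) (by assumption))
      (mul_le_mul (hC₂ _) hb (norm_nonneg _) (by assumption))

theorem tendsto_truncation (h : IsMomentFlow μ u ρ a b)
    {g : ℝ → ℝ} (hg0 : ∀ s, 0 ≤ g s) {t : ℝ}
    (ht : 0 ≤ t) (hi : Integrable (fun p => g (ρ t p) * u t p) μ) {θ : ℕ → ℝ → ℝ}
    (h0 : ∀ N s, 0 ≤ θ N s) (h1 : ∀ N s, θ N s ≤ 1)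
    (he : ∀ N : ℕ, ∀ s : ℝ, |s| ≤ N + 1 → θ N s = 1) (hc : ∀ N, Continuous fun s => θ N s * g s) :
    Tendsto (fun N => ∫ p, θ N (ρ t p) * g (ρ t p) * u t p ∂μ) atTop
      (𝓝 (∫ p, g (ρ t p) * u t p ∂μ)) := by
  refine tendsto_integral_of_dominated_convergence (fun p => g (ρ t p) * u t p) ?_ hi ?_ ?_
  · exact fun N => ((hc N).measurable.comp (h.measurable_rho t ht)).aestronglyMeasurable.mul
      (h.integrable t).aestronglyMeasurable
  · refine fun N => .of_forall fun p => ?_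
    have hu := h.nonneg t p
    have hgp := hg0 (ρ t p)
    have ht0 := h0 N (ρ t p)
    rw [norm_of_nonneg (by positivity)]
    refine mul_le_mul_of_nonneg_right ?_ hu
    exact mul_le_of_le_one_left hgp (h1 _ _)
  · refine .of_forall fun p => tendsto_const_nhds.congr' ?_
    filter_upwards [eventually_ge_atTop ⌈|ρ t p|⌉₊] with N hN
    rw [he N _ (by linarith [Nat.ceil_le.1 hN]), one_mul]

theorem integral_regExp_le (h : IsMomentFlow μ u ρ a b)
    {k : ℝ} (hk : 0 ≤ k) (t₁ : ℝ) : ∃ C, 0 ≤ C ∧ ∀ δ, 0 < δ →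
    ∀ s ∈ Set.Icc 0 t₁, ∀ t ∈ Set.Icc 0 t₁, ∫ p, regExp k δ (ρ t p) * u t p ∂μ ≤
      exp (C * t₁) * ∫ p, regExp k δ (ρ s p) * u s p ∂μ := by
  obtain ⟨B, hB⟩ := h.bounded t₁
  obtain ⟨K, hK, htr⟩ := exists_truncation hk
  refine ⟨|2 * (k + k ^ 2) * B|, abs_nonneg _, fun δ hδ s hs t ht => ?_⟩
  have hne : Nonempty X := by
    by_contra hX
    rw [not_nonempty_iff] at hX
    have h1 := h.integral_eq 0
    rw [integral_of_isEmpty] at h1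
    exact zero_ne_one h1
  obtain ⟨p₀⟩ := hne
  have hB0 : 0 ≤ B := (abs_nonneg _).trans (hB s hs p₀).1
  rw [abs_of_nonneg (by positivity)]
  set L := exp (-k * log δ)
  have hL : ∀ s, |regExp k δ s| ≤ L := fun s => by
    rw [abs_of_pos (regExp_pos _ _ _)]; exact regExp_le hk hδ s
  have hL0 : 0 ≤ L := (exp_pos _).le
  have hM : ∀ N : ℕ, (1 : ℝ) ≤ N + 1 := fun N => by linarith [N.cast_nonneg (α := ℝ)]
  choose θ h0 h1 he hsm hcs herr using fun N : ℕ => htr δ hδ.le (N + 1) (hM N)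
  have hgc : Continuous (regExp k δ) := (contDiff_regExp hδ.le).continuous
  have key : ∀ N : ℕ, ∫ p, θ N (ρ t p) * regExp k δ (ρ t p) * u t p ∂μ ≤
      exp (2 * (k + k ^ 2) * B * t₁) * (∫ p, θ N (ρ s p) * regExp k δ (ρ s p) * u s p ∂μ +
        K * B / (N + 1) * L * t₁) := by
    intro N
    refine le_of_abs_deriv_le (by positivity) (by positivity) (h.continuousOn (hsm N) (hcs N) t₁)
      (fun τ hτ => integral_nonneg fun p => mul_nonneg (mul_nonneg (h0 _ _) (regExp_pos _ _ _).le)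
        (h.nonneg _ _)) (fun τ hτ => h.hasDerivAt _ (hsm N) (hcs N) τ hτ.1) ?_ hs ht
    intro τ hτ
    have hb1 : ∀ s, |θ N s * regExp k δ s| ≤ L := fun s => by
      rw [abs_mul, abs_of_nonneg (h0 N s)]
      exact (mul_le_of_le_one_left (abs_nonneg _) (h1 N s)).trans (hL s)
    have hi := h.integrable_mul (hsm N).continuous hb1 hτ.1.le
    have e : 2 * (k + k ^ 2) * B * ∫ p, θ N (ρ τ p) * regExp k δ (ρ τ p) * u τ p ∂μ +
        K * B / (N + 1) * L = ∫ p, (2 * (k + k ^ 2) * B * (θ N (ρ τ p) * regExp k δ (ρ τ p) *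
          u τ p) + K * B / (N + 1) * L * u τ p) ∂μ := by
      rw [integral_add (hi.const_mul _) ((h.integrable τ).const_mul _), integral_const_mul,
        integral_const_mul, h.integral_eq, mul_one]
    rw [e]
    refine abs_integral_le_integral_abs.trans (integral_mono (h.integrable_deriv (hsm N) (hcs N)
      hτ.1.le).abs ((hi.const_mul _).add ((h.integrable τ).const_mul _)) fun p => ?_)
    simp only
    have hu := h.nonneg τ p
    obtain ⟨ha, hb⟩ := hB τ ⟨hτ.1.le, hτ.2.le⟩ p
    rw [abs_mul, abs_of_nonneg hu, ← mul_assoc, ← add_mul]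
    refine mul_le_mul_of_nonneg_right ?_ hu
    have h3 := herr N (ρ τ p) _ _ B ha hb
    have hg0 := (regExp_pos k δ (ρ τ p)).le
    have h4 : K * B / (N + 1) * regExp k δ (ρ τ p) ≤ K * B / (N + 1) * L := by
      gcongr; exact regExp_le hk hδ _
    have h5 : |θ N (ρ τ p) * (deriv (regExp k δ) (ρ τ p) * a τ p +
        deriv (deriv (regExp k δ)) (ρ τ p) * b τ p)| ≤
        2 * (k + k ^ 2) * B * (θ N (ρ τ p) * regExp k δ (ρ τ p)) := by
      rw [abs_mul, abs_of_nonneg (h0 N _)]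
      have h6 : |deriv (regExp k δ) (ρ τ p) * a τ p + deriv (deriv (regExp k δ)) (ρ τ p) * b τ p| ≤
          (k + k ^ 2) * regExp k δ (ρ τ p) * B + (k + k ^ 2) * regExp k δ (ρ τ p) * B := by
        refine (abs_add_le _ _).trans ?_
        rw [abs_mul, abs_mul]
        gcongr
        · exact abs_deriv_regExp_le hk hδ.le _
        · exact abs_deriv_deriv_regExp_le hk hδ.le _
      refine (mul_le_mul_of_nonneg_left h6 (h0 N _)).trans (le_of_eq ?_)
      ring
    have h7 := abs_sub_abs_le_abs_sub (deriv (fun s => θ N s * regExp k δ s) (ρ τ p) * a τ p +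
            deriv (deriv fun s => θ N s * regExp k δ s) (ρ τ p) * b τ p)
          (θ N (ρ τ p) * (deriv (regExp k δ) (ρ τ p) * a τ p +
        deriv (deriv (regExp k δ)) (ρ τ p) * b τ p))
    linarith
  have hlim : ∀ τ ∈ Set.Icc 0 t₁, _ := fun τ hτ => h.tendsto_truncation
    (fun s => (regExp_pos k δ s).le) hτ.1 (h.integrable_mul hgc hL hτ.1) h0 h1 he
    (fun N => (hsm N).continuous)
  have hz : Tendsto (fun N : ℕ => K * B / ((N : ℝ) + 1) * L * t₁) atTop (𝓝 (0 * L * t₁)) :=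
    ((tendsto_const_div_atTop_nhds_zero_nat (K * B)).comp (tendsto_add_atTop_nat 1)).congr
      (by simp) |>.mul_const L |>.mul_const t₁
  have hR := ((hlim s hs).add hz).const_mul (exp (2 * (k + k ^ 2) * B * t₁))
  simpa using le_of_tendsto_of_tendsto' (hlim t ht) hR key

theorem integrable_exp_mul (h : IsMomentFlow μ u ρ a b)
    {k : ℝ} (hk : 0 ≤ k) (t₁ : ℝ) : ∃ C, ∀ s ∈ Set.Icc 0 t₁,
    Integrable (fun p => exp (k * ρ s p) * u s p) μ → ∀ t ∈ Set.Icc 0 t₁,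
      Integrable (fun p => exp (k * ρ t p) * u t p) μ ∧
        ∫ p, exp (k * ρ t p) * u t p ∂μ ≤ C * ∫ p, exp (k * ρ s p) * u s p ∂μ := by
  obtain ⟨C, hC, hle⟩ := h.integral_regExp_le hk t₁
  refine ⟨exp (C * t₁), fun s hs hi t ht => ?_⟩
  set R := exp (C * t₁) * ∫ p, exp (k * ρ s p) * u s p ∂μ with hR
  have hd : ∀ N : ℕ, (0 : ℝ) < 1 / ((N : ℝ) + 1) := fun N => by positivity
  have hint : ∀ δ, 0 < δ → ∀ τ, 0 ≤ τ → Integrable (fun p => regExp k δ (ρ τ p) * u τ p) μ :=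
    fun δ hδ τ hτ => h.integrable_mul (contDiff_regExp hδ.le).continuous
      (fun s => by rw [abs_of_pos (regExp_pos _ _ _)]; exact regExp_le hk hδ s) hτ
  have hb : ∀ N : ℕ, ∫ p, regExp k (1 / ((N : ℝ) + 1)) (ρ t p) * u t p ∂μ ≤ R := fun N => by
    refine (hle _ (hd N) s hs t ht).trans (mul_le_mul_of_nonneg_left ?_ (exp_pos _).le)
    refine integral_mono (hint _ (hd N) s hs.1) hi fun p => ?_
    exact mul_le_mul_of_nonneg_right (regExp_le_exp hk (hd N).le _) (h.nonneg _ _)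
  have hR0 : 0 ≤ R := mul_nonneg (exp_pos _).le
    (integral_nonneg fun p => mul_nonneg (exp_pos _).le (h.nonneg _ _))
  have hn : ∀ p, 0 ≤ exp (k * ρ t p) * u t p := fun p => mul_nonneg (exp_pos _).le (h.nonneg _ _)
  have hm : AEStronglyMeasurable (fun p => exp (k * ρ t p) * u t p) μ :=
    (((h.measurable_rho t ht.1).const_mul k).exp.aestronglyMeasurable).mul
      (h.integrable t).aestronglyMeasurable
  have hl : ∫⁻ p, ENNReal.ofReal (exp (k * ρ t p) * u t p) ∂μ ≤ ENNReal.ofReal R := by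
    have hlim : ∀ p, Tendsto (fun N : ℕ => ENNReal.ofReal
        (regExp k (1 / ((N : ℝ) + 1)) (ρ t p) * u t p)) atTop
        (𝓝 (ENNReal.ofReal (exp (k * ρ t p) * u t p))) := fun p => by
      refine (ENNReal.continuous_ofReal.tendsto _).comp (Tendsto.mul_const _ ?_)
      have h1 : Tendsto (fun N : ℕ => exp (-ρ t p) + 1 / ((N : ℝ) + 1)) atTop
          (𝓝 (exp (-ρ t p) + 0)) := tendsto_const_nhds.add tendsto_one_div_add_atTop_nhds_zero_nat
      have h2 := (h1.log (by rw [add_zero]; exact (exp_pos _).ne')).const_mul (-k)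
      have h3 := (continuous_exp.tendsto _).comp h2
      simpa [regExp, Function.comp_def] using h3
    calc ∫⁻ p, ENNReal.ofReal (exp (k * ρ t p) * u t p) ∂μ
        = ∫⁻ p, liminf (fun N : ℕ => ENNReal.ofReal
            (regExp k (1 / ((N : ℝ) + 1)) (ρ t p) * u t p)) atTop ∂μ :=
          lintegral_congr fun p => (hlim p).liminf_eq.symm
      _ ≤ liminf (fun N : ℕ => ∫⁻ p, ENNReal.ofReal
            (regExp k (1 / ((N : ℝ) + 1)) (ρ t p) * u t p) ∂μ) atTop :=
          lintegral_liminf_le' fun N => (hint _ (hd N) t ht.1).aemeasurable.ennreal_ofReal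
      _ ≤ liminf (fun _ : ℕ => ENNReal.ofReal R) atTop := by
          refine liminf_le_liminf (.of_forall fun N => ?_)
          rw [← ofReal_integral_eq_lintegral_ofReal (hint _ (hd N) t ht.1)
            (.of_forall fun p => mul_nonneg (regExp_pos _ _ _).le (h.nonneg _ _))]
          exact ENNReal.ofReal_le_ofReal (hb N)
      _ = ENNReal.ofReal R := liminf_const _
  refine ⟨⟨hm, ?_⟩, ?_⟩
  · rw [hasFiniteIntegral_iff_ofReal (.of_forall hn)]
    exact hl.trans_lt ENNReal.ofReal_lt_top
  · rw [integral_eq_lintegral_of_nonneg_ae (.of_forall hn) hm]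
    exact ENNReal.toReal_le_of_le_ofReal hR0 hl

theorem exists_integral_exp_le (h : IsMomentFlow μ u ρ a b)
    {k C c : ℝ} (hk : 0 ≤ k) (hC : 0 < C) (hc : 0 < c) {κ : ℝ → ℝ}
    (hκ : ∀ t, 0 ≤ t → 0 ≤ κ t)
    (hdis : ∀ t, 0 ≤ t → ∀ p, k * a t p + k ^ 2 * b t p ≤ κ t * (C * exp (-ρ t p) - c)) :
    ∃ M, ∀ t, 0 ≤ t → ∫ p, exp (k * ρ t p) * u t p ∂μ ≤ M := by
  by_cases hex : ∃ s, 0 ≤ s ∧ Integrable (fun p => exp (k * ρ s p) * u s p) μ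
  swap
  · push Not at hex
    exact ⟨0, fun t ht => (integral_undef (hex t ht)).le⟩
  have hI0 : Integrable (fun p => exp (k * ρ 0 p) * u 0 p) μ := by
    obtain ⟨s, hs, hi⟩ := hex
    obtain ⟨C', hC'⟩ := h.integrable_exp_mul hk s
    exact (hC' s ⟨hs, le_rfl⟩ hi 0 ⟨le_rfl, hs⟩).1
  set I := fun t => ∫ p, exp (k * ρ t p) * u t p ∂μ with hI
  have hIn : ∀ t, 0 ≤ I t := fun t =>
    integral_nonneg fun p => mul_nonneg (exp_pos _).le (h.nonneg _ _)
  set C₃ := C * exp (k * log (2 * C / c)) with hC₃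
  have hC₃0 : 0 < C₃ := mul_pos hC (exp_pos _)
  refine ⟨max (I 0) (C₃ / (c / 2)), fun t ht => ?_⟩
  obtain ⟨C', hC'⟩ := h.integrable_exp_mul hk t
  have hit : ∀ τ ∈ Set.Icc 0 t, _ := hC' 0 ⟨le_rfl, ht⟩ hI0
  obtain ⟨B, hB⟩ := h.bounded t
  obtain ⟨K, hK, htr⟩ := exists_truncation hk
  have hne : Nonempty X := by
    by_contra hX
    rw [not_nonempty_iff] at hX
    have h1 := h.integral_eq 0
    rw [integral_of_isEmpty] at h1
    exact zero_ne_one h1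
  obtain ⟨p₀⟩ := hne
  have hB0 : 0 ≤ B := (abs_nonneg _).trans (hB t ⟨ht, le_rfl⟩ p₀).1
  have hM : ∀ N : ℕ, (1 : ℝ) ≤ N + 1 := fun N => by linarith [N.cast_nonneg (α := ℝ)]
  choose θ h0 h1 he hsm hcs herr using fun N : ℕ => htr 0 le_rfl (N + 1) (hM N)
  have hR0 : regExp k 0 = fun s => exp (k * s) := funext (regExp_zero k)
  have hR1 : ∀ s, deriv (regExp k 0) s = k * exp (k * s) := fun s => by
    rw [deriv_regExp le_rfl]; simp [regExp_zero]
  have hR2 : ∀ s, deriv (deriv (regExp k 0)) s = k ^ 2 * exp (k * s) := fun s => by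
    rw [deriv_deriv_regExp le_rfl]; simp [regExp_zero]
  set J := C' * I 0 with hJ
  have hJ0 : 0 ≤ J := (hIn t).trans (hit t ⟨ht, le_rfl⟩).2
  have key : ∀ N : ℕ, ∫ p, θ N (ρ t p) * regExp k 0 (ρ t p) * u t p ∂μ ≤
      max (∫ p, θ N (ρ 0 p) * regExp k 0 (ρ 0 p) * u 0 p ∂μ) (C₃ / (c / 2)) +
        K * B / (N + 1) * J * t := by
    intro N
    refine le_max_add_of_deriv_le (κ := κ) ht (half_pos hc) (by positivity)
      (fun τ hτ => hκ τ hτ.1.le) (h.continuousOn (hsm N) (hcs N) t)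
      (fun τ hτ => h.hasDerivAt _ (hsm N) (hcs N) τ hτ.1) ?_
    intro τ hτ
    obtain ⟨hiτ, hbτ⟩ := hit τ ⟨hτ.1.le, hτ.2.le⟩
    obtain ⟨L, hL⟩ := (hcs N).exists_bound_of_continuous (hsm N).continuous
    have hi := h.integrable_mul (hsm N).continuous hL hτ.1.le
    have hR : ∫ p, ((κ τ * C₃ * u τ p - κ τ * (c / 2) *
          (θ N (ρ τ p) * regExp k 0 (ρ τ p) * u τ p)) + K * B / (N + 1) *
          (exp (k * ρ τ p) * u τ p)) ∂μ ≤
        κ τ * (C₃ - c / 2 * ∫ p, θ N (ρ τ p) * regExp k 0 (ρ τ p) * u τ p ∂μ) +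
          K * B / (N + 1) * J := by
      have hs : Integrable (fun p => κ τ * C₃ * u τ p - κ τ * (c / 2) *
          (θ N (ρ τ p) * regExp k 0 (ρ τ p) * u τ p)) μ :=
        ((h.integrable τ).const_mul _).sub (hi.const_mul _)
      rw [integral_add hs (hiτ.const_mul _),
        integral_sub ((h.integrable τ).const_mul _) (hi.const_mul _), integral_const_mul,
        integral_const_mul, integral_const_mul, h.integral_eq]
      have : K * B / (N + 1) * ∫ p, exp (k * ρ τ p) * u τ p ∂μ ≤ K * B / (N + 1) * J := by
        gcongr
      linarith
    refine le_trans ?_ hR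
    refine integral_mono (h.integrable_deriv (hsm N) (hcs N) hτ.1.le)
      ((((h.integrable τ).const_mul _).sub (hi.const_mul _)).add (hiτ.const_mul _)) fun p => ?_
    have hu := h.nonneg τ p
    obtain ⟨ha, hb⟩ := hB τ ⟨hτ.1.le, hτ.2.le⟩ p
    have h3 := (abs_le.1 (herr N (ρ τ p) _ _ B ha hb)).2
    rw [hR1, hR2, regExp_zero] at h3
    have h4 := hdis τ hτ.1.le p
    have hκ0 := hκ τ hτ.1.le
    have hx := exp_pos (k * ρ τ p)
    have hθ0 := h0 N (ρ τ p)
    have hθ1 := h1 N (ρ τ p)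
    have h5 : θ N (ρ τ p) * exp (k * ρ τ p) * (C * exp (-ρ τ p) - c / 2) ≤ C₃ := by
      rcases le_or_gt (C * exp (-ρ τ p)) (c / 2) with hle | hgt
      · exact (mul_nonpos_of_nonneg_of_nonpos (by positivity) (by linarith)).trans hC₃0.le
      · have h6 : exp (ρ τ p) ≤ 2 * C / c := by
          rw [exp_neg, ← div_eq_mul_inv, lt_div_iff₀ (exp_pos _)] at hgt
          rw [le_div_iff₀ hc]
          linarith
        have h7 : ρ τ p ≤ log (2 * C / c) := by
          rwa [le_log_iff_exp_le (by positivity)]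
        have h8 : C * exp (-ρ τ p) - c / 2 ≤ C := by
          have : exp (-ρ τ p) ≤ 1 := exp_le_one_iff.2 (by linarith [h.rho_nonneg τ hτ.1.le p])
          nlinarith
        calc θ N (ρ τ p) * exp (k * ρ τ p) * (C * exp (-ρ τ p) - c / 2)
            ≤ 1 * exp (k * log (2 * C / c)) * C := by gcongr
          _ = C₃ := by rw [hC₃]; ring
    have h9 : θ N (ρ τ p) * (k * exp (k * ρ τ p) * a τ p + k ^ 2 * exp (k * ρ τ p) * b τ p) ≤
        κ τ * C₃ - κ τ * (c / 2) * (θ N (ρ τ p) * exp (k * ρ τ p)) := by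
      have h10 := mul_le_mul_of_nonneg_left h4 (mul_nonneg hθ0 hx.le)
      have h11 := mul_le_mul_of_nonneg_left h5 hκ0
      linarith
    have h12 := mul_le_mul_of_nonneg_right (add_le_add h3 h9) hu
    simp only [regExp_zero] at h12 ⊢
    linarith
  have hlim : ∀ τ ∈ Set.Icc 0 t, Tendsto (fun N => ∫ p, θ N (ρ τ p) * regExp k 0 (ρ τ p) * u τ p ∂μ)
      atTop (𝓝 (I τ)) := fun τ hτ => by
    have := h.tendsto_truncation (fun s => (regExp_pos k 0 s).le) hτ.1
      (by simpa only [regExp_zero] using (hit τ hτ).1) h0 h1 he (fun N => (hsm N).continuous)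
    simpa only [hI, regExp_zero] using this
  have hz : Tendsto (fun N : ℕ => K * B / ((N : ℝ) + 1) * J * t) atTop (𝓝 (0 * J * t)) :=
    ((tendsto_const_div_atTop_nhds_zero_nat (K * B)).comp (tendsto_add_atTop_nat 1)).congr
      (by simp) |>.mul_const J |>.mul_const t
  have hR := ((hlim 0 ⟨le_rfl, ht⟩).max (tendsto_const_nhds (x := C₃ / (c / 2)))).add hz
  simpa using le_of_tendsto_of_tendsto' (hlim t ⟨ht, le_rfl⟩) hR key

end IsMomentFlow

end Moment

section Lyapunov

open scoped Matrix

variable {n m : ℕ}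

theorem sqnorm_eq_dotProduct {k : ℕ} (v : Fin k → ℝ) : sqnorm v = v ⬝ᵥ v := by
  simp [sqnorm, dotProduct, sq]

theorem sqnorm_nonneg {k : ℕ} (v : Fin k → ℝ) : 0 ≤ sqnorm v :=
  Finset.sum_nonneg fun _ _ => sq_nonneg _

theorem contDiff_dotProduct {E : Type*} [NormedAddCommGroup E] [NormedSpace ℝ E] {k : ℕ}
    {f g : E → Fin k → ℝ} (hf : ContDiff ℝ ∞ f) (hg : ContDiff ℝ ∞ g) :
    ContDiff ℝ ∞ fun p => f p ⬝ᵥ g p := by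
  unfold dotProduct
  exact ContDiff.sum fun i _ => (contDiff_pi.1 hf i).mul (contDiff_pi.1 hg i)

theorem contDiff_mulVec {k l : ℕ} (M : Matrix (Fin k) (Fin l) ℝ) :
    ContDiff ℝ ∞ fun v : Fin l → ℝ => M *ᵥ v :=
  contDiff_pi.2 fun i => contDiff_mulVec_apply M i

theorem fderiv_apply_eq_of_hasDerivAt {E : Type*} [NormedAddCommGroup E] [NormedSpace ℝ E]
    {f : E → ℝ} {p v : E} {d : ℝ} (hf : DifferentiableAt ℝ f p)
    (h : HasDerivAt (fun s : ℝ => f (p + s • v)) d 0) : fderiv ℝ f p v = d :=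
  HasDerivAt.unique (hf.hasFDerivAt.hasLineDerivAt v : HasDerivAt _ _ _) h

theorem fderiv_apply_eq_of_forall {E : Type*} [NormedAddCommGroup E] [NormedSpace ℝ E]
    {f : E → ℝ} {p v : E} {d e : ℝ} (hf : DifferentiableAt ℝ f p)
    (h : ∀ s : ℝ, f (p + s • v) = f p + s * d + s ^ 2 * e) : fderiv ℝ f p v = d := by
  refine fderiv_apply_eq_of_hasDerivAt hf ?_
  simp_rw [h]
  have h1 := (((hasDerivAt_id (0 : ℝ)).mul_const d).const_add (f p)).add
    (((hasDerivAt_id (0 : ℝ)).pow 2).mul_const e)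
  refine (h1.congr_deriv (by simp)).congr_of_eventuallyEq (.of_forall fun s => ?_)
  simp

/-- The energy part of the Lyapunov function. -/
def energy (U : (Fin n → ℝ) → ℝ) (Um : ℝ) (p : St n m) : ℝ :=
  U p.1 - Um + (p.2.1 ⬝ᵥ p.2.1) / 2 + (p.2.2 ⬝ᵥ p.2.2) / 2

/-- The cross terms of the Lyapunov function. -/
def crossTerm (Λ : Matrix (Fin n) (Fin m) ℝ) (p : St n m) : ℝ :=
  p.2.1 ⬝ᵥ Λ *ᵥ p.2.2 + (p.1 ⬝ᵥ p.2.1) / 2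

/-- The normalised Lyapunov function. -/
def lyap (U : (Fin n → ℝ) → ℝ) (Um : ℝ) (Λ : Matrix (Fin n) (Fin m) ℝ) (κ : ℝ) (p : St n m) : ℝ :=
  1 + κ * energy U Um p + κ ^ 2 * crossTerm Λ p

variable {U : (Fin n → ℝ) → ℝ} (Um : ℝ) (Λ : Matrix (Fin n) (Fin m) ℝ) (κ : ℝ)

theorem contDiff_energy (hU : ContDiff ℝ ∞ U) : ContDiff ℝ ∞ (energy (m := m) U Um) := by
  have h2 : ContDiff ℝ ∞ fun p : St n m => p.2.1 := by fun_prop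
  have h3 : ContDiff ℝ ∞ fun p : St n m => p.2.2 := by fun_prop
  exact (((hU.comp contDiff_fst).sub contDiff_const).add
    ((contDiff_dotProduct h2 h2).div_const 2)).add
    ((contDiff_dotProduct h3 h3).div_const 2)

theorem contDiff_crossTerm : ContDiff ℝ ∞ (crossTerm Λ) := by
  have h1 : ContDiff ℝ ∞ fun p : St n m => p.1 := by fun_prop
  have h2 : ContDiff ℝ ∞ fun p : St n m => p.2.1 := by fun_prop
  have h3 : ContDiff ℝ ∞ fun p : St n m => p.2.2 := by fun_prop
  exact (contDiff_dotProduct h2 ((contDiff_mulVec Λ).comp h3)).add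
    ((contDiff_dotProduct h1 h2).div_const 2)

theorem contDiff_lyap (hU : ContDiff ℝ ∞ U) : ContDiff ℝ ∞ (lyap U Um Λ κ) :=
  (contDiff_const.add (contDiff_const.mul (contDiff_energy Um hU))).add
    (contDiff_const.mul (contDiff_crossTerm Λ))

theorem pX_lyap (hU : ContDiff ℝ ∞ U) (i : Fin n) (p : St n m) :
    pX (lyap U Um Λ κ) i p = κ * gradp U p.1 i + κ ^ 2 / 2 * p.2.1 i := by
  refine fderiv_apply_eq_of_hasDerivAt
    ((contDiff_lyap Um Λ κ hU).differentiable (by simp) p) ?_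
  have hUd : HasDerivAt (fun s : ℝ => U (p.1 + s • Pi.single i 1)) (gradp U p.1 i) 0 :=
    (hU.differentiable (by simp) p.1).hasFDerivAt.hasLineDerivAt (Pi.single i 1)
  have h := ((hUd.const_mul κ).add ((hasDerivAt_id (0 : ℝ)).const_mul
    (κ ^ 2 / 2 * p.2.1 i))).add_const (lyap U Um Λ κ p - κ * U p.1)
  rw [mul_one] at h
  refine h.congr_of_eventuallyEq (.of_forall fun s => ?_)
  simp [lyap, energy, crossTerm]
  ring

theorem pY_lyap (hU : ContDiff ℝ ∞ U) (i : Fin n) (p : St n m) :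
    pY (lyap U Um Λ κ) i p = κ * p.2.1 i + κ ^ 2 * ((Λ *ᵥ p.2.2) i + p.1 i / 2) := by
  refine fderiv_apply_eq_of_forall (e := κ / 2)
    ((contDiff_lyap Um Λ κ hU).differentiable (by simp) p) fun s => ?_
  simp [lyap, energy, crossTerm]
  ring

theorem pZ_lyap (hU : ContDiff ℝ ∞ U) (j : Fin m) (p : St n m) :
    pZ (lyap U Um Λ κ) j p = κ * p.2.2 j + κ ^ 2 * (Λᵀ *ᵥ p.2.1) j := by
  refine fderiv_apply_eq_of_forall (e := κ / 2)
    ((contDiff_lyap Um Λ κ hU).differentiable (by simp) p) fun s => ?_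
  have h : p.2.1 ⬝ᵥ Λ.col j = (Λᵀ *ᵥ p.2.1) j := by
    rw [dotProduct_comm]; rfl
  simp [lyap, energy, crossTerm, Matrix.mulVec_add, Matrix.mulVec_smul, h]
  ring

theorem pZ_pZ_lyap (hU : ContDiff ℝ ∞ U) (i j : Fin m) (p : St n m) :
    pZ (fun q => pZ (lyap U Um Λ κ) j q) i p = if i = j then κ else 0 := by
  simp_rw [pZ_lyap Um Λ κ hU]
  have hd : DifferentiableAt ℝ (fun q : St n m => κ * q.2.2 j + κ ^ 2 * (Λᵀ *ᵥ q.2.1) j) p := by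
    have h1 : ContDiff ℝ ∞ fun q : St n m => (Λᵀ *ᵥ q.2.1) j :=
      (contDiff_mulVec_apply Λᵀ j).comp (by fun_prop)
    have h2 : ContDiff ℝ ∞ fun q : St n m => κ * q.2.2 j + κ ^ 2 * (Λᵀ *ᵥ q.2.1) j := by fun_prop
    exact h2.differentiable (by simp) p
  refine fderiv_apply_eq_of_forall (e := 0) hd fun s => ?_
  by_cases hij : i = j
  · subst hij; simp; ring
  · simp [hij, Ne.symm hij]

theorem genL_lyap (hU : ContDiff ℝ ∞ U) (A : Matrix (Fin m) (Fin m) ℝ)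
    {lam : Matrix (Fin m) (Fin n) ℝ} (hΛ : Λ * lam = 1) (T : ℝ) (p : St n m) :
    genL U A lam T (lyap U Um Λ κ) p = κ * A.trace - T⁻¹ * κ * (Aᵀ *ᵥ p.2.2 ⬝ᵥ p.2.2) -
      T⁻¹ * κ ^ 2 * (Aᵀ *ᵥ p.2.2 ⬝ᵥ Λᵀ *ᵥ p.2.1) +
      κ ^ 2 * (-(p.2.1 ⬝ᵥ p.2.1) / 2 - gradp U p.1 ⬝ᵥ Λ *ᵥ p.2.2 - (gradp U p.1 ⬝ᵥ p.1) / 2 +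
        lamᵀ *ᵥ p.2.2 ⬝ᵥ Λ *ᵥ p.2.2 + (lamᵀ *ᵥ p.2.2 ⬝ᵥ p.1) / 2) := by
  have h1 : lam *ᵥ p.2.1 ⬝ᵥ Λᵀ *ᵥ p.2.1 = p.2.1 ⬝ᵥ p.2.1 := by
    rw [Matrix.mulVec_transpose, dotProduct_comm, ← Matrix.dotProduct_mulVec,
      Matrix.mulVec_mulVec, hΛ, Matrix.one_mulVec]
  have h2 : lam *ᵥ p.2.1 ⬝ᵥ p.2.2 = lamᵀ *ᵥ p.2.2 ⬝ᵥ p.2.1 := by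
    rw [Matrix.mulVec_transpose, ← Matrix.dotProduct_mulVec, dotProduct_comm]
  have h3 : ∑ i, ∑ j, A i j * pZ (fun q => pZ (lyap U Um Λ κ) j q) i p = κ * A.trace := by
    simp_rw [pZ_pZ_lyap Um Λ κ hU]
    simp [Matrix.trace, Finset.mul_sum, mul_comm]
  have s1 : ∑ i, p.2.1 i * pX (lyap U Um Λ κ) i p =
      κ * (gradp U p.1 ⬝ᵥ p.2.1) + κ ^ 2 / 2 * (p.2.1 ⬝ᵥ p.2.1) := by
    simp_rw [pX_lyap Um Λ κ hU, dotProduct, Finset.mul_sum, ← Finset.sum_add_distrib]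
    exact Finset.sum_congr rfl fun _ _ => by ring
  have s2 : ∀ w : Fin n → ℝ, ∑ i, w i * pY (lyap U Um Λ κ) i p =
      κ * (w ⬝ᵥ p.2.1) + κ ^ 2 * (w ⬝ᵥ Λ *ᵥ p.2.2) + κ ^ 2 / 2 * (w ⬝ᵥ p.1) := by
    intro w
    simp_rw [pY_lyap Um Λ κ hU, dotProduct, Finset.mul_sum, ← Finset.sum_add_distrib]
    exact Finset.sum_congr rfl fun _ _ => by ring
  have s3 : ∀ w : Fin m → ℝ, ∑ i, w i * pZ (lyap U Um Λ κ) i p =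
      κ * (w ⬝ᵥ p.2.2) + κ ^ 2 * (w ⬝ᵥ Λᵀ *ᵥ p.2.1) := by
    intro w
    simp_rw [pZ_lyap Um Λ κ hU, dotProduct, Finset.mul_sum, ← Finset.sum_add_distrib]
    exact Finset.sum_congr rfl fun _ _ => by ring
  rw [genL, h3, s1, s2, s2, s3, s3, h1, h2]
  ring

/-- The quadratic form `∇_z f · A ∇_z f`. -/
def carre (A : Matrix (Fin m) (Fin m) ℝ) (f : St n m → ℝ) (p : St n m) : ℝ :=
  ∑ i, ∑ j, A i j * (pZ f i p * pZ f j p)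

theorem carre_lyap (hU : ContDiff ℝ ∞ U) (A : Matrix (Fin m) (Fin m) ℝ) (p : St n m) :
    carre A (lyap U Um Λ κ) p = κ ^ 2 * ((p.2.2 + κ • Λᵀ *ᵥ p.2.1) ⬝ᵥ
      A *ᵥ (p.2.2 + κ • Λᵀ *ᵥ p.2.1)) := by
  simp only [carre, pZ_lyap Um Λ κ hU]
  generalize Λᵀ *ᵥ p.2.1 = w
  simp only [Matrix.mulVec, dotProduct, Finset.mul_sum]
  refine Finset.sum_congr rfl fun i _ => Finset.sum_congr rfl fun j _ => ?_
  simp only [Pi.add_apply, Pi.smul_apply, smul_eq_mul]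
  ring

theorem genL_comp {f : St n m → ℝ} (hf : ContDiff ℝ ∞ f) {H H₁ H₂ : ℝ → ℝ}
    (h₁ : ∀ p, HasDerivAt H (H₁ (f p)) (f p)) (h₂ : ∀ p, HasDerivAt H₁ (H₂ (f p)) (f p))
    (A : Matrix (Fin m) (Fin m) ℝ) (lam : Matrix (Fin m) (Fin n) ℝ) (T : ℝ) (p : St n m) :
    genL U A lam T (fun q => H (f q)) p =
      H₁ (f p) * genL U A lam T f p + H₂ (f p) * carre A f p := by
  have hd : ∀ q, HasFDerivAt (fun q => H (f q)) (H₁ (f q) • fderiv ℝ f q) q := fun q =>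
    (h₁ q).comp_hasFDerivAt q (hf.differentiable (by simp) q).hasFDerivAt
  have e1 : ∀ i q, pX (fun q => H (f q)) i q = H₁ (f q) * pX f i q := fun i q => by
    rw [pX, (hd q).fderiv]; rfl
  have e2 : ∀ i q, pY (fun q => H (f q)) i q = H₁ (f q) * pY f i q := fun i q => by
    rw [pY, (hd q).fderiv]; rfl
  have e3 : ∀ j q, pZ (fun q => H (f q)) j q = H₁ (f q) * pZ f j q := fun i q => by
    rw [pZ, (hd q).fderiv]; rfl
  have e4 : ∀ i j, pZ (fun q => pZ (fun q => H (f q)) j q) i p =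
      H₁ (f p) * pZ (fun q => pZ f j q) i p + H₂ (f p) * (pZ f i p * pZ f j p) := fun i j => by
    simp_rw [e3]
    have hg : ContDiff ℝ ∞ fun q => pZ f j q :=
      (hf.fderiv_right (m := ∞) le_rfl).clm_apply contDiff_const
    have h3 := ((h₂ p).comp_hasFDerivAt p (hf.differentiable (by simp) p).hasFDerivAt).mul
      (hg.differentiable (by simp) p).hasFDerivAt
    rw [pZ]
    refine (congrArg (fun L => L (0, 0, Pi.single i 1)) h3.fderiv).trans ?_
    simp only [add_apply, smul_apply, smul_eq_mul,
      Function.comp_apply, pZ]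
    ring
  simp only [genL, carre, e1, e2, e4]
  simp only [e3, mul_add, Finset.sum_add_distrib,
    mul_left_comm _ (H₁ (f p)), mul_left_comm _ (H₂ (f p)), ← Finset.mul_sum]
  ring

end Lyapunov

section Bounds

open scoped Matrix

variable {n m : ℕ}

theorem exists_sqnorm_mulVec_le {k l : ℕ} (M : Matrix (Fin k) (Fin l) ℝ) :
    ∃ L, 0 < L ∧ ∀ v, sqnorm (M *ᵥ v) ≤ L * sqnorm v := by
  refine ⟨1 + ∑ i, ∑ j, M i j ^ 2, by positivity, fun v => ?_⟩
  have h : sqnorm (M *ᵥ v) ≤ (∑ i, ∑ j, M i j ^ 2) * sqnorm v := by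
    rw [sqnorm, Finset.sum_mul]
    exact Finset.sum_le_sum fun i _ =>
      Finset.sum_mul_sq_le_sq_mul_sq Finset.univ (M i) v
  linarith [sqnorm_nonneg v]

theorem abs_dotProduct_le {k : ℕ} (v w : Fin k → ℝ) {η : ℝ} (hη : 0 < η) :
    |v ⬝ᵥ w| ≤ η * sqnorm v + (4 * η)⁻¹ * sqnorm w := by
  rw [dotProduct, sqnorm, sqnorm, Finset.mul_sum, Finset.mul_sum, ← Finset.sum_add_distrib]
  refine (Finset.abs_sum_le_sum_abs _ _).trans (Finset.sum_le_sum fun i _ => ?_)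
  rw [abs_mul, ← sq_abs (v i), ← sq_abs (w i)]
  have h : η * |v i| ^ 2 + (4 * η)⁻¹ * |w i| ^ 2 - |v i| * |w i| =
      η * (|v i| - (2 * η)⁻¹ * |w i|) ^ 2 := by field_simp; ring
  have : 0 ≤ η * (|v i| - (2 * η)⁻¹ * |w i|) ^ 2 := by positivity
  linarith

theorem exists_abs_dotProduct_mulVec_le {k l a : ℕ} (M : Matrix (Fin a) (Fin k) ℝ)
    (M' : Matrix (Fin a) (Fin l) ℝ) : ∃ L, 0 < L ∧ ∀ v w,
      |M *ᵥ v ⬝ᵥ M' *ᵥ w| ≤ L * (sqnorm v + sqnorm w) := by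
  obtain ⟨L, hL, h⟩ := exists_sqnorm_mulVec_le M
  obtain ⟨L', hL', h'⟩ := exists_sqnorm_mulVec_le M'
  refine ⟨L + L', by positivity, fun v w => ?_⟩
  have h1 := abs_dotProduct_le (M *ᵥ v) (M' *ᵥ w) (η := 1) one_pos
  have := h v
  have := h' w
  have := sqnorm_nonneg v
  have := sqnorm_nonneg w
  have := sqnorm_nonneg (M' *ᵥ w)
  have := mul_nonneg hL.le (sqnorm_nonneg w)
  have := mul_nonneg hL'.le (sqnorm_nonneg v)
  norm_num at h1
  nlinarith

/-- The squared Euclidean norm of a point of the state space. -/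
def stSq (p : St n m) : ℝ := sqnorm p.1 + sqnorm p.2.1 + sqnorm p.2.2

theorem stSq_nonneg (p : St n m) : 0 ≤ stSq p :=
  add_nonneg (add_nonneg (sqnorm_nonneg _) (sqnorm_nonneg _)) (sqnorm_nonneg _)

theorem exists_energy_bounds {U : (Fin n → ℝ) → ℝ} {abar : Fin n → ℝ} (habar : ∀ i, 0 < abar i)
    {Um UM : ℝ} (hUlow : ∀ x, sqnorm (fun i => abar i * x i) + Um ≤ U x)
    (hUup : ∀ x, U x ≤ sqnorm (fun i => abar i * x i) + UM) :
    ∃ c K, 0 < c ∧ 0 < K ∧ ∀ p : St n m, c * stSq p ≤ energy U Um p ∧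
      energy U Um p ≤ K * (1 + stSq p) := by
  obtain ⟨a, ha, hle⟩ : ∃ a, 0 < a ∧ ∀ i, a ≤ abar i := by
    rcases isEmpty_or_nonempty (Fin n) with hn | hn
    · exact ⟨1, one_pos, fun i => hn.elim i⟩
    · obtain ⟨i, hi⟩ := Finite.exists_min abar
      exact ⟨abar i, habar i, hi⟩
  have hup : ∀ x : Fin n → ℝ, sqnorm (fun i => abar i * x i) ≤ sqnorm abar * sqnorm x := by
    intro x
    rw [sqnorm, sqnorm, Finset.sum_mul]
    refine Finset.sum_le_sum fun i _ => ?_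
    rw [mul_pow]
    exact mul_le_mul_of_nonneg_left (Finset.single_le_sum (f := fun i => x i ^ 2)
      (fun _ _ => sq_nonneg _) (Finset.mem_univ i)) (sq_nonneg _)
  have hlow : ∀ x : Fin n → ℝ, a ^ 2 * sqnorm x ≤ sqnorm (fun i => abar i * x i) := by
    intro x
    rw [sqnorm, sqnorm, Finset.mul_sum]
    refine Finset.sum_le_sum fun i _ => ?_
    rw [mul_pow]
    exact mul_le_mul_of_nonneg_right (pow_le_pow_left₀ ha.le (hle i) 2) (sq_nonneg _)
  have hab := sqnorm_nonneg abar
  refine ⟨min (a ^ 2) (1 / 2), sqnorm abar + 1 + |UM - Um|, by positivity, by positivity,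
    fun p => ?_⟩
  have hx := sqnorm_nonneg p.1
  have hy := sqnorm_nonneg p.2.1
  have hz := sqnorm_nonneg p.2.2
  rw [energy, ← sqnorm_eq_dotProduct, ← sqnorm_eq_dotProduct, stSq]
  constructor
  · have h1 := mul_le_mul_of_nonneg_right (min_le_left (a ^ 2) (1 / 2)) hx
    have h2 := mul_le_mul_of_nonneg_right (min_le_right (a ^ 2) (1 / 2)) hy
    have h3 := mul_le_mul_of_nonneg_right (min_le_right (a ^ 2) (1 / 2)) hz
    linarith [hUlow p.1, hlow p.1]
  · have h1 := hUup p.1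
    have h2 := hup p.1
    have h3 := le_abs_self (UM - Um)
    have h4 := abs_nonneg (UM - Um)
    have h5 := mul_nonneg h4 (add_nonneg (add_nonneg hx hy) hz)
    have h6 := mul_nonneg hab (add_nonneg hy hz)
    linarith

theorem exists_abs_crossTerm_le (Λ : Matrix (Fin n) (Fin m) ℝ) :
    ∃ K, 0 < K ∧ ∀ p : St n m, |crossTerm Λ p| ≤ K * stSq p := by
  obtain ⟨L, hL, h⟩ := exists_sqnorm_mulVec_le Λ
  refine ⟨L + 2, by positivity, fun p => ?_⟩
  have h1 := abs_dotProduct_le p.2.1 (Λ *ᵥ p.2.2) one_pos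
  have h2 := abs_dotProduct_le p.1 p.2.1 one_pos
  have h3 := h p.2.2
  have h4 : |crossTerm Λ p| ≤ |p.2.1 ⬝ᵥ Λ *ᵥ p.2.2| + |p.1 ⬝ᵥ p.2.1| / 2 := by
    refine (abs_add_le _ _).trans (le_of_eq ?_)
    rw [abs_div, abs_of_pos (two_pos : (0 : ℝ) < 2)]
  have hx := sqnorm_nonneg p.1
  have hy := sqnorm_nonneg p.2.1
  have hz := sqnorm_nonneg p.2.2
  have h5 := mul_nonneg hL.le hx
  have h6 := mul_nonneg hL.le hy
  have h7 := mul_nonneg hL.le hz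
  norm_num at h1 h2
  rw [stSq]
  linarith

theorem exists_lyap_bounds {U : (Fin n → ℝ) → ℝ} {abar : Fin n → ℝ} (habar : ∀ i, 0 < abar i)
    {Um UM : ℝ} (hUlow : ∀ x, sqnorm (fun i => abar i * x i) + Um ≤ U x)
    (hUup : ∀ x, U x ≤ sqnorm (fun i => abar i * x i) + UM) (Λ : Matrix (Fin n) (Fin m) ℝ) :
    ∃ ε c K, 0 < ε ∧ 0 < c ∧ 0 < K ∧ ∀ κ, 0 < κ → κ ≤ ε → ∀ p : St n m,
      1 + c * (κ * stSq p) ≤ lyap U Um Λ κ p ∧ lyap U Um Λ κ p ≤ K * (1 + κ * stSq p) ∧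
      0 ≤ energy U Um p + 2 * κ * crossTerm Λ p ∧
      κ * (energy U Um p + 2 * κ * crossTerm Λ p) ≤ 2 * lyap U Um Λ κ p := by
  obtain ⟨c, K, hc, hK, he⟩ := exists_energy_bounds (m := m) habar hUlow hUup
  obtain ⟨L, hL, hl⟩ := exists_abs_crossTerm_le Λ
  refine ⟨min 1 (c / (2 * L)), c / 2, 1 + 2 * K + 2 * L, by positivity, by positivity,
    by positivity, fun κ hκ hκε p => ?_⟩
  have hκ1 : κ ≤ 1 := hκε.trans (min_le_left _ _)
  have hκ2 : κ * (2 * L) ≤ c := by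
    rw [← le_div_iff₀ (by positivity)]; exact hκε.trans (min_le_right _ _)
  obtain ⟨he1, he2⟩ := he p
  obtain ⟨hl1, hl2⟩ := abs_le.1 (hl p)
  have hs := stSq_nonneg p
  have h1 : κ * crossTerm Λ p ≤ c / 2 * stSq p := by
    have := mul_le_mul_of_nonneg_left hl2 hκ.le
    have := mul_le_mul_of_nonneg_right hκ2 hs
    linarith
  have h2 : -(c / 2 * stSq p) ≤ κ * crossTerm Λ p := by
    have := mul_le_mul_of_nonneg_left hl1 hκ.le
    have := mul_le_mul_of_nonneg_right hκ2 hs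
    linarith
  have h1' := mul_le_mul_of_nonneg_left h1 hκ.le
  have h2' := mul_le_mul_of_nonneg_left h2 hκ.le
  have he1' := mul_le_mul_of_nonneg_left he1 hκ.le
  have he2' := mul_le_mul_of_nonneg_left he2 hκ.le
  have h3 := mul_nonneg hκ.le hs
  have h4 := mul_nonneg hK.le h3
  have h5 := mul_nonneg hL.le h3
  rw [lyap]
  refine ⟨by linarith, ?_, by linarith, by linarith⟩
  have h6 : κ ^ 2 * crossTerm Λ p ≤ L * (κ * stSq p) := by
    have a1 := mul_le_mul_of_nonneg_left hl2 (sq_nonneg κ)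
    have a2 := mul_le_mul_of_nonneg_right hκ1 h5
    linarith
  have h7 : κ * K ≤ K := by nlinarith
  linarith

theorem exists_carre_lyap_bounds {U : (Fin n → ℝ) → ℝ} (hU : ContDiff ℝ ∞ U) (Um : ℝ)
    (Λ : Matrix (Fin n) (Fin m) ℝ) {A : Matrix (Fin m) (Fin m) ℝ} {Ac : ℝ} (hAc : 0 < Ac)
    (hApd : ∀ v : Fin m → ℝ, Ac * sqnorm v ≤ ∑ j, v j * A.mulVec v j) :
    ∃ K, 0 < K ∧ ∀ κ, 0 < κ → κ ≤ 1 → ∀ p : St n m, 0 ≤ carre A (lyap U Um Λ κ) p ∧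
      carre A (lyap U Um Λ κ) p ≤ κ * (K * (κ * stSq p)) := by
  obtain ⟨L, hL, hl⟩ := exists_abs_dotProduct_mulVec_le (1 : Matrix (Fin m) (Fin m) ℝ) A
  obtain ⟨L', hL', hl'⟩ := exists_sqnorm_mulVec_le Λᵀ
  refine ⟨2 * L * (2 + 2 * L'), by positivity, fun κ hκ hκ1 p => ?_⟩
  rw [carre_lyap Um Λ κ hU]
  set w := p.2.2 + κ • Λᵀ *ᵥ p.2.1 with hw
  have hw0 := sqnorm_nonneg w
  have h1 : Ac * sqnorm w ≤ w ⬝ᵥ A *ᵥ w := hApd w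
  have h2 := (abs_le.1 (hl w w)).2
  rw [Matrix.one_mulVec] at h2
  have h3 : sqnorm w ≤ 2 * sqnorm p.2.2 + 2 * (κ ^ 2 * sqnorm (Λᵀ *ᵥ p.2.1)) := by
    simp only [sqnorm, Finset.mul_sum, ← Finset.sum_add_distrib]
    refine Finset.sum_le_sum fun i _ => ?_
    simp only [hw, Pi.add_apply, Pi.smul_apply, smul_eq_mul]
    nlinarith [sq_nonneg (p.2.2 i - κ * (Λᵀ *ᵥ p.2.1) i)]
  have h4 : κ ^ 2 * sqnorm (Λᵀ *ᵥ p.2.1) ≤ 1 * (L' * sqnorm p.2.1) :=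
    mul_le_mul (pow_le_one₀ hκ.le hκ1) (hl' _) (sqnorm_nonneg _) zero_le_one
  have h5 : sqnorm w ≤ (2 + 2 * L') * stSq p := by
    have hx := sqnorm_nonneg p.1
    have hy := sqnorm_nonneg p.2.1
    have hz := sqnorm_nonneg p.2.2
    have := mul_nonneg hL'.le hx
    have := mul_nonneg hL'.le hz
    rw [stSq]
    linarith
  refine ⟨mul_nonneg (sq_nonneg _) ((mul_nonneg hAc.le hw0).trans h1), ?_⟩
  calc κ ^ 2 * (w ⬝ᵥ A *ᵥ w) ≤ κ ^ 2 * (2 * L * ((2 + 2 * L') * stSq p)) := by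
        refine mul_le_mul_of_nonneg_left ?_ (sq_nonneg _)
        have := mul_le_mul_of_nonneg_left h5 (mul_nonneg (two_pos (α := ℝ)).le hL.le)
        linarith
    _ = _ := by ring

theorem exists_abs_genL_lyap_le {U : (Fin n → ℝ) → ℝ} (hU : ContDiff ℝ ∞ U) (Um : ℝ)
    {Λ : Matrix (Fin n) (Fin m) ℝ} (A : Matrix (Fin m) (Fin m) ℝ) {lam : Matrix (Fin m) (Fin n) ℝ}
    (hΛ : Λ * lam = 1) {r2 Ug : ℝ} (hr2 : 0 < r2) (hUg : 0 < Ug)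
    (hgrad2 : ∀ x, sqnorm (gradp U x) ≤ r2 * sqnorm x + Ug) :
    ∃ K, 0 < K ∧ ∀ κ T, 0 < κ → κ ≤ 1 → 0 < T → ∀ p : St n m,
      |genL U A lam T (lyap U Um Λ κ) p| ≤ K * (1 + T⁻¹) * (1 + κ * stSq p) := by
  obtain ⟨L₁, hL₁, h₁⟩ := exists_abs_dotProduct_mulVec_le Aᵀ (1 : Matrix (Fin m) (Fin m) ℝ)
  obtain ⟨L₂, hL₂, h₂⟩ := exists_abs_dotProduct_mulVec_le Aᵀ Λᵀ
  obtain ⟨L₃, hL₃, h₃⟩ := exists_sqnorm_mulVec_le Λ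
  obtain ⟨L₄, hL₄, h₄⟩ := exists_abs_dotProduct_mulVec_le lamᵀ Λ
  obtain ⟨L₅, hL₅, h₅⟩ := exists_abs_dotProduct_mulVec_le lamᵀ (1 : Matrix (Fin n) (Fin n) ℝ)
  set M := 1 + 2 * r2 + L₃ + 2 * L₄ + L₅ + 2 * Ug with hM
  refine ⟨|A.trace| + 2 * L₁ + L₂ + M, by positivity, fun κ T hκ hκ1 hT p => ?_⟩
  rw [genL_lyap Um Λ κ hU A hΛ, ← sqnorm_eq_dotProduct]
  have hx := sqnorm_nonneg p.1
  have hy := sqnorm_nonneg p.2.1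
  have hz := sqnorm_nonneg p.2.2
  have hs := stSq_nonneg p
  have e₁ := h₁ p.2.2 p.2.2
  have e₂ := h₂ p.2.2 p.2.1
  have e₃ := abs_dotProduct_le (gradp U p.1) (Λ *ᵥ p.2.2) one_pos
  have e₄ := h₄ p.2.2 p.2.2
  have e₅ := h₅ p.2.2 p.1
  have e₆ := abs_dotProduct_le (gradp U p.1) p.1 one_pos
  rw [Matrix.one_mulVec] at e₁ e₅
  have g := hgrad2 p.1
  have g3 := h₃ p.2.2
  norm_num at e₃ e₆
  have hτ : 0 < T⁻¹ := inv_pos.2 hT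
  set τ := T⁻¹
  set s := stSq p with hsd
  have hs1 : s = sqnorm p.1 + sqnorm p.2.1 + sqnorm p.2.2 := rfl
  have b1 : |Aᵀ *ᵥ p.2.2 ⬝ᵥ p.2.2| ≤ 2 * L₁ * s := by
    have := mul_nonneg hL₁.le hx; have := mul_nonneg hL₁.le hy
    rw [hs1]; linarith
  have b2 : |Aᵀ *ᵥ p.2.2 ⬝ᵥ Λᵀ *ᵥ p.2.1| ≤ L₂ * s := by
    have := mul_nonneg hL₂.le hx
    rw [hs1]; linarith
  have b3 : |-sqnorm p.2.1 / 2 - gradp U p.1 ⬝ᵥ Λ *ᵥ p.2.2 - gradp U p.1 ⬝ᵥ p.1 / 2 +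
      lamᵀ *ᵥ p.2.2 ⬝ᵥ Λ *ᵥ p.2.2 + lamᵀ *ᵥ p.2.2 ⬝ᵥ p.1 / 2| ≤ M * (1 + s) := by
    have q1 := mul_nonneg hr2.le hx
    have q2 := mul_nonneg hr2.le hy
    have q3 := mul_nonneg hr2.le hz
    have q4 := mul_nonneg hL₃.le hx
    have q5 := mul_nonneg hL₃.le hy
    have q6 := mul_nonneg hL₃.le hz
    have q7 := mul_nonneg hL₄.le hx
    have q8 := mul_nonneg hL₄.le hy
    have q9 := mul_nonneg hL₄.le hz
    have q10 := mul_nonneg hL₅.le hx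
    have q11 := mul_nonneg hL₅.le hy
    have q12 := mul_nonneg hL₅.le hz
    have q13 := mul_nonneg hUg.le hs
    rw [hs1] at q13
    obtain ⟨a1, a2⟩ := abs_le.1 e₃
    obtain ⟨a3, a4⟩ := abs_le.1 e₄
    obtain ⟨a5, a6⟩ := abs_le.1 e₅
    obtain ⟨a7, a8⟩ := abs_le.1 e₆
    rw [hM, hs1, abs_le]
    constructor <;> linarith
  have hks : 0 ≤ κ * s := mul_nonneg hκ.le hs
  have hk2 : κ ^ 2 ≤ κ := by nlinarith
  have c0 : |κ * A.trace| ≤ |A.trace| := by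
    rw [abs_mul, abs_of_pos hκ]; exact mul_le_of_le_one_left (abs_nonneg _) hκ1
  have c1 : |τ * κ * (Aᵀ *ᵥ p.2.2 ⬝ᵥ p.2.2)| ≤ τ * κ * (2 * L₁ * s) := by
    rw [abs_mul, abs_of_pos (mul_pos hτ hκ)]
    exact mul_le_mul_of_nonneg_left b1 (mul_pos hτ hκ).le
  have c2 : |τ * κ ^ 2 * (Aᵀ *ᵥ p.2.2 ⬝ᵥ Λᵀ *ᵥ p.2.1)| ≤ τ * κ * (L₂ * s) := by
    rw [abs_mul, abs_of_pos (by positivity)]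
    gcongr
  have c3 := mul_le_mul_of_nonneg_left b3 (sq_nonneg κ)
  rw [← abs_of_nonneg (sq_nonneg κ), ← abs_mul, abs_of_nonneg (sq_nonneg κ)] at c3
  have c4 : κ ^ 2 * (M * (1 + s)) ≤ M * (1 + κ * s) := by
    have hM0 : 0 < M := by positivity
    have : κ ^ 2 * (1 + s) ≤ 1 + κ * s := by
      have := mul_le_mul_of_nonneg_right hk2 hs
      linarith
    have := mul_le_mul_of_nonneg_left this hM0.le
    linarith
  refine (abs_add_le _ _).trans ((add_le_add ((abs_sub _ _).trans (add_le_add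
    ((abs_sub _ _).trans (add_le_add c0 c1)) c2)) (c3.trans c4)).trans ?_)
  have hA := abs_nonneg A.trace
  have hM0 : 0 < M := by positivity
  have z1 : 0 ≤ |A.trace| * (τ + τ * (κ * s) + κ * s) := by positivity
  have z2 : 0 ≤ (2 * L₁ + L₂) * (1 + κ * s + τ) := by positivity
  have z3 : 0 ≤ M * (τ * (1 + κ * s)) := by positivity
  linarith

theorem exists_genL_lyap_le {U : (Fin n → ℝ) → ℝ} (hU : ContDiff ℝ ∞ U) (Um : ℝ)
    {Λ : Matrix (Fin n) (Fin m) ℝ} {A : Matrix (Fin m) (Fin m) ℝ} {lam : Matrix (Fin m) (Fin n) ℝ}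
    (hΛ : Λ * lam = 1) {Ac : ℝ} (hAc : 0 < Ac)
    (hApd : ∀ v : Fin m → ℝ, Ac * sqnorm v ≤ ∑ j, v j * A.mulVec v j)
    {r1 r2 Ug : ℝ} (hr1 : 0 < r1) (hr2 : 0 < r2) (hUg : 0 < Ug)
    (hgrad1 : ∀ x, r1 * sqnorm x - Ug ≤ ∑ i, gradp U x i * x i)
    (hgrad2 : ∀ x, sqnorm (gradp U x) ≤ r2 * sqnorm x + Ug) :
    ∃ ε c K, 0 < ε ∧ 0 < c ∧ 0 < K ∧ ∀ κ T, 0 < κ → κ ≤ 1 → 0 < T → κ * T⁻¹ ≤ ε → κ ≤ ε * T⁻¹ →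
      ∀ p : St n m, genL U A lam T (lyap U Um Λ κ) p ≤ κ * (K - c * (κ * stSq p)) := by
  obtain ⟨L₁, hL₁, h₁⟩ := exists_sqnorm_mulVec_le Aᵀ
  obtain ⟨L₂, hL₂, h₂⟩ := exists_sqnorm_mulVec_le Λᵀ
  obtain ⟨L₃, hL₃, h₃⟩ := exists_sqnorm_mulVec_le Λ
  obtain ⟨L₄, hL₄, h₄⟩ := exists_abs_dotProduct_mulVec_le lamᵀ Λ
  obtain ⟨L₅, hL₅, h₅⟩ := exists_sqnorm_mulVec_le lamᵀ
  set K₁ := 2 * L₂ * L₁ with hK₁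
  set K₅ := 2 * r2 / r1 * L₃ + 2 * L₄ + (r1 / 4)⁻¹ * L₅ with hK₅
  set c := min (1 / 4) (r1 / 8) with hc
  have hc0 : 0 < c := by positivity
  have hK₁0 : 0 < K₁ := by positivity
  have hK₅0 : 0 < K₅ := by positivity
  refine ⟨min (Ac / (2 * K₁)) (Ac / (2 * (K₅ + c))), c,
    |A.trace| + Ug + Ug * (r1 / (8 * r2)), by positivity, hc0, by positivity,
    fun κ T hκ hκ1 hT hε₁ hε₂ p => ?_⟩
  rw [genL_lyap Um Λ κ hU A hΛ, ← sqnorm_eq_dotProduct]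
  have hx := sqnorm_nonneg p.1
  have hy := sqnorm_nonneg p.2.1
  have hz := sqnorm_nonneg p.2.2
  have hτ : 0 < T⁻¹ := inv_pos.2 hT
  set τ := T⁻¹
  have hε₁' : κ * τ * (2 * K₁) ≤ Ac := by
    rw [← le_div_iff₀ (by positivity)]; exact hε₁.trans (min_le_left _ _)
  have hε₂' : κ * (2 * (K₅ + c)) ≤ Ac * τ := by
    have h1 : κ ≤ Ac / (2 * (K₅ + c)) * τ :=
      hε₂.trans (mul_le_mul_of_nonneg_right (min_le_right _ _) hτ.le)
    rw [div_mul_eq_mul_div] at h1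
    rwa [← le_div_iff₀ (by positivity)]
  have a1 : Ac * sqnorm p.2.2 ≤ Aᵀ *ᵥ p.2.2 ⬝ᵥ p.2.2 := by
    rw [Matrix.mulVec_transpose, ← Matrix.dotProduct_mulVec]; exact hApd p.2.2
  have a2 : -(Aᵀ *ᵥ p.2.2 ⬝ᵥ Λᵀ *ᵥ p.2.1) * τ ≤ 1 / 8 * sqnorm p.2.1 +
      τ ^ 2 * (K₁ * sqnorm p.2.2) := by
    have e := abs_dotProduct_le (Aᵀ *ᵥ p.2.2) (Λᵀ *ᵥ p.2.1) (η := 2 * L₂ * τ) (by positivity)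
    have e' := mul_le_mul_of_nonneg_right ((neg_le_abs _).trans e) hτ.le
    refine e'.trans ?_
    have f1 := mul_le_mul_of_nonneg_left (h₁ p.2.2) (by positivity : 0 ≤ 2 * L₂ * τ ^ 2)
    have f2 := mul_le_mul_of_nonneg_left (h₂ p.2.1) (by positivity : 0 ≤ (8 * L₂)⁻¹)
    have f3 : (4 * (2 * L₂ * τ))⁻¹ * sqnorm (Λᵀ *ᵥ p.2.1) * τ =
        (8 * L₂)⁻¹ * sqnorm (Λᵀ *ᵥ p.2.1) := by field_simp; ring
    have f4 : (8 * L₂)⁻¹ * (L₂ * sqnorm p.2.1) = 1 / 8 * sqnorm p.2.1 := by field_simp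
    rw [add_mul, f3]
    rw [f4] at f2
    rw [hK₁]
    linarith
  have a3 : -(gradp U p.1 ⬝ᵥ Λ *ᵥ p.2.2) ≤ r1 / 8 * sqnorm p.1 + Ug * (r1 / (8 * r2)) +
      2 * r2 / r1 * L₃ * sqnorm p.2.2 := by
    have e := (neg_le_abs _).trans
      (abs_dotProduct_le (gradp U p.1) (Λ *ᵥ p.2.2) (η := r1 / (8 * r2)) (by positivity))
    have f1 := mul_le_mul_of_nonneg_left (hgrad2 p.1) (by positivity : 0 ≤ r1 / (8 * r2))
    have f2 := mul_le_mul_of_nonneg_left (h₃ p.2.2) (by positivity : 0 ≤ (4 * (r1 / (8 * r2)))⁻¹)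
    have f3 : r1 / (8 * r2) * (r2 * sqnorm p.1 + Ug) = r1 / 8 * sqnorm p.1 +
      Ug * (r1 / (8 * r2)) := by field_simp
    have f4 : (4 * (r1 / (8 * r2)))⁻¹ = 2 * r2 / r1 := by field_simp; norm_num
    rw [f4] at f2 e
    rw [f3] at f1
    linarith
  have a4 := (le_abs_self _).trans (h₄ p.2.2 p.2.2)
  have a5 : lamᵀ *ᵥ p.2.2 ⬝ᵥ p.1 ≤ (r1 / 4)⁻¹ * L₅ * sqnorm p.2.2 + r1 / 4 * sqnorm p.1 := by
    have e := (le_abs_self _).trans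
      (abs_dotProduct_le (lamᵀ *ᵥ p.2.2) p.1 (η := r1⁻¹) (by positivity))
    have f2 := mul_le_mul_of_nonneg_left (h₅ p.2.2) (by positivity : 0 ≤ r1⁻¹)
    have f4 : (4 * r1⁻¹)⁻¹ = r1 / 4 := by field_simp
    have f5 : (r1 / 4)⁻¹ = 4 * r1⁻¹ := by field_simp
    rw [f4] at e
    rw [f5]
    have := mul_nonneg (mul_nonneg (inv_pos.2 hr1).le hL₅.le) hz
    linarith
  have a6 : r1 * sqnorm p.1 - Ug ≤ gradp U p.1 ⬝ᵥ p.1 := hgrad1 p.1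
  have b0 : κ * A.trace ≤ κ * |A.trace| := mul_le_mul_of_nonneg_left (le_abs_self _) hκ.le
  have b1 := mul_le_mul_of_nonneg_left a1 (mul_pos hτ hκ).le
  have b2 := mul_le_mul_of_nonneg_left a2 (sq_nonneg κ)
  have b3 : -sqnorm p.2.1 / 2 - gradp U p.1 ⬝ᵥ Λ *ᵥ p.2.2 - gradp U p.1 ⬝ᵥ p.1 / 2 +
      lamᵀ *ᵥ p.2.2 ⬝ᵥ Λ *ᵥ p.2.2 + lamᵀ *ᵥ p.2.2 ⬝ᵥ p.1 / 2 ≤ -sqnorm p.2.1 / 2 -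
      r1 / 4 * sqnorm p.1 + K₅ * sqnorm p.2.2 + (Ug + Ug * (r1 / (8 * r2))) := by
    have := mul_nonneg (mul_nonneg (inv_pos.2 (by positivity : 0 < r1 / 4)).le hL₅.le) hz
    rw [hK₅]
    linarith
  have b3' := mul_le_mul_of_nonneg_left b3 (sq_nonneg κ)
  have k1 : κ ^ 2 * (Ug + Ug * (r1 / (8 * r2))) ≤ κ * (Ug + Ug * (r1 / (8 * r2))) := by
    refine mul_le_mul_of_nonneg_right ?_ (by positivity)
    nlinarith
  have d1 := mul_le_mul_of_nonneg_right hε₁' (by positivity : 0 ≤ κ * τ * sqnorm p.2.2)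
  have d2 := mul_le_mul_of_nonneg_right hε₂' (by positivity : 0 ≤ κ * sqnorm p.2.2)
  have cy := mul_le_mul_of_nonneg_right (min_le_left (1 / 4) (r1 / 8))
    (by positivity : 0 ≤ κ ^ 2 * sqnorm p.2.1)
  have cx := mul_le_mul_of_nonneg_right (min_le_right (1 / 4) (r1 / 8))
    (by positivity : 0 ≤ κ ^ 2 * sqnorm p.1)
  rw [← hc] at cx cy
  have px : 0 ≤ κ ^ 2 * sqnorm p.1 := by positivity
  have py : 0 ≤ κ ^ 2 * sqnorm p.2.1 := by positivity
  have px' := mul_nonneg hr1.le px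
  rw [stSq]
  linarith

end Bounds

section TimeDependent

variable {E : Type*} [MeasurableSpace E] {μ : Measure E}

/-- Leibniz rule for a time-dependent test function integrated against a moving density. -/
theorem hasDerivAt_integral_mul_of_density {u φ ψ : ℝ → E → ℝ} {C B M t D : ℝ}
    (hu : ∀ s, Integrable (u s) μ) (hu0 : ∀ s p, 0 ≤ u s p) (hu1 : ∀ s, ∫ p, u s p ∂μ = C)
    (hut : ∀ p, ContinuousAt (fun s => u s p) t)
    (hφm : ∀ᶠ s in 𝓝 t, Measurable (φ s)) (hφB : ∀ᶠ s in 𝓝 t, ∀ p, |φ s p| ≤ B)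
    (hψ : ∀ᶠ s in 𝓝 t, ∀ p, HasDerivAt (fun s => φ s p) (ψ s p) s ∧ |ψ s p| ≤ M)
    (hD : HasDerivAt (fun s => ∫ p, φ t p * u s p ∂μ) D t) :
    HasDerivAt (fun s => ∫ p, φ s p * u s p ∂μ) ((∫ p, ψ t p * u t p ∂μ) + D) t := by
  classical
  obtain ⟨r, hr, hball⟩ := Metric.eventually_nhds_iff_ball.1 (hφm.and (hφB.and hψ))
  have htr : t ∈ Metric.ball t r := Metric.mem_ball_self hr
  set g : ℝ → E → ℝ := fun s p =>
    if s ∈ Metric.ball t r then (s - t)⁻¹ * (φ s p - φ t p) else 0 with hg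
  have hgm : ∀ s, Measurable (g s) := by
    intro s
    by_cases hs : s ∈ Metric.ball t r
    · simp only [hg, if_pos hs]
      exact ((hball s hs).1.sub (hball t htr).1).const_mul _
    · simp only [hg, if_neg hs]
      exact measurable_const
  have hnear : ∀ᶠ s in 𝓝[≠] t, s ∈ Metric.ball t r :=
    mem_nhdsWithin_of_mem_nhds (Metric.ball_mem_nhds t hr)
  have hgM : ∀ᶠ s in 𝓝[≠] t, ∀ p, |g s p| ≤ M := by
    filter_upwards [hnear, self_mem_nhdsWithin] with s hs hne p
    have hst : 0 < |s - t| := abs_pos.2 (sub_ne_zero.2 hne)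
    have := (convex_ball t r).norm_image_sub_le_of_norm_hasDerivWithin_le (C := M)
      (fun y hy => ((hball y hy).2.2 p).1.hasDerivWithinAt)
      (fun y hy => ((hball y hy).2.2 p).2) htr hs
    simp only [hg, if_pos hs, abs_mul, abs_inv]
    rw [inv_mul_le_iff₀ hst, mul_comm]
    exact this
  have hglim : ∀ p, Tendsto (fun s => g s p) (𝓝[≠] t) (𝓝 (ψ t p)) := by
    intro p
    have := hasDerivAt_iff_tendsto_slope.1 ((hball t htr).2.2 p).1
    refine this.congr' ?_
    filter_upwards [hnear] with s hs
    simp only [hg, if_pos hs, slope_def_module, smul_eq_mul]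
  have h1 := tendsto_integral_mul_of_density hu (hu t) hu0 hu1 (hu1 t)
    (fun p => (hut p).tendsto.mono_left nhdsWithin_le_nhds)
    (fun s => (hgm s).aestronglyMeasurable) hgM hglim
  have h2 := hasDerivAt_iff_tendsto_slope.1 hD
  rw [hasDerivAt_iff_tendsto_slope]
  refine (h1.add h2).congr' ?_
  filter_upwards [hnear] with s hs
  have hint : ∀ s' ∈ Metric.ball t r, Integrable (fun p => φ s' p * u s p) μ := fun s' hs' =>
    (hu s).bdd_mul (c := B) (hball s' hs').1.aestronglyMeasurable
      (.of_forall (hball s' hs').2.1)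
  have hintt : Integrable (fun p => φ t p * u t p) μ :=
    (hu t).bdd_mul (c := B) (hball t htr).1.aestronglyMeasurable (.of_forall (hball t htr).2.1)
  have e : ∫ p, g s p * u s p ∂μ =
      (s - t)⁻¹ * ((∫ p, φ s p * u s p ∂μ) - ∫ p, φ t p * u s p ∂μ) := by
    rw [← integral_sub (hint s hs) (hint t htr), ← integral_const_mul]
    refine integral_congr_ae (.of_forall fun p => ?_)
    simp only [hg, if_pos hs]
    ring
  rw [e, slope_def_module, slope_def_module, smul_eq_mul, smul_eq_mul]
  ring

end TimeDependent

section Drift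

open scoped Matrix

variable {n m : ℕ}

theorem continuous_genL {U : (Fin n → ℝ) → ℝ} (hU : ContDiff ℝ ∞ U)
    (A : Matrix (Fin m) (Fin m) ℝ) (lam : Matrix (Fin m) (Fin n) ℝ) (T : ℝ) {f : St n m → ℝ}
    (hf : ContDiff ℝ ∞ f) : Continuous (genL U A lam T f) := by
  have c (v : St n m) : ContDiff ℝ ∞ fun q => fderiv ℝ f q v :=
    (hf.fderiv_right (m := ∞) le_rfl).clm_apply contDiff_const
  have c1 : ∀ i, Continuous (pX f i) := fun i => (c _).continuous
  have c2 : ∀ i, Continuous (pY f i) := fun i => (c _).continuous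
  have c3 : ∀ j, Continuous (pZ f j) := fun j => (c _).continuous
  have c4 : ∀ i j, Continuous (pZ (pZ f j) i) := fun i j =>
    (((c (0, 0, Pi.single j 1)).fderiv_right (m := ∞) le_rfl).clm_apply
      contDiff_const).continuous
  have c5 : ∀ i, Continuous fun p : St n m => gradp U p.1 i := fun i =>
    (contDiff_gradp hU i).continuous.comp continuous_fst
  unfold genL
  have c6 : ∀ i, Continuous fun p : St n m => (lam.transpose.mulVec p.2.2) i := fun i =>
    (contDiff_mulVec_apply _ i).continuous.comp (by fun_prop)
  have c7 : ∀ i, Continuous fun p : St n m => (lam.mulVec p.2.1) i := fun i =>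
    (contDiff_mulVec_apply _ i).continuous.comp (by fun_prop)
  have c8 : ∀ i, Continuous fun p : St n m => (A.transpose.mulVec p.2.2) i := fun i =>
    (contDiff_mulVec_apply _ i).continuous.comp (by fun_prop)
  fun_prop

theorem continuous_carre (A : Matrix (Fin m) (Fin m) ℝ) {f : St n m → ℝ}
    (hf : ContDiff ℝ ∞ f) : Continuous (carre A f) := by
  have c3 : ∀ j, Continuous (pZ f j) := fun j =>
    ((hf.fderiv_right (m := ∞) le_rfl).clm_apply contDiff_const).continuous
  unfold carre
  fun_prop

theorem norm_sq_le_stSq (p : St n m) : ‖p‖ ^ 2 ≤ stSq p := by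
  have key {k : ℕ} (v : Fin k → ℝ) : ‖v‖ ≤ √(sqnorm v) := by
    refine (pi_norm_le_iff_of_nonneg (sqrt_nonneg _)).2 fun i => ?_
    rw [Real.norm_eq_abs, ← sqrt_sq_eq_abs]
    exact sqrt_le_sqrt (Finset.single_le_sum (f := fun i => v i ^ 2)
      (fun i _ => sq_nonneg _) (Finset.mem_univ i))
  have hx := sqnorm_nonneg p.1
  have hy := sqnorm_nonneg p.2.1
  have hz := sqnorm_nonneg p.2.2
  have h : ‖p‖ ≤ √(stSq p) := by
    refine max_le ((key _).trans (sqrt_le_sqrt ?_)) (max_le ((key _).trans (sqrt_le_sqrt ?_))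
      ((key _).trans (sqrt_le_sqrt ?_))) <;> · rw [stSq]; linarith
  calc ‖p‖ ^ 2 ≤ √(stSq p) ^ 2 := pow_le_pow_left₀ (norm_nonneg _) h 2
    _ = _ := sq_sqrt (stSq_nonneg p)

/-- The derivative of `lyap` along a parameter depending on time. -/
def lyapRate (U : (Fin n → ℝ) → ℝ) (Um : ℝ) (Λ : Matrix (Fin n) (Fin m) ℝ) (κ κ' : ℝ)
    (p : St n m) : ℝ :=
  κ' * (energy U Um p + 2 * κ * crossTerm Λ p)

theorem hasDerivAt_lyap (U : (Fin n → ℝ) → ℝ) (Um : ℝ) (Λ : Matrix (Fin n) (Fin m) ℝ)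
    {κ : ℝ → ℝ} {κ' t : ℝ} (h : HasDerivAt κ κ' t) (p : St n m) :
    HasDerivAt (fun s => lyap U Um Λ (κ s) p) (lyapRate U Um Λ (κ t) κ' p) t := by
  refine (((h.mul_const _).const_add 1).add ((h.pow 2).mul_const _)).congr_deriv ?_
  rw [lyapRate]
  push_cast
  ring

theorem continuous_lyapRate {U : (Fin n → ℝ) → ℝ} (hU : ContDiff ℝ ∞ U) (Um : ℝ)
    (Λ : Matrix (Fin n) (Fin m) ℝ) (κ κ' : ℝ) :
    Continuous (lyapRate U Um Λ κ κ' : St n m → ℝ) := by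
  have h1 := (contDiff_energy (m := m) Um hU).continuous
  have h2 := (contDiff_crossTerm Λ).continuous
  unfold lyapRate
  fun_prop

/-- The time derivative plus generator applied to the Lyapunov function. -/
def lyapDrift (U : (Fin n → ℝ) → ℝ) (Um : ℝ) (A : Matrix (Fin m) (Fin m) ℝ)
    (lam : Matrix (Fin m) (Fin n) ℝ) (Λ : Matrix (Fin n) (Fin m) ℝ) (T κ κ' : ℝ)
    (p : St n m) : ℝ :=
  lyapRate U Um Λ κ κ' p + genL U A lam T (lyap U Um Λ κ) p

theorem exists_lyapDrift_bounds {U : (Fin n → ℝ) → ℝ} (hU : ContDiff ℝ ∞ U)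
    {abar : Fin n → ℝ} (habar : ∀ i, 0 < abar i)
    {r1 r2 Ug : ℝ} (hr1 : 0 < r1) (hr2 : 0 < r2) (hUg : 0 < Ug) {Um UM : ℝ}
    (hUlow : ∀ x, sqnorm (fun i => abar i * x i) + Um ≤ U x)
    (hUup : ∀ x, U x ≤ sqnorm (fun i => abar i * x i) + UM)
    (hgrad1 : ∀ x, r1 * sqnorm x - Ug ≤ ∑ i, gradp U x i * x i)
    (hgrad2 : ∀ x, sqnorm (gradp U x) ≤ r2 * sqnorm x + Ug)
    {A : Matrix (Fin m) (Fin m) ℝ} {Ac : ℝ} (hAc : 0 < Ac)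
    (hApd : ∀ v : Fin m → ℝ, Ac * sqnorm v ≤ ∑ j, v j * A.mulVec v j)
    {lam : Matrix (Fin m) (Fin n) ℝ} {Λ : Matrix (Fin n) (Fin m) ℝ} (hΛ : Λ * lam = 1) :
    ∃ ε c K, 0 < ε ∧ 0 < c ∧ 0 < K ∧ ∀ κ κ' T, 0 < κ → κ ≤ ε → 0 < T → κ * T⁻¹ ≤ ε →
      κ ≤ ε * T⁻¹ → κ' ≤ 0 → -κ' ≤ κ → ∀ p : St n m,
        1 + c * (κ * stSq p) ≤ lyap U Um Λ κ p ∧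
        lyap U Um Λ κ p ≤ K * (1 + κ * stSq p) ∧
        |lyapRate U Um Λ κ κ' p| ≤ K * lyap U Um Λ κ p ∧
        |genL U A lam T (lyap U Um Λ κ) p| ≤ K * (1 + T⁻¹) * lyap U Um Λ κ p ∧
        lyapDrift U Um A lam Λ T κ κ' p ≤ κ * (K - c * lyap U Um Λ κ p) ∧
        0 ≤ carre A (lyap U Um Λ κ) p ∧
        carre A (lyap U Um Λ κ) p ≤ κ * (K * lyap U Um Λ κ p) := by
  obtain ⟨ε₁, c₁, K₁, hε₁, hc₁, hK₁, h₁⟩ := exists_lyap_bounds habar hUlow hUup Λ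
  obtain ⟨K₂, hK₂, h₂⟩ := exists_carre_lyap_bounds hU Um Λ hAc hApd
  obtain ⟨K₃, hK₃, h₃⟩ := exists_abs_genL_lyap_le hU Um A hΛ hr2 hUg hgrad2
  obtain ⟨ε₄, c₄, K₄, hε₄, hc₄, hK₄, h₄⟩ :=
    exists_genL_lyap_le hU Um hΛ hAc hApd hr1 hr2 hUg hgrad1 hgrad2
  have hcK : 0 < c₄ / K₁ := by positivity
  refine ⟨min 1 (min ε₁ ε₄), min c₁ (c₄ / K₁),
    2 + K₁ + K₂ / c₁ + K₃ * (1 + c₁⁻¹) + K₄ + c₄, by positivity, by positivity, by positivity, ?_⟩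
  intro κ κ' T hκ hκε hT hκT hTκ hκ'0 hκ' p
  have hN := mul_nonneg hκ.le (stSq_nonneg p)
  have hτ : 0 < T⁻¹ := by positivity
  have e1 : κ ≤ 1 := hκε.trans (min_le_left _ _)
  have e2 : κ ≤ ε₁ := hκε.trans ((min_le_right _ _).trans (min_le_left _ _))
  have e3 : min 1 (min ε₁ ε₄) ≤ ε₄ := (min_le_right _ _).trans (min_le_right _ _)
  obtain ⟨b1, b2, b3, b4⟩ := h₁ κ hκ e2 p
  obtain ⟨d1, d2⟩ := h₂ κ hκ e1 p
  have g1 := h₃ κ T hκ e1 hT p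
  have g2 := h₄ κ T hκ e1 hT (hκT.trans e3)
    (hTκ.trans (mul_le_mul_of_nonneg_right e3 hτ.le)) p
  set r := lyap U Um Λ κ p
  set N := κ * stSq p
  have hcN := mul_nonneg hc₁.le hN
  have hr : 1 ≤ r := by linarith
  have hr0 : 0 < r := by linarith
  have hNr : N ≤ c₁⁻¹ * r := by
    rw [inv_mul_eq_div, le_div_iff₀ hc₁]; linarith
  have q1 : 0 ≤ K₂ / c₁ := by positivity
  have q2 : 0 ≤ K₃ * (1 + c₁⁻¹) := by positivity
  refine ⟨?_, ?_, ?_, ?_, ?_, d1, ?_⟩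
  · have := mul_le_mul_of_nonneg_right (min_le_left c₁ (c₄ / K₁)) hN
    linarith
  · refine b2.trans (mul_le_mul_of_nonneg_right ?_ (by linarith))
    linarith
  · have h : |lyapRate U Um Λ κ κ' p| ≤ 2 * r := by
      rw [lyapRate, abs_mul, abs_of_nonpos hκ'0, abs_of_nonneg b3]
      exact (mul_le_mul_of_nonneg_right hκ' b3).trans b4
    refine h.trans (mul_le_mul_of_nonneg_right ?_ hr0.le)
    linarith
  · refine g1.trans ?_
    calc K₃ * (1 + T⁻¹) * (1 + N) ≤ K₃ * (1 + T⁻¹) * ((1 + c₁⁻¹) * r) := by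
          refine mul_le_mul_of_nonneg_left ?_ (by positivity)
          linarith
      _ = K₃ * (1 + c₁⁻¹) * ((1 + T⁻¹) * r) := by ring
      _ ≤ _ := by
          rw [mul_assoc (_ + _)]
          refine mul_le_mul_of_nonneg_right ?_ (by positivity)
          linarith
  · have h : lyapRate U Um Λ κ κ' p ≤ 0 := mul_nonpos_of_nonpos_of_nonneg hκ'0 b3
    have h' : c₄ / K₁ * r ≤ c₄ + c₄ * N := by
      rw [div_mul_eq_mul_div, div_le_iff₀ hK₁]
      have := mul_le_mul_of_nonneg_left b2 hc₄.le
      linarith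
    have h'' := mul_le_mul_of_nonneg_right (min_le_right c₁ (c₄ / K₁)) hr0.le
    rw [lyapDrift]
    have : κ * (K₄ - c₄ * N) ≤ κ * ((2 + K₁ + K₂ / c₁ + K₃ * (1 + c₁⁻¹) + K₄ + c₄) -
        min c₁ (c₄ / K₁) * r) := by
      refine mul_le_mul_of_nonneg_left ?_ hκ.le
      linarith
    linarith
  · refine d2.trans (mul_le_mul_of_nonneg_left ?_ hκ.le)
    calc K₂ * N ≤ K₂ * (c₁⁻¹ * r) := mul_le_mul_of_nonneg_left hNr hK₂.le
      _ = K₂ / c₁ * r := by ring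
      _ ≤ _ := by
        refine mul_le_mul_of_nonneg_right ?_ hr0.le
        linarith

end Drift

section Flow

variable {n m : ℕ} {U : (Fin n → ℝ) → ℝ} {Um : ℝ} {Λ : Matrix (Fin n) (Fin m) ℝ}

theorem measurable_log_lyap (hU : ContDiff ℝ ∞ U) (κ : ℝ) :
    Measurable fun p : St n m => log (lyap U Um Λ κ p) :=
  (contDiff_lyap Um Λ κ hU).continuous.measurable.log

/-- Coefficient of the first derivative in the evolution of functions of `log r`. -/
def logDrift (D Γ r : ℝ) : ℝ := (D - Γ / r) / r

/-- Coefficient of the second derivative in the evolution of functions of `log r`. -/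
def logCarre (Γ r : ℝ) : ℝ := Γ / r ^ 2

theorem hasDerivAt_comp_log {H : ℝ → ℝ} (hH : ContDiff ℝ ∞ H) {x : ℝ} (hx : 0 < x) :
    HasDerivAt (fun x => H (log x)) (deriv H (log x) * x⁻¹) x :=
  ((hH.differentiable (by simp)).differentiableAt.hasDerivAt).comp x (hasDerivAt_log hx.ne')

theorem hasDerivAt_deriv_comp_log {H : ℝ → ℝ} (hH : ContDiff ℝ ∞ H) {x : ℝ} (hx : 0 < x) :
    HasDerivAt (fun x => deriv H (log x) * x⁻¹)
      ((deriv (deriv H) (log x) - deriv H (log x)) / x ^ 2) x := by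
  have h := (hasDerivAt_comp_log (contDiff_infty_iff_deriv.1 hH).2 hx).mul (hasDerivAt_inv hx.ne')
  refine h.congr_deriv ?_
  field_simp
  ring

theorem contDiff_comp_log_lyap (hU : ContDiff ℝ ∞ U) {κ : ℝ}
    (hr : ∀ p : St n m, 0 < lyap U Um Λ κ p) {H : ℝ → ℝ} (hH : ContDiff ℝ ∞ H) :
    ContDiff ℝ ∞ fun p : St n m => H (log (lyap U Um Λ κ p)) :=
  hH.comp ((contDiff_lyap Um Λ κ hU).log fun p => (hr p).ne')

theorem hasCompactSupport_comp_log_lyap {κ c : ℝ} (hκ : 0 < κ) (hc : 0 < c)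
    (hr : ∀ p : St n m, 1 + c * (κ * stSq p) ≤ lyap U Um Λ κ p) {H : ℝ → ℝ}
    (hH : HasCompactSupport H) :
    HasCompactSupport fun p : St n m => H (log (lyap U Um Λ κ p)) := by
  obtain ⟨R, hR⟩ := hH.isCompact.isBounded.subset_closedBall 0
  refine HasCompactSupport.intro (isCompact_closedBall 0 (√(exp R / (c * κ)))) fun p hp => ?_
  by_contra hne
  refine hp ?_
  have h1 := hR (subset_tsupport H hne)
  rw [mem_closedBall_zero_iff, Real.norm_eq_abs] at h1
  have hr0 : 0 < lyap U Um Λ κ p := by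
    have := mul_nonneg hc.le (mul_nonneg hκ.le (stSq_nonneg p))
    linarith [hr p]
  have h2 : lyap U Um Λ κ p ≤ exp R := by
    rw [← log_le_iff_le_exp hr0]; exact (le_abs_self _).trans h1
  rw [mem_closedBall_zero_iff]
  refine le_sqrt_of_sq_le ((norm_sq_le_stSq p).trans ?_)
  rw [le_div_iff₀ (by positivity)]
  linarith [hr p]

theorem isMomentFlow_log_lyap (hU : ContDiff ℝ ∞ U)
    {A : Matrix (Fin m) (Fin m) ℝ} {lam : Matrix (Fin m) (Fin n) ℝ} {T : ℝ → ℝ}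
    (hT : Continuous T) (hT0 : ∀ t, 0 < T t) {u : ℝ → St n m → ℝ}
    (hu : ∀ t, ContDiff ℝ ∞ (u t)) (hu0 : ∀ t p, 0 ≤ u t p) (hu1 : ∀ t, ∫ p, u t p = 1)
    (hfp : ∀ t, 0 ≤ t → ∀ p, HasDerivAt (fun s => u s p) (genLadj U A lam (T t) (u t) p) t)
    {κ κ' : ℝ → ℝ} {ε c K : ℝ} (hc : 0 < c) (hK : 0 < K) (hκ : ∀ t, 0 ≤ t → 0 < κ t)
    (hκε : ∀ t, 0 ≤ t → κ t ≤ ε) (hκ' : ∀ t, 0 ≤ t → HasDerivAt κ (κ' t) t)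
    (hb : ∀ t, 0 ≤ t → ∀ p : St n m,
      1 + c * (κ t * stSq p) ≤ lyap U Um Λ (κ t) p ∧
      |lyapRate U Um Λ (κ t) (κ' t) p| ≤ K * lyap U Um Λ (κ t) p ∧
      |genL U A lam (T t) (lyap U Um Λ (κ t)) p| ≤ K * (1 + (T t)⁻¹) * lyap U Um Λ (κ t) p ∧
      0 ≤ carre A (lyap U Um Λ (κ t)) p ∧
      carre A (lyap U Um Λ (κ t)) p ≤ κ t * (K * lyap U Um Λ (κ t) p)) :
    IsMomentFlow volume u (fun t p => log (lyap U Um Λ (κ t) p))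
      (fun t p => logDrift (lyapDrift U Um A lam Λ (T t) (κ t) (κ' t) p)
        (carre A (lyap U Um Λ (κ t)) p) (lyap U Um Λ (κ t) p))
      (fun t p => logCarre (carre A (lyap U Um Λ (κ t)) p) (lyap U Um Λ (κ t) p)) := by
  have hint : ∀ t, Integrable (u t) := fun t => integrable_of_integral_eq_one (hu1 t)
  have hr1 : ∀ t, 0 ≤ t → ∀ p : St n m, 1 ≤ lyap U Um Λ (κ t) p := fun t ht p => by
    have := mul_nonneg hc.le (mul_nonneg (hκ t ht).le (stSq_nonneg p))
    linarith [(hb t ht p).1]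
  have hr0 : ∀ t, 0 ≤ t → ∀ p : St n m, 0 < lyap U Um Λ (κ t) p := fun t ht p =>
    zero_lt_one.trans_le (hr1 t ht p)
  have hrm : ∀ t, Measurable (lyap U Um Λ (κ t)) := fun t =>
    (contDiff_lyap Um Λ (κ t) hU).continuous.measurable
  have hΓm : ∀ t, Measurable (carre A (lyap U Um Λ (κ t))) := fun t =>
    (continuous_carre A (contDiff_lyap Um Λ (κ t) hU)).measurable
  have hLm : ∀ t, Measurable (genL U A lam (T t) (lyap U Um Λ (κ t))) := fun t =>
    (continuous_genL hU A lam (T t) (contDiff_lyap Um Λ (κ t) hU)).measurable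
  have hRm : ∀ t, Measurable (lyapRate U Um Λ (κ t) (κ' t) : St n m → ℝ) := fun t =>
    (continuous_lyapRate hU Um Λ (κ t) (κ' t)).measurable
  have hε : 0 ≤ ε := (hκ 0 le_rfl).le.trans (hκε 0 le_rfl)
  have hΓb : ∀ t, 0 ≤ t → ∀ p : St n m,
      |carre A (lyap U Um Λ (κ t)) p / lyap U Um Λ (κ t) p ^ 2| ≤ ε * K := fun t ht p => by
    obtain ⟨-, -, -, d1, d2⟩ := hb t ht p
    have hp := hr0 t ht p
    rw [abs_of_nonneg (by positivity), div_le_iff₀ (by positivity)]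
    calc _ ≤ κ t * (K * lyap U Um Λ (κ t) p) := d2
      _ ≤ ε * (K * lyap U Um Λ (κ t) p ^ 2) := by
        refine mul_le_mul (hκε t ht) ?_ (by positivity) hε
        refine mul_le_mul_of_nonneg_left ?_ hK.le
        nlinarith [hr1 t ht p]
      _ = _ := by ring
  have hLb : ∀ t, 0 ≤ t → ∀ p : St n m, |genL U A lam (T t) (lyap U Um Λ (κ t)) p /
      lyap U Um Λ (κ t) p| ≤ K * (1 + (T t)⁻¹) := fun t ht p => by
    have hp := hr0 t ht p
    rw [abs_div, abs_of_pos hp, div_le_iff₀ hp]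
    exact (hb t ht p).2.2.1
  have hRb : ∀ t, 0 ≤ t → ∀ p : St n m, |lyapRate U Um Λ (κ t) (κ' t) p /
      lyap U Um Λ (κ t) p| ≤ K := fun t ht p => by
    have hp := hr0 t ht p
    rw [abs_div, abs_of_pos hp, div_le_iff₀ hp]
    exact (hb t ht p).2.1
  refine ⟨hu0, hint, hu1, fun t ht p => log_nonneg (hr1 t ht p),
    fun t _ => measurable_log_lyap hU (κ t), fun t _ => ?_, fun t _ => ?_, fun t₁ => ?_, ?_, ?_⟩
  · exact ((((hRm t).add (hLm t)).sub ((hΓm t).div (hrm t))).div (hrm t))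
  · exact (hΓm t).div ((hrm t).pow_const 2)
  · obtain ⟨B, hB⟩ := (isCompact_Icc (a := (0 : ℝ)) (b := t₁)).exists_bound_of_continuousOn
      (hT.inv₀ fun t => (hT0 t).ne').continuousOn
    refine ⟨K + K * (1 + B) + ε * K, fun t ht p => ?_⟩
    have hBt : (T t)⁻¹ ≤ B := (le_abs_self _).trans (hB t ht)
    have hB0 : 0 ≤ B := (inv_pos.2 (hT0 t)).le.trans hBt
    have b1 := hΓb t ht.1 p
    have b2 := hLb t ht.1 p
    have b3 := hRb t ht.1 p
    have b4 : K * (1 + (T t)⁻¹) ≤ K * (1 + B) := by gcongr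
    have hp := hr0 t ht.1 p
    constructor
    · have e : logDrift (lyapDrift U Um A lam Λ (T t) (κ t) (κ' t) p)
          (carre A (lyap U Um Λ (κ t)) p) (lyap U Um Λ (κ t) p) =
          lyapRate U Um Λ (κ t) (κ' t) p / lyap U Um Λ (κ t) p +
          genL U A lam (T t) (lyap U Um Λ (κ t)) p / lyap U Um Λ (κ t) p -
          carre A (lyap U Um Λ (κ t)) p / lyap U Um Λ (κ t) p ^ 2 := by
        rw [logDrift, lyapDrift]
        field_simp
      rw [e]
      refine (abs_sub _ _).trans ?_
      refine (add_le_add_left (abs_add_le _ _) _).trans ?_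
      linarith
    · refine b1.trans ?_
      have : 0 ≤ K * (1 + B) := by positivity
      linarith
  · intro H hH hHc t ht
    have hH' := (contDiff_infty_iff_deriv.1 hH).2
    have hH'' := (contDiff_infty_iff_deriv.1 hH').2
    obtain ⟨M, hM⟩ := hHc.exists_bound_of_continuous hH.continuous
    obtain ⟨M₁, hM₁⟩ := hHc.deriv.exists_bound_of_continuous hH'.continuous
    obtain ⟨M₂, hM₂⟩ := hHc.deriv.deriv.exists_bound_of_continuous hH''.continuous
    have hM₁0 : 0 ≤ M₁ := (norm_nonneg _).trans (hM₁ 0)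
    have hD := hasDerivAt_integral_genL hU hT hT0 hu hu0 hu1 (fun t ht => hfp t ht.le)
      (contDiff_comp_log_lyap hU (hr0 t ht.le) hH)
      (hasCompactSupport_comp_log_lyap (hκ t ht.le) hc (fun p => (hb t ht.le p).1) hHc) ht
    have key := hasDerivAt_integral_mul_of_density (μ := volume) (u := u)
      (φ := fun s p => H (log (lyap U Um Λ (κ s) p)))
      (ψ := fun s p => deriv H (log (lyap U Um Λ (κ s) p)) *
        (lyapRate U Um Λ (κ s) (κ' s) p / lyap U Um Λ (κ s) p)) (B := M) (M := M₁ * K)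
      hint hu0 hu1 (fun p => (hfp t ht.le p).continuousAt)
      (.of_forall fun s => hH.continuous.measurable.comp (measurable_log_lyap hU (κ s)))
      (.of_forall fun s p => hM _) ?_ hD
    · refine key.congr_deriv ?_
      have hcomp := genL_comp (H₁ := fun x => deriv H (log x) * x⁻¹)
        (H₂ := fun x => (deriv (deriv H) (log x) - deriv H (log x)) / x ^ 2)
        (contDiff_lyap Um Λ (κ t) hU)
        (fun p => hasDerivAt_comp_log hH (hr0 t ht.le p))
        (fun p => hasDerivAt_deriv_comp_log hH (hr0 t ht.le p)) A lam (T t) (U := U)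
      have i1 : Integrable fun p => deriv H (log (lyap U Um Λ (κ t) p)) *
          (lyapRate U Um Λ (κ t) (κ' t) p / lyap U Um Λ (κ t) p) * u t p := by
        refine (hint t).bdd_mul (c := M₁ * K) ?_ (.of_forall fun p => ?_)
        · exact ((hH'.continuous.measurable.comp (measurable_log_lyap hU (κ t))).mul
            ((hRm t).div (hrm t))).aestronglyMeasurable
        · rw [Real.norm_eq_abs, abs_mul]
          exact mul_le_mul (hM₁ _) (hRb t ht.le p) (abs_nonneg _) hM₁0
      have i2 : Integrable fun p =>
          genL U A lam (T t) (fun q => H (log (lyap U Um Λ (κ t) q))) p * u t p := by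
        refine (hint t).bdd_mul (c := M₁ * (K * (1 + (T t)⁻¹)) + (M₂ + M₁) * (ε * K)) ?_
          (.of_forall fun p => ?_)
        · exact (continuous_genL hU A lam (T t)
            (contDiff_comp_log_lyap hU (hr0 t ht.le) hH)).aestronglyMeasurable
        · have e : genL U A lam (T t) (fun q => H (log (lyap U Um Λ (κ t) q))) p =
              deriv H (log (lyap U Um Λ (κ t) p)) *
                (genL U A lam (T t) (lyap U Um Λ (κ t)) p / lyap U Um Λ (κ t) p) +
              (deriv (deriv H) (log (lyap U Um Λ (κ t) p)) - deriv H (log (lyap U Um Λ (κ t) p))) *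
                (carre A (lyap U Um Λ (κ t)) p / lyap U Um Λ (κ t) p ^ 2) := by
            rw [hcomp]; ring
          rw [e, Real.norm_eq_abs]
          refine (abs_add_le _ _).trans (add_le_add ?_ ?_)
          · rw [abs_mul]
            exact mul_le_mul (hM₁ _) (hLb t ht.le p) (abs_nonneg _) hM₁0
          · rw [abs_mul]
            exact mul_le_mul ((abs_sub _ _).trans (add_le_add (hM₂ _) (hM₁ _)))
              (hΓb t ht.le p) (abs_nonneg _)
              (add_nonneg ((norm_nonneg _).trans (hM₂ 0)) hM₁0)
      rw [← integral_add i1 i2]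
      refine integral_congr_ae (.of_forall fun p => ?_)
      have hp := hr0 t ht.le p
      simp only [hcomp, logDrift, logCarre, lyapDrift]
      field_simp
      ring
    · filter_upwards [lt_mem_nhds ht] with s hs p
      have hp := hr0 s hs.le p
      constructor
      · refine ((hasDerivAt_comp_log hH hp).comp s
          (hasDerivAt_lyap U Um Λ (hκ' s hs.le) p)).congr_deriv ?_
        ring
      · rw [abs_mul]
        exact mul_le_mul (hM₁ _) (hRb s hs.le p) (abs_nonneg _) hM₁0
  · intro H hH hHc
    obtain ⟨M, hM⟩ := hHc.exists_bound_of_continuous hH.continuous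
    refine tendsto_integral_mul_of_density (M := M) hint (hint 0) hu0 hu1 (hu1 0)
      (fun p => (hfp 0 le_rfl p).continuousAt.continuousWithinAt)
      (fun s => (hH.continuous.measurable.comp (measurable_log_lyap hU (κ s))).aestronglyMeasurable)
      (.of_forall fun s p => hM _) fun p => ?_
    have h := (hasDerivAt_comp_log hH (hr0 0 le_rfl p)).comp 0
      (hasDerivAt_lyap U Um Λ (hκ' 0 le_rfl) p)
    exact h.continuousAt.continuousWithinAt

end Flow

section Schedule

theorem one_le_log_exp_one_add {t : ℝ} (ht : 0 ≤ t) : 1 ≤ log (exp 1 + t) := by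
  rw [le_log_iff_exp_le (by positivity)]
  linarith

theorem exists_le_mul_log {T : ℝ → ℝ} (hT : Continuous T) (hT0 : ∀ t, 0 < T t) {E : ℝ}
    (hE : 0 < E) (h : ∀ᶠ t in atTop, E / log t ≤ T t) :
    ∃ c, 0 < c ∧ ∀ t, 0 ≤ t → c ≤ T t * log (exp 1 + t) := by
  obtain ⟨t₀, ht₀⟩ := eventually_atTop.1 (h.and (eventually_gt_atTop 1))
  obtain ⟨s, -, hs⟩ := (isCompact_Icc (a := (0 : ℝ)) (b := max 0 t₀)).exists_isMinOn
    (Set.nonempty_Icc.2 (le_max_left _ _)) hT.continuousOn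
  refine ⟨min E (T s), lt_min hE (hT0 s), fun t ht => ?_⟩
  rcases le_total t₀ t with h1 | h1
  · obtain ⟨h2, h3⟩ := ht₀ t h1
    have h4 : 0 < log t := log_pos h3
    refine (min_le_left _ _).trans (((div_le_iff₀ h4).1 h2).trans ?_)
    refine mul_le_mul_of_nonneg_left (log_le_log (by linarith) ?_) (hT0 t).le
    linarith [exp_pos 1]
  · have h2 : T s ≤ T t := hs ⟨ht, h1.trans (le_max_right _ _)⟩
    refine (min_le_right _ _).trans (h2.trans ?_)
    exact le_mul_of_one_le_right (hT0 t).le (one_le_log_exp_one_add ht)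

theorem exists_forall_le_of_tendsto_zero {T : ℝ → ℝ} (hT : Continuous T)
    (h : Tendsto T atTop (𝓝 0)) : ∃ B, 0 < B ∧ ∀ t, 0 ≤ t → T t ≤ B := by
  obtain ⟨t₀, ht₀⟩ := eventually_atTop.1 (h.eventually_le_const zero_lt_one)
  obtain ⟨B, hB⟩ := (isCompact_Icc (a := (0 : ℝ)) (b := t₀)).exists_bound_of_continuousOn
    hT.continuousOn
  refine ⟨max 1 B, by positivity, fun t ht => ?_⟩
  rcases le_total t₀ t with h1 | h1
  · exact (ht₀ t h1).trans (le_max_left _ _)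
  · exact ((le_abs_self _).trans (hB t ⟨ht, h1⟩)).trans (le_max_right _ _)

theorem hasDerivAt_div_log {η t : ℝ} (ht : 0 ≤ t) :
    HasDerivAt (fun s => η / log (exp 1 + s)) (-(η / (log (exp 1 + t) ^ 2 * (exp 1 + t)))) t := by
  have h0 : exp 1 + t ≠ 0 := by positivity
  have h1 : log (exp 1 + t) ≠ 0 := by linarith [one_le_log_exp_one_add ht]
  refine ((((hasDerivAt_id t).const_add (exp 1)).log h0).inv h1 |>.const_mul η).congr_deriv ?_
  simp only [id]
  field_simp

end Schedule

section Moments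

variable {n m : ℕ}

theorem mul_logDrift_add_le {k κ c K D Γ r : ℝ} (hk : 0 ≤ k) (hr : 0 < r)
    (hD : D ≤ κ * (K - c * r)) (hΓ0 : 0 ≤ Γ) (hΓ : Γ ≤ κ * (K * r)) :
    k * logDrift D Γ r + k ^ 2 * logCarre Γ r ≤ κ * ((k + k ^ 2) * K * r⁻¹ - k * c) := by
  have e : k * logDrift D Γ r + k ^ 2 * logCarre Γ r =
      (k * (D * r) + (k ^ 2 - k) * Γ) / r ^ 2 := by
    rw [logDrift, logCarre]
    field_simp
    ring
  have e' : κ * ((k + k ^ 2) * K * r⁻¹ - k * c) =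
      (k * (κ * (K - c * r) * r) + k ^ 2 * (κ * (K * r))) / r ^ 2 := by
    field_simp
    ring
  rw [e, e']
  have h1 := mul_le_mul_of_nonneg_left (mul_le_mul_of_nonneg_right hD hr.le) hk
  have h2 := mul_le_mul_of_nonneg_left hΓ (sq_nonneg k)
  have h3 := mul_nonneg hk hΓ0
  gcongr
  linarith

theorem integral_stSq_pow_le {μ : Measure (St n m)} {u r : St n m → ℝ} {κ c K M : ℝ} {k : ℕ}
    (hκ : 0 < κ) (hc : 0 < c) (hK : 0 ≤ K) (hu : Integrable u μ) (hu0 : ∀ p, 0 ≤ u p)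
    (hrm : Measurable r) (hr : ∀ p, 1 + c * (κ * stSq p) ≤ r p)
    (hr' : ∀ p, r p ≤ K * (1 + κ * stSq p)) (hM : ∫ p, r p ^ k * u p ∂μ ≤ M) :
    ∫ p, stSq p ^ k * u p ∂μ ≤ ((c * κ)⁻¹) ^ k * max M 0 := by
  have hN : ∀ p : St n m, 0 ≤ κ * stSq p := fun p => mul_nonneg hκ.le (stSq_nonneg p)
  have hr0 : ∀ p, 0 ≤ r p := fun p => by linarith [hr p, mul_nonneg hc.le (hN p)]
  by_cases hi : Integrable (fun p => stSq p ^ k * u p) μ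
  · have hri : Integrable (fun p => r p ^ k * u p) μ := by
      have hdom : Integrable (fun p => K ^ k * (2 ^ (k - 1) *
          (u p + κ ^ k * (stSq p ^ k * u p)))) μ :=
        ((hu.add (hi.const_mul _)).const_mul _).const_mul _
      refine hdom.mono' ((hrm.pow_const k).aestronglyMeasurable.mul hu.aestronglyMeasurable)
        (.of_forall fun p => ?_)
      rw [Real.norm_eq_abs, abs_of_nonneg (mul_nonneg (pow_nonneg (hr0 p) k) (hu0 p))]
      have h1 : r p ^ k ≤ K ^ k * (2 ^ (k - 1) * (1 ^ k + (κ * stSq p) ^ k)) := by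
        refine (pow_le_pow_left₀ (hr0 p) (hr' p) k).trans ?_
        rw [mul_pow]
        exact mul_le_mul_of_nonneg_left (add_pow_le zero_le_one (hN p) k) (by positivity)
      refine (mul_le_mul_of_nonneg_right h1 (hu0 p)).trans (le_of_eq ?_)
      rw [one_pow, mul_pow]
      ring
    calc ∫ p, stSq p ^ k * u p ∂μ ≤ ∫ p, ((c * κ)⁻¹) ^ k * (r p ^ k * u p) ∂μ := by
          refine integral_mono hi (hri.const_mul _) fun p => ?_
          have h1 : stSq p ≤ (c * κ)⁻¹ * r p := by
            rw [inv_mul_eq_div, le_div_iff₀ (by positivity)]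
            linarith [hr p]
          have h2 := mul_le_mul_of_nonneg_right (pow_le_pow_left₀ (stSq_nonneg p) h1 k) (hu0 p)
          rwa [mul_pow, mul_assoc] at h2
      _ = ((c * κ)⁻¹) ^ k * ∫ p, r p ^ k * u p ∂μ := integral_const_mul _ _
      _ ≤ _ := mul_le_mul_of_nonneg_left (hM.trans (le_max_left _ _)) (by positivity)
  · rw [integral_undef hi]
    positivity

theorem exists_integral_stSq_pow_le {U : (Fin n → ℝ) → ℝ} (hU : ContDiff ℝ ∞ U)
    {abar : Fin n → ℝ} (habar : ∀ i, 0 < abar i)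
    {r1 r2 Ug : ℝ} (hr1 : 0 < r1) (hr2 : 0 < r2) (hUg : 0 < Ug) {Um UM : ℝ}
    (hUlow : ∀ x, sqnorm (fun i => abar i * x i) + Um ≤ U x)
    (hUup : ∀ x, U x ≤ sqnorm (fun i => abar i * x i) + UM)
    (hgrad1 : ∀ x, r1 * sqnorm x - Ug ≤ ∑ i, gradp U x i * x i)
    (hgrad2 : ∀ x, sqnorm (gradp U x) ≤ r2 * sqnorm x + Ug)
    {A : Matrix (Fin m) (Fin m) ℝ} {Ac : ℝ} (hAc : 0 < Ac)
    (hApd : ∀ v : Fin m → ℝ, Ac * sqnorm v ≤ ∑ j, v j * A.mulVec v j)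
    {lam : Matrix (Fin m) (Fin n) ℝ} {Λ : Matrix (Fin n) (Fin m) ℝ} (hΛ : Λ * lam = 1)
    {T : ℝ → ℝ} (hT : Continuous T) (hT0 : ∀ t, 0 < T t) (hTlim : Tendsto T atTop (𝓝 0))
    {E : ℝ} (hE : UM - Um < E) (hTlb : ∀ᶠ t in atTop, E / log t ≤ T t) {u : ℝ → St n m → ℝ}
    (hu : ∀ t, ContDiff ℝ ∞ (u t)) (hu0 : ∀ t p, 0 ≤ u t p) (hu1 : ∀ t, ∫ p, u t p = 1)
    (hfp : ∀ t, 0 ≤ t → ∀ p, HasDerivAt (fun s => u s p) (genLadj U A lam (T t) (u t) p) t)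
    {k : ℕ} (hk : 0 < k) :
    ∃ C, ∀ t, 0 ≤ t → ∫ p, stSq p ^ k * u t p ≤ C * log (exp 1 + t) ^ k := by
  have hE0 : 0 < E := by linarith [(hUlow 0).trans (hUup 0)]
  obtain ⟨c₀, hc₀, hTc⟩ := exists_le_mul_log hT hT0 hE0 hTlb
  obtain ⟨B, hB, hTB⟩ := exists_forall_le_of_tendsto_zero hT hTlim
  obtain ⟨ε, c, K, hε, hc, hK, hb⟩ := exists_lyapDrift_bounds (m := m) hU habar hr1 hr2 hUg hUlow
    hUup hgrad1 hgrad2 hAc hApd hΛ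
  obtain ⟨η, hη, hη1, hη2, hη3⟩ : ∃ η, 0 < η ∧ η ≤ ε ∧ η ≤ ε * c₀ ∧ η * B ≤ ε := by
    refine ⟨min ε (min (ε * c₀) (ε / B)), by positivity, min_le_left _ _,
      (min_le_right _ _).trans (min_le_left _ _), ?_⟩
    rw [← le_div_iff₀ hB]
    exact (min_le_right _ _).trans (min_le_right _ _)
  set κ : ℝ → ℝ := fun t => η / log (exp 1 + t) with hκdef
  set κ' : ℝ → ℝ := fun t => -(η / (log (exp 1 + t) ^ 2 * (exp 1 + t))) with hκ'def
  have hl : ∀ t : ℝ, 0 ≤ t → 0 < log (exp 1 + t) := fun t ht =>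
    zero_lt_one.trans_le (one_le_log_exp_one_add ht)
  have hκ : ∀ t, 0 ≤ t → 0 < κ t := fun t ht => div_pos hη (hl t ht)
  have hκη : ∀ t, 0 ≤ t → κ t ≤ η := fun t ht =>
    div_le_self hη.le (one_le_log_exp_one_add ht)
  have hbt := fun (t : ℝ) (ht : 0 ≤ t) => hb (κ t) (κ' t) (T t) (hκ t ht)
    ((hκη t ht).trans hη1) (hT0 t)
    (by
      rw [← div_eq_mul_inv, div_le_iff₀ (hT0 t), div_le_iff₀ (hl t ht), mul_assoc]
      exact hη2.trans (mul_le_mul_of_nonneg_left (hTc t ht) hε.le))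
    (by
      rw [← div_eq_mul_inv, le_div_iff₀ (hT0 t)]
      exact (mul_le_mul (hκη t ht) (hTB t ht) (hT0 t).le hη.le).trans hη3)
    (by
      have := hl t ht
      simp only [hκ'def, Left.neg_nonpos_iff]
      positivity)
    (by
      have h1 := one_le_log_exp_one_add ht
      have h2 := hl t ht
      simp only [hκ'def, hκdef, neg_neg]
      refine div_le_div_of_nonneg_left hη.le h2 ?_
      have h3 : 1 ≤ exp 1 + t := by linarith [add_one_le_exp (1 : ℝ)]
      nlinarith [mul_le_mul h1 h3 zero_le_one h2.le])
  have hflow := isMomentFlow_log_lyap (Um := Um) (Λ := Λ) hU hT hT0 hu hu0 hu1 hfp hc hK hκ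
    (fun t ht => (hκη t ht)) (fun t ht => hasDerivAt_div_log ht) fun t ht p => by
      obtain ⟨b1, -, b3, b4, -, b6, b7⟩ := hbt t ht p
      exact ⟨b1, b3, b4, b6, b7⟩
  have hr0 : ∀ t, 0 ≤ t → ∀ p : St n m, 0 < lyap U Um Λ (κ t) p := fun t ht p => by
    have := mul_nonneg hc.le (mul_nonneg (hκ t ht).le (stSq_nonneg p))
    linarith [(hbt t ht p).1]
  have hk0 : (0 : ℝ) < k := by exact_mod_cast hk
  obtain ⟨M, hM⟩ := hflow.exists_integral_exp_le (k := k) (C := (k + k ^ 2) * K) (c := k * c)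
    hk0.le (by positivity) (by positivity) (fun t ht => (hκ t ht).le) fun t ht p => by
      obtain ⟨-, -, -, -, b5, b6, b7⟩ := hbt t ht p
      rw [exp_neg, exp_log (hr0 t ht p)]
      exact mul_logDrift_add_le hk0.le (hr0 t ht p) b5 b6 b7
  refine ⟨((c * η)⁻¹) ^ k * max M 0, fun t ht => ?_⟩
  have hMt : ∫ p, lyap U Um Λ (κ t) p ^ k * u t p ≤ M := by
    refine le_of_eq_of_le (integral_congr_ae (.of_forall fun p => ?_)) (hM t ht)
    simp only [exp_nat_mul, exp_log (hr0 t ht p)]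
  refine (integral_stSq_pow_le (hκ t ht) hc hK.le (integrable_of_integral_eq_one (hu1 t)) (hu0 t)
    (contDiff_lyap Um Λ (κ t) hU).continuous.measurable (fun p => (hbt t ht p).1)
    (fun p => (hbt t ht p).2.1) hMt).trans (le_of_eq ?_)
  have e : (c * κ t)⁻¹ = (c * η)⁻¹ * log (exp 1 + t) := by
    have := (hl t ht).ne'
    simp only [hκdef]
    field_simp
  rw [e, mul_pow]
  ring

end Moments

end MomentBounds

/-- moment bounds for the process along the flow. -/
theorem stmt3 (n m : ℕ) (hn : 0 < n) (hm : 0 < m) (hnm : n ≤ m)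
    (U : (Fin n → ℝ) → ℝ) (hU : ContDiff ℝ (⊤ : ℕ∞) U)
    (D2 : ℝ) (hD2 : ∀ x, ‖fderiv ℝ (fun y => fderiv ℝ U y) x‖ ≤ D2)
    (abar : Fin n → ℝ) (habar : ∀ i, 0 < abar i)
    (r1 r2 Ug : ℝ) (hr1 : 0 < r1) (hr2 : 0 < r2) (hUg : 0 < Ug) (Um UM : ℝ)
    (hUlow : ∀ x, sqnorm (fun i => abar i * x i) + Um ≤ U x)
    (hUup : ∀ x, U x ≤ sqnorm (fun i => abar i * x i) + UM)
    (hgrad1 : ∀ x, r1 * sqnorm x - Ug ≤ ∑ i, gradp U x i * x i)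
    (hgrad2 : ∀ x, sqnorm (gradp U x) ≤ r2 * sqnorm x + Ug)
    (A : Matrix (Fin m) (Fin m) ℝ) (Ac : ℝ) (hAc : 0 < Ac)
    (hApd : ∀ v : Fin m → ℝ, Ac * sqnorm v ≤ ∑ j, v j * A.mulVec v j)
    (lam : Matrix (Fin m) (Fin n) ℝ) (lamInv : Matrix (Fin n) (Fin m) ℝ)
    (hlamInv : lamInv * lam = 1)
    (T : ℝ → ℝ) (hTpos : ∀ t, 0 < T t) (hTdiff : ContDiff ℝ 1 T)
    (hTlim : Tendsto T atTop (nhds 0))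
    (E : ℝ) (hE : UM - Um < E)
    (hTlb : ∀ᶠ t in atTop, E / Real.log t ≤ T t)
    (Ttil : ℝ) (hTtil : 0 < Ttil)
    (hTder : ∀ᶠ t in atTop, -(Ttil / t) ≤ deriv T t ∧ deriv T t ≤ 0)
    (δ₀ : ℝ) (hδ₀ : 0 < δ₀) (hTconst : ∀ t ∈ Set.Icc (0:ℝ) δ₀, T t = T 0)
    (mFam : ℝ → St n m → ℝ)
    (hMsmooth : ∀ t, ContDiff ℝ (⊤ : ℕ∞) (mFam t))
    (hMpos : ∀ t p, 0 < mFam t p)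
    (hMprob : ∀ t, ∫ p : St n m, mFam t p = 1)
    (hFP : ∀ t : ℝ, 0 ≤ t → ∀ p : St n m,
      HasDerivAt (fun s => mFam s p) (genLadj U A lam (T t) (mFam t) p) t)
    (hM0grad : Integrable (fun p : St n m => gradSq (mFam 0) p / mFam 0 p))
    (pbar : ℕ) (hpbar : 2 ≤ pbar)
    (hM0mom : ∀ k : ℕ, 2 ≤ k → k ≤ pbar → Integrable (fun q : St n m =>
      (Real.sqrt (sqnorm q.1) ^ k + Real.sqrt (sqnorm q.2.1) ^ k +
        Real.sqrt (sqnorm q.2.2) ^ k) * mFam 0 q))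
    :
    ∀ k : ℕ, 2 ≤ k → k ≤ pbar → ∃ C : ℝ, ∀ t : ℝ, 0 ≤ t →
      (∫ q : St n m, (sqnorm q.1 + sqnorm q.2.1 + sqnorm q.2.2) ^ k * mFam t q) ≤
        C * Real.log (Real.exp 1 + t) ^ k := by
  intro k hk _
  exact exists_integral_stSq_pow_le hU habar hr1 hr2 hUg hUlow hUup hgrad1 hgrad2 hAc hApd hlamInv
    hTdiff.continuous hTpos hTlim hE hTlb hMsmooth (fun t p => (hMpos t p).le) hMprob hFP
    (two_pos.trans_le hk)
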